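/- The following rank-crank inequalities hold: N(0,8;4n+1) ≥ C(0,8;4n+1) for every integer n ≥ 2; N(0,8;4n+2) ≤ C(0,8;4n+2) for every integer n ≥ 2; and N(0,8;4n+3) ≥ C(0,8;4n+3) for every integer n ≥ 1. -/

import Mathlib

/-- The rank of a partition: its largest part minus its number of parts. -/
def partitionRank {n : ℕ} (π : n.Partition) : ℤ :=
  (π.parts.sup : ℤ) - π.parts.card

/-- The crank of a partition: the largest part if there are no parts equal to 1,
otherwise the number of parts larger than the number of ones minus the number of ones. -/
def partitionCrank {n : ℕ} (π : n.Partition) : ℤ :=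
  if π.parts.count 1 = 0 then (π.parts.sup : ℤ)
  else ((π.parts.filter (fun x => π.parts.count 1 < x)).card : ℤ) - π.parts.count 1

/-- `N(a,M;n)`: the number of partitions of `n` whose rank is congruent to `a` modulo `M`. -/
def rankCount (a : ℤ) (M : ℕ) (n : ℕ) : ℕ :=
  (Finset.univ.filter (fun π : n.Partition => partitionRank π % M = a % M)).card

/-- `C(a,M;n)`: the number of partitions of `n` whose crank is congruent to `a` modulo `M`. -/
def crankCount (a : ℤ) (M : ℕ) (n : ℕ) : ℕ :=
  (Finset.univ.filter (fun π : n.Partition => partitionCrank π % M = a % M)).card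


namespace RC
open PowerSeries Finset
set_option linter.all false


/-- the ring of complex power series -/
abbrev A := PowerSeries ℂ

theorem inv_cancel' {a : A} (h : constantCoeff a ≠ 0) : a * a⁻¹ = 1 := PowerSeries.mul_inv_cancel a h

/-- reciprocal q-Pochhammer `1/(a;X)_n` -/
noncomputable def ip (a : A) (n : ℕ) : A := ∏ k ∈ range n, (1 - a * X ^ k)⁻¹

theorem ip_succ (a : A) (n : ℕ) : ip a (n + 1) = ip a n * (1 - a * X ^ n)⁻¹ := prod_range_succ _ _

theorem ip_succ' (a : A) (n : ℕ) : ip a (n + 1) = (1 - a)⁻¹ * ip (a * X) n := by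
  unfold ip
  rw [prod_range_succ', mul_comm]
  simp [pow_succ', mul_assoc]

/-- q-Pochhammer in any ring -/
def qp {R : Type*} [CommRing R] (a q : R) (n : ℕ) : R := ∏ k ∈ range n, (1 - a * q ^ k)

theorem qp_zero {R : Type*} [CommRing R] (a q : R) : qp a q 0 = 1 := rfl

theorem qp_succ {R : Type*} [CommRing R] (a q : R) (n : ℕ) :
    qp a q (n + 1) = qp a q n * (1 - a * q ^ n) := prod_range_succ _ _

theorem qp_succ' {R : Type*} [CommRing R] (a q : R) (n : ℕ) :
    qp a q (n + 1) = (1 - a) * qp (a * q) q n := by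
  unfold qp
  rw [prod_range_succ', mul_comm]
  simp [pow_succ', mul_assoc]

theorem map_qp {R S : Type*} [CommRing R] [CommRing S] (f : R →+* S) (a q : R) (n : ℕ) :
    f (qp a q n) = qp (f a) (f q) n := by
  simp [qp, map_prod]

theorem cc_one_sub {a : A} (h : constantCoeff a = 0) : constantCoeff (1 - a) ≠ 0 := by
  simp [h]

theorem cc_qp {a q : A} (h : constantCoeff a = 0) (n : ℕ) : constantCoeff (qp a q n) = 1 := by
  rw [map_qp]; simp [qp, h]

theorem ip_eq (a : A) (n : ℕ) : ip a n = (qp a X n)⁻¹ := by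
  induction n with
  | zero => simp [ip, qp]
  | succ n ih => rw [ip_succ, qp_succ, PowerSeries.mul_inv_rev, ih, mul_comm]

theorem qp_mul_ip {a : A} (h : constantCoeff a = 0) (n : ℕ) : qp a X n * ip a n = 1 := by
  rw [ip_eq]; apply inv_cancel'; rw [cc_qp h]; simp

open scoped PowerSeries.WithPiTopology in
theorem hfac (u : ℂ) (i : ℕ) :
    1 + ∑' j : ℕ, (u ^ (j + 1)) • (X : A) ^ ((i + 1) * (j + 1)) = (1 - C u * X ^ (i + 1))⁻¹ := by
  have hs := Nat.Partition.summable_genFun_term (fun _ c => u ^ c) i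
  rw [PowerSeries.eq_inv_iff_mul_eq_one (by simp)]
  set S := ∑' j : ℕ, (u ^ (j + 1)) • (X : A) ^ ((i + 1) * (j + 1)) with hS
  have h1 : S = u • (X : A) ^ (i + 1) + (C u * X ^ (i + 1)) * S := by
    conv_lhs => rw [hS, hs.tsum_eq_zero_add]
    rw [hS, ← hs.tsum_mul_left]
    congr 1
    · simp
    · congr 1; ext1 j
      simp only [PowerSeries.smul_eq_C_mul, map_pow]; ring
  rw [PowerSeries.smul_eq_C_mul] at h1
  linear_combination h1

open scoped PowerSeries.WithPiTopology in
theorem genFun_fin (f : ℕ → ℕ → ℂ) (g : ℕ → A) (N : ℕ) (hN : ∀ i c, N < i → f i c = 0)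
    (hg :
      ∀ i < N, 1 + ∑' j : ℕ, f (i + 1) (j + 1) • (X : A) ^ ((i + 1) * (j + 1)) = g i) :
    Nat.Partition.genFun f = ∏ i ∈ range N, g i := by
  have h := Nat.Partition.hasProd_genFun f
  have h2 : HasProd (fun i ↦ (1 : A) + ∑' j, f (i + 1) (j + 1) • (X : A) ^ ((i + 1) * (j + 1)))
      (∏ i ∈ range N, (1 + ∑' j, f (i + 1) (j + 1) • (X : A) ^ ((i + 1) * (j + 1)))) := by
    apply hasProd_prod_of_ne_finset_one
    intro b hb
    have : ∀ c, f (b + 1) c = 0 := fun c => hN _ _ (by simp at hb; omega)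
    simp [this]
  rw [h.unique h2]
  exact prod_congr rfl fun i hi => hg i (by simpa using hi)

open scoped PowerSeries.WithPiTopology in
theorem hfac0 (i : ℕ) :
    1 + ∑' j : ℕ, (0 : ℂ) • (X : A) ^ ((i + 1) * (j + 1)) = 1 := by
  simp

open scoped PowerSeries.WithPiTopology in
theorem hfac1 (i k : ℕ) :
    1 + ∑' j : ℕ, (if j + 1 = k + 1 then (1 : ℂ) else 0) • (X : A) ^ ((i + 1) * (j + 1))
      = 1 + X ^ ((i + 1) * (k + 1)) := by
  rw [tsum_eq_single k]
  · simp
  · intro b hb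
    simp [hb]

/-- product over parts, expressed for a partition -/
theorem prod_pow_count (s : Multiset ℕ) (P : ℕ → Prop) [DecidablePred P] (u : ℂ) :
    s.toFinsupp.prod (fun i c => if P i then u ^ c else 1) = u ^ (s.filter P).card := by
  rw [Finsupp.prod, Multiset.toFinsupp_support]
  simp only [Multiset.toFinsupp_apply]
  rw [← Finset.prod_filter, Finset.prod_pow_eq_pow_sum]
  congr 1
  rw [← Multiset.toFinset_sum_count_eq, Multiset.toFinset_filter]
  apply Finset.sum_congr rfl
  intro i hi
  simp at hi
  rw [Multiset.count_filter_of_pos hi.2]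

end RC

set_option linter.all false
namespace RC
open PowerSeries Finset

theorem prod_bdd (s : Multiset ℕ) (m : ℕ) (w : ℂ) :
    s.toFinsupp.prod (fun i c => if i ≤ m then w ^ c else 0) =
      if s.sup ≤ m then w ^ s.card else 0 := by
  split_ifs with h
  · have h2 := prod_pow_count s (fun _ => True) w
    simp at h2
    rw [← h2]
    apply Finset.prod_congr rfl
    intro i hi
    simp at hi
    have : i ≤ m := (Multiset.le_sup hi).trans h
    simp [this]
  · rw [Multiset.sup_le] at h
    push Not at h
    obtain ⟨b, hb, hm⟩ := h
    apply Finset.prod_eq_zero (i := b)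
    · simpa using hb
    · simp [hm]

theorem gen_bdd (m : ℕ) (w : ℂ) :
    Nat.Partition.genFun (fun i c => if i ≤ m then w ^ c else 0) = ip (C w * X) m := by
  rw [genFun_fin _ (fun i => (1 - C w * X ^ (i + 1))⁻¹) m]
  · unfold ip
    apply prod_congr rfl
    intro i hi
    rw [pow_succ']; ring_nf
  · intro i c h; simp [h]
  · intro i hi
    rw [← hfac]
    simp [Nat.succ_le_of_lt hi]

theorem rank_gf {z : ℂ} (hz : z ≠ 0) {n N : ℕ} (hn : 1 ≤ n) (hN : n ≤ N) :
    ∑ p : n.Partition, z ^ (partitionRank p) =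
      coeff n (∑ m ∈ range N, C z ^ m * X ^ (m + 1) * ip (C z⁻¹ * X) (m + 1)) := by
  have h1 : ∀ m, C z ^ m * X ^ (m + 1) * ip (C z⁻¹ * X) (m + 1) =
      C z ^ (m + 1) * (ip (C z⁻¹ * X) (m + 1) - ip (C z⁻¹ * X) m) := by
    intro m
    rw [ip_succ]
    have : constantCoeff (1 - C z⁻¹ * X * X ^ m : A) ≠ 0 := by simp
    have h3 := inv_cancel' this
    have h4 : (C z * C z⁻¹ : A) = 1 := by rw [← map_mul, mul_inv_cancel₀ hz, map_one]
    linear_combination (-C z ^ (m+1) * ip (C z⁻¹ * X) m) * h3 - C z ^ m * X^(m+1) *  ip (C z⁻¹ * X) m * (1 - C z⁻¹ * X * X ^ m : A)⁻¹ * h4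
  rw [Finset.sum_congr rfl (fun m _ => h1 m)]
  simp only [map_sum, ← map_pow, coeff_C_mul, map_sub, ← gen_bdd, Nat.Partition.coeff_genFun,
    prod_bdd, ← Finset.sum_sub_distrib, Finset.mul_sum]
  rw [Finset.sum_comm]
  apply Finset.sum_congr rfl
  intro p _
  have hs : 1 ≤ p.parts.sup := by
    by_contra h
    have h0 : p.parts.sup = 0 := by omega
    have : p.parts = 0 := by
      apply Multiset.eq_zero_of_forall_notMem
      intro a ha
      have := Multiset.le_sup ha
      have := p.parts_pos ha
      omega
    have h3 := p.parts_sum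
    rw [this] at h3
    simp at h3; omega
  have hs2 : p.parts.sup ≤ n := by
    rw [Multiset.sup_le]
    intro b hb
    rw [← p.parts_sum]
    exact Multiset.le_sum_of_mem hb
  rw [Finset.sum_eq_single (p.parts.sup - 1)]
  · have e : p.parts.sup - 1 + 1 = p.parts.sup := by omega
    have e2 : ¬ p.parts.sup ≤ p.parts.sup - 1 := by omega
    rw [e, if_pos le_rfl, if_neg e2, sub_zero, partitionRank, zpow_sub₀ hz, inv_pow, zpow_natCast, zpow_natCast, div_eq_mul_inv]
  · intro b _ hb
    by_cases h : p.parts.sup ≤ b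
    · rw [if_pos (by omega), if_pos h, sub_self, mul_zero]
    · rw [if_neg (by omega), if_neg h, sub_self, mul_zero]
  · intro h
    simp at h; omega

/-- auxiliary sum -/
noncomputable def hh (z w a : A) (L : ℕ) : A := ∑ m ∈ range L, (z * a) ^ m * ip (a * w) (m + 1)

theorem hh_rec {z w a : A} (hzw : z * w = 1) (ha : constantCoeff a = 0) (L : ℕ) :
    (1 - a * w) * (1 - a * z) * hh z w a (L + 1) =
      1 + X * a ^ 2 * hh z w (a * X) L - (1 - a * w) * (z * a) ^ (L + 1) * ip (a * w) (L + 1) := by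
  have c0 : constantCoeff (1 - a * w) ≠ 0 := by simp [ha]
  have hi := inv_cancel' c0
  induction L with
  | zero =>
    have : ip (a * w) 1 = (1 - a * w)⁻¹ := by simp [ip]
    simp [hh, this]
    linear_combination hi
  | succ L ih =>
    have e1 : hh z w a (L + 1 + 1) = hh z w a (L + 1) + (z * a) ^ (L + 1) * ip (a * w) (L + 2) := by
      simp [hh, sum_range_succ]
    have e2 : hh z w (a * X) (L + 1) = hh z w (a * X) L + (z * (a * X)) ^ L * ip (a * X * w) (L + 1) := by
      simp [hh, sum_range_succ]
    have e3 : ip (a * w) (L + 2) = (1 - a * w)⁻¹ * ip (a * X * w) (L + 1) := by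
      rw [ip_succ']; congr 2; ring
    have e4 : ip (a * w) (L + 2) * (1 - a * w * X ^ (L + 1)) = ip (a * w) (L + 1) := by
      rw [ip_succ, mul_assoc, mul_comm _⁻¹, inv_cancel' (by simp [ha]), mul_one]
    have e5 : ip (a * X * w) (L + 1) = (1 - a * w) * ip (a * w) (L + 2) := by
      rw [e3]; linear_combination (-ip (a * X * w) (L + 1)) * hi
    rw [e1, e2, e5]
    rw [← e4] at ih
    linear_combination ih + hzw * ((z * a) ^ L * a ^ 2 * X ^ (L+1) * (1 - a * w) * ip (a * w) (L + 2))

/-- Durfee form of the rank generating function, truncated -/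
noncomputable def Rs (z w : A) (L : ℕ) : A :=
  ∑ n ∈ range L, X ^ (n ^ 2) * ip (z * X) n * ip (w * X) n

theorem rank_durfee_aux {z w : A} (hzw : z * w = 1) : ∀ (L j : ℕ),
    (X : A) ^ L ∣ (1 + X ^ (2 * j + 1) * hh z w (X ^ (j + 1)) L) -
     ∑ n ∈ range (L + 1), X ^ (n ^ 2 + 2 * j * n) * ip (z * X ^ (j + 1)) n *
        ip (w * X ^ (j + 1)) n := by
  intro L
  induction L with
  | zero => intro j; simp
  | succ L ih =>
    intro j
    have hr := hh_rec (a := X ^ (j + 1)) hzw (by simp) L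
    have c1 : constantCoeff (1 - X ^ (j + 1) * w : A) ≠ 0 := by simp
    have c2 : constantCoeff (1 - X ^ (j + 1) * z : A) ≠ 0 := by simp
    have i1 := inv_cancel' c1
    have i2 := inv_cancel' c2
    set U := (1 - X ^ (j + 1) * w : A)⁻¹
    set V := (1 - X ^ (j + 1) * z : A)⁻¹
    obtain ⟨c, hc⟩ := ih (j + 1)
    rw [Finset.sum_range_succ']
    have e : ∀ n, X ^ ((n + 1) ^ 2 + 2 * j * (n + 1)) * ip (z * X ^ (j + 1)) (n + 1) *
        ip (w * X ^ (j + 1)) (n + 1) = X ^ (2 * j + 1) * U * V *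
        (X ^ (n ^ 2 + 2 * (j + 1) * n) * ip (z * X ^ (j + 1 + 1)) n *
        ip (w * X ^ (j + 1 + 1)) n) := by
      intro n
      rw [ip_succ', ip_succ', mul_assoc z, mul_assoc w, ← pow_succ, mul_comm z (X ^ (j + 1)),
        mul_comm w (X ^ (j + 1))]
      ring
    rw [Finset.sum_congr rfl (fun n _ => e n), ← Finset.mul_sum]
    have hc' := sub_eq_iff_eq_add.mp hc
    refine ⟨X ^ (2 * j) * (U * V * c) - X ^ (2 * j + 1) * X ^ (j * (L + 1)) * V * z ^ (L + 1) *
      ip (X ^ (j + 1) * w) (L + 1), ?_⟩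
    have e0 : (X : A) ^ (0 ^ 2 + 2 * j * 0) * ip (z * X ^ (j + 1)) 0 * ip (w * X ^ (j + 1)) 0 = 1 := by
      simp [ip]
    rw [e0]
    have hr' : hh z w (X ^ (j + 1)) (L + 1) = U * V * (1 + X * (X ^ (j + 1)) ^ 2 * hh z w (X ^ (j + 1) * X) L - (1 - X ^ (j + 1) * w) * (z * X ^ (j + 1)) ^ (L + 1) * ip (X ^ (j + 1) * w) (L + 1)) := by
      rw [← hr]
      linear_combination (-hh z w (X ^ (j + 1)) (L + 1)) * i1 - (1 - X ^ (j + 1) * w) * U * hh z w (X ^ (j + 1)) (L + 1) * i2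
    rw [hr']
    rw [← pow_succ]
    linear_combination X ^ (2 * j + 1) * U * V * hc - X ^ (2 * j + 1) * V * (z * X ^ (j + 1)) ^ (L + 1) * ip (X ^ (j + 1) * w) (L + 1) * i1

theorem rank_durfee {z : ℂ} (hz : z ≠ 0) {n L : ℕ} (hn : 1 ≤ n) (hL : n < L) :
    ∑ p : n.Partition, z ^ (partitionRank p) = coeff n (Rs (C z) (C z⁻¹) (L + 1)) := by
  rw [rank_gf hz hn hL.le]
  have hzw : (C z * C z⁻¹ : A) = 1 := by rw [← map_mul, mul_inv_cancel₀ hz, map_one]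
  have h := rank_durfee_aux hzw L 0
  rw [X_pow_dvd_iff] at h
  have h2 := h n hL
  rw [map_sub, sub_eq_zero] at h2
  have e : ∑ m ∈ range L, C z ^ m * X ^ (m + 1) * ip (C z⁻¹ * X) (m + 1) = X * hh (C z) (C z⁻¹) X L := by
    rw [hh, Finset.mul_sum]
    apply Finset.sum_congr rfl
    intro m _
    rw [mul_comm (C z⁻¹) X]; ring
  rw [e]
  simp only [mul_zero, zero_add, pow_one, zero_mul, add_zero] at h2
  rw [Rs, ← h2, map_add]
  simp [coeff_one, show n ≠ 0 by omega]

end RC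

set_option linter.all false
namespace RC
open PowerSeries Finset

/-- reduction modulo `X^M` -/
def BQ (M : ℕ) : Type := A ⧸ Ideal.span {(X : A) ^ M}

noncomputable instance (M : ℕ) : CommRing (BQ M) :=
  inferInstanceAs (CommRing (A ⧸ Ideal.span {(X : A) ^ M}))

/-- reduction modulo `X^M` -/
noncomputable def pi (M : ℕ) : A →+* BQ M := Ideal.Quotient.mk (Ideal.span {(X : A) ^ M})

theorem pi_eq {M : ℕ} {a b : A} : pi M a = pi M b ↔ (X : A) ^ M ∣ a - b := by
  rw [← Ideal.mem_span_singleton]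
  exact Ideal.Quotient.eq

theorem pi_zero {M : ℕ} {a : A} : pi M a = 0 ↔ (X : A) ^ M ∣ a := by
  rw [← map_zero (pi M), pi_eq, sub_zero]

theorem pi_coeff {M n : ℕ} {a b : A} (h : pi M a = pi M b) (hn : n < M) : coeff n a = coeff n b := by
  rw [pi_eq, X_pow_dvd_iff] at h
  have := h n hn
  rwa [map_sub, sub_eq_zero] at this

theorem pi_X {M k : ℕ} (h : M ≤ k) : pi M (X ^ k) = 0 := pi_zero.2 (pow_dvd_pow _ h)

theorem pi_qp_stable {M : ℕ} {a q : A} {n : ℕ} (h : ∀ m, n ≤ m → (X : A) ^ M ∣ a * q ^ m) {m : ℕ} (hm : n ≤ m) :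
    pi M (qp a q m) = pi M (qp a q n) := by
  induction m, hm using Nat.le_induction with
  | base => rfl
  | succ m hm ih => rw [qp_succ, map_mul, map_sub, pi_zero.2 (h m hm)]; simp [ih]

theorem pi_inv {M : ℕ} {a b : A} (ha : constantCoeff a ≠ 0) (hb : constantCoeff b ≠ 0)
    (h : pi M a = pi M b) : pi M a⁻¹ = pi M b⁻¹ := by
  have h1 := congrArg (pi M) (inv_cancel' ha)
  have h2 := congrArg (pi M) (inv_cancel' hb)
  rw [map_mul, map_one] at h1 h2
  linear_combination pi M a⁻¹ * (-h2) + pi M b⁻¹ * h1 - h * pi M a⁻¹ * pi M b⁻¹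

/-- truncated q-binomial sum -/
noncomputable def Fb (a x : A) (L : ℕ) : A := ∑ j ∈ range L, x ^ j * qp a X j * ip X j

theorem Fb_rec (a x : A) (L : ℕ) : (1 - x) * Fb a x (L + 1) =
    (1 - a * x) * Fb a (x * X) (L + 1) - x ^ (L + 1) * qp a X L * ip X L * (1 - a * X ^ L) := by
  induction L with
  | zero => simp [Fb, qp, ip]; ring
  | succ L ih =>
    have e (y : A) : Fb a y (L + 2) = Fb a y (L + 1) + y ^ (L + 1) * qp a X (L + 1) * ip X (L + 1) := by
      rw [Fb, Fb, sum_range_succ]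
    rw [e, e]
    have h1 : ip X (L + 1) * (1 - X * X ^ L) = ip X L := by
      rw [ip_succ, mul_assoc, mul_comm _⁻¹, inv_cancel' (by simp), mul_one]
    rw [← h1] at ih
    rw [qp_succ] at *
    linear_combination ih

theorem Fb_iter (a x : A) (hx : X ∣ x) (L K : ℕ) :
    pi (L + 1) (Fb a x (L + 1) * qp x X K) = pi (L + 1) (qp (a * x) X K * Fb a (x * X ^ K) (L + 1)) := by
  induction K with
  | zero => simp [qp]
  | succ K ih =>
    have h := congrArg (pi (L + 1)) (Fb_rec a (x * X ^ K) L)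
    have h0 : pi (L + 1) ((x * X ^ K) ^ (L + 1)) = 0 := by
      rw [pi_zero]
      exact pow_dvd_pow_of_dvd (hx.mul_right _) _
    rw [qp_succ, qp_succ, pow_succ, ← mul_assoc x]
    simp only [map_mul, map_sub, h0, map_one] at *
    linear_combination (1 - pi (L + 1) x * pi (L + 1) (X ^ K)) * ih + pi (L + 1) (qp (a * x) X K) * h

theorem qbin (a x : A) (hx : X ∣ x) (L : ℕ) :
    pi (L + 1) (Fb a x (L + 1) * qp x X L) = pi (L + 1) (qp (a * x) X L) := by
  have h := Fb_iter a x hx L L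
  rw [h]
  have h0 : pi (L + 1) (x * X ^ L) = 0 := by
    rw [pi_zero, pow_succ']; exact mul_dvd_mul_right hx _
  have : pi (L + 1) (Fb a (x * X ^ L) (L + 1)) = 1 := by
    rw [Fb, sum_range_succ', map_add, map_sum]
    rw [Finset.sum_eq_zero]
    · simp [qp, ip]
    · intro j _
      rw [map_mul, map_mul, map_pow, h0]; simp
  rw [map_mul, this, mul_one]

theorem crank0 (s : Multiset ℕ) (m : ℕ) :
    s.toFinsupp.prod (fun i c => if i = 1 then 0 else if i ≤ m then (1 : ℂ) else 0) =
      if s.count 1 = 0 ∧ s.sup ≤ m then 1 else 0 := by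
  split_ifs with h
  · apply Finset.prod_eq_one
    intro i hi
    simp at hi
    have : i ≤ m := (Multiset.le_sup hi).trans h.2
    have h1 : i ≠ 1 := by
      rintro rfl
      rw [Multiset.count_eq_zero] at h
      exact h.1 hi
    simp [this, h1]
  · by_cases h1 : s.count 1 = 0
    · have h2 : ¬ s.sup ≤ m := fun h2 => h ⟨h1, h2⟩
      rw [Multiset.sup_le] at h2
      push Not at h2
      obtain ⟨b, hb, hm⟩ := h2
      apply Finset.prod_eq_zero (i := b)
      · simpa using hb
      · simp [hm]
    · apply Finset.prod_eq_zero (i := 1)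
      · simpa [Multiset.count_eq_zero] using h1
      · simp

theorem gen_crank0 (m : ℕ) :
    Nat.Partition.genFun (fun i c => if i = 1 then 0 else if i ≤ m + 1 then (1 : ℂ) else 0) =
      ip (X ^ 2) m := by
  rw [genFun_fin _ (fun i => if i = 0 then 1 else (1 - C 1 * X ^ (i + 1))⁻¹) (m + 1)]
  · rw [prod_range_succ']
    simp only [if_true, mul_one]
    unfold ip
    apply prod_congr rfl
    intro i hi
    simp
    congr 2; ring
  · intro i c h
    have : ¬ i ≤ m + 1 := by omega
    simp [this]
  · intro i hi
    by_cases h : i = 0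
    · subst h; simp
    · simp only [h, if_false]
      rw [← hfac]
      have : i ≤ m := by omega
      simp [h, this]

theorem crankj (s : Multiset ℕ) (N j : ℕ) (hj : 1 ≤ j) (hs : s.sup ≤ N) (z : ℂ) (g : ℕ → ℂ) :
    s.toFinsupp.prod (fun i c => if i = 1 then g c
        else if i ≤ N then (if j < i then z ^ c else 1) else 0) =
      (if s.count 1 = 0 then 1 else g (s.count 1)) * z ^ (s.filter (fun x => j < x)).card := by
  rw [← prod_pow_count s (fun x => j < x) z]
  have key : s.toFinsupp.prod (fun i c => if i = 1 then g c
        else if i ≤ N then (if j < i then z ^ c else 1) else 0) = s.toFinsupp.prod (fun i c => if i = 1 then g c else 1) * s.toFinsupp.prod (fun i c => if j < i then z ^ c else 1) := by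
    rw [Finsupp.prod, Finsupp.prod, Finsupp.prod, ← Finset.prod_mul_distrib]
    apply Finset.prod_congr rfl
    intro i hi
    simp at hi
    have : i ≤ N := (Multiset.le_sup hi).trans hs
    by_cases h : i = 1
    · have : ¬ j < i := by omega
      simp [h]
      intro h; omega
    · simp [h, this]
  rw [key]
  congr 1
  rw [Finsupp.prod]
  split_ifs with h
  · apply Finset.prod_eq_one
    intro i hi
    simp at hi
    rw [if_neg]
    rintro rfl
    rw [Multiset.count_eq_zero] at h
    exact h hi
  · rw [Finset.prod_eq_single 1]
    · simp
    · intro b _ hb; simp [hb]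
    · intro h1
      simp at h1
      exact absurd (Multiset.count_eq_zero.2 h1) h

theorem gen_crankj (N j : ℕ) (hj : j < N) (z : ℂ) :
    Nat.Partition.genFun (fun i c => if i = 1 then (if c = j + 1 then 1 else 0)
        else if i ≤ N then (if j + 1 < i then z ^ c else 1) else 0) -
    Nat.Partition.genFun (fun i c => if i = 1 then 0
        else if i ≤ N then (if j + 1 < i then z ^ c else 1) else 0) =
      X ^ (j + 1) * ip (X ^ 2) j * ip (C z * X ^ (j + 2)) (N - (j + 1)) := by
  obtain ⟨K, rfl⟩ : ∃ K, N = K + 1 := ⟨N - 1, by omega⟩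
  rw [genFun_fin _ (fun i => if i = 0 then 1 + X ^ (j + 1) else if j < i then (1 - C z * X ^ (i + 1))⁻¹ else  (1 - C 1 * X ^ (i + 1))⁻¹) (K + 1), 
   genFun_fin _ (fun i => if i = 0 then 1 else if j < i then (1 - C z * X ^ (i + 1))⁻¹ else  (1 - C 1 * X ^ (i + 1))⁻¹) (K + 1)]
  · rw [prod_range_succ', prod_range_succ']
    simp only [if_true, mul_one]
    have : ∀ i, ¬ (i + 1 = 0) := fun i => by omega
    simp only [this, if_false]
    have e : ∏ k ∈ range K, (if j < k + 1 then (1 - C z * X ^ (k + 1 + 1))⁻¹ else  (1 - C 1 * X ^ (k + 1 + 1))⁻¹) = ip (X ^ 2) j * ip (C z * X ^ (j + 2)) (K + 1 - (j + 1)) := by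
      have hK : K = j + (K + 1 - (j + 1)) := by omega
      conv_lhs => rw [hK]
      rw [prod_range_add]
      unfold ip
      congr 1
      · apply prod_congr rfl
        intro k hk
        rw [if_neg (by simp at hk; omega), map_one]; congr 2; ring
      · apply prod_congr rfl
        intro k hk
        rw [if_pos (by omega)]; congr 2; ring
    rw [e]; ring
  · intro i c h
    have h1 : ¬ i ≤ K + 1 := by omega
    have h2 : i ≠ 1 := by omega
    simp [h1, h2]
  · intro i hi
    by_cases h : i = 0
    · subst h; simp
    · by_cases h2 : j < i
      · simp only [h, if_false, h2, if_true]
        rw [← hfac]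
        have : i ≤ K := by omega
        simp [h, h2, this]
      · simp only [h, if_false, h2]
        rw [← hfac]
        have : i ≤ K := by omega
        simp [h, h2, this]
  · intro i c h
    have h1 : ¬ i ≤ K + 1 := by omega
    have h2 : i ≠ 1 := by omega
    simp [h1, h2]
  · intro i hi
    by_cases h : i = 0
    · subst h
      have := hfac1 0 j
      simp only [zero_add, one_mul] at this
      simpa using this
    · by_cases h2 : j < i
      · simp only [h, if_false, h2, if_true]
        rw [← hfac]
        have : i ≤ K := by omega
        simp [h, h2, this]
      · simp only [h, if_false, h2]
        rw [← hfac]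
        have : i ≤ K := by omega
        simp [h, h2, this]


theorem crank_split {z : ℂ} (hz : z ≠ 0) {n N : ℕ} (hn : 2 ≤ n) (hN : n ≤ N) :
    ∑ p : n.Partition, z ^ (partitionCrank p) =
      coeff n (∑ m ∈ range N, C z ^ (m + 2) * (X ^ (m + 2) * ip (X ^ 2) (m + 1)) +
        ∑ j ∈ range N, C z⁻¹ ^ (j + 1) * (X ^ (j + 1) * ip (X ^ 2) j * ip (C z * X ^ (j + 2)) (N - (j + 1)))) := by
  have h1 : ∀ m, (X : A) ^ (m + 2) * ip (X ^ 2) (m + 1) = ip (X ^ 2) (m + 1) - ip (X ^ 2) m := by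
    intro m
    rw [ip_succ]
    have : constantCoeff (1 - X ^ 2 * X ^ m : A) ≠ 0 := by simp
    have h3 := inv_cancel' this
    linear_combination (-ip (X ^ 2) m) * h3
  have h2 : ∀ j ∈ range N, C z⁻¹ ^ (j + 1) * (X ^ (j + 1) * ip (X ^ 2) j * ip (C z * X ^ (j + 2)) (N - (j + 1)))
      = C z⁻¹ ^ (j + 1) * (Nat.Partition.genFun (fun i c => if i = 1 then (if c = j + 1 then 1 else 0)
        else if i ≤ N then (if j + 1 < i then z ^ c else 1) else 0) -
    Nat.Partition.genFun (fun i c => if i = 1 then 0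
        else if i ≤ N then (if j + 1 < i then z ^ c else 1) else 0)) := by
    intro j hj
    rw [gen_crankj N j (by simpa using hj)]
  rw [Finset.sum_congr rfl (fun m _ => congrArg _ (h1 m)), Finset.sum_congr rfl h2]
  simp only [map_add, map_sum, ← map_pow, coeff_C_mul, map_sub, ← gen_crank0, Nat.Partition.coeff_genFun,
    crank0, ← Finset.sum_sub_distrib, Finset.mul_sum]
  rw [Finset.sum_comm, Finset.sum_comm (s := range N), ← Finset.sum_add_distrib]
  apply Finset.sum_congr rfl
  intro p _
  have hs2 : p.parts.sup ≤ n := by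
    rw [Multiset.sup_le]
    intro b hb
    rw [← p.parts_sum]
    exact Multiset.le_sum_of_mem hb
  have hsN := hs2.trans hN
  have e2 : ∀ j ∈ range N, z⁻¹ ^ (j + 1) * ((p.parts.toFinsupp.prod fun i c ↦
                if i = 1 then if c = j + 1 then (1 : ℂ) else 0 else if i ≤ N then if j + 1 < i then z ^ c else 1 else 0) -
            p.parts.toFinsupp.prod fun i c ↦ if i = 1 then (0 : ℂ) else if i ≤ N then if j + 1 < i then z ^ c else 1 else 0)
       = if p.parts.count 1 = j + 1 then z⁻¹ ^ (j + 1) * z ^ (p.parts.filter (fun x => j + 1 < x)).card else 0 := by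
    intro j _
    rw [crankj p.parts N (j + 1) (by omega) hsN z (fun c => if c = j + 1 then 1 else 0)]
    rw [crankj p.parts N (j + 1) (by omega) hsN z (fun c => 0)]
    by_cases h : p.parts.count 1 = 0
    · simp [h]
    · by_cases h' : p.parts.count 1 = j + 1
      · simp [h']
      · simp [h, h']
  rw [Finset.sum_congr rfl e2]
  by_cases h0 : p.parts.count 1 = 0
  · have hs : 2 ≤ p.parts.sup := by
      by_contra h
      have : p.parts = 0 := by
        apply Multiset.eq_zero_of_forall_notMem
        intro a ha
        have := Multiset.le_sup ha
        have := p.parts_pos ha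
        have : a = 1 := by omega
        subst this
        rw [Multiset.count_eq_zero] at h0
        exact h0 ha
      have h3 := p.parts_sum
      rw [this] at h3
      simp at h3; omega
    rw [partitionCrank, if_pos h0]
    simp only [h0, true_and]
    rw [Finset.sum_eq_zero (s := range N) (f := fun j => if 0 = j + 1 then _ else _), add_zero]
    · rw [Finset.sum_eq_single (p.parts.sup - 2)]
      · have e : p.parts.sup - 2 + 2 = p.parts.sup := by omega
        have e' : p.parts.sup ≤ p.parts.sup - 2 + 1 + 1 := by omega
        have e2 : ¬ p.parts.sup ≤ p.parts.sup - 2 + 1 := by omega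
        rw [if_pos e', if_neg e2, sub_zero, e, zpow_natCast, mul_one]
      · intro b _ hb
        by_cases h : p.parts.sup ≤ b + 1
        · rw [if_pos (by omega), if_pos h, sub_self, mul_zero]
        · rw [if_neg (by omega), if_neg h, sub_self, mul_zero]
      · intro h
        simp at h; omega
    · intro j _
      rw [if_neg (by omega)]
  · rw [partitionCrank, if_neg h0]
    simp only [h0, false_and, if_false, sub_self, mul_zero, Finset.sum_const_zero, zero_add]
    rw [Finset.sum_eq_single (p.parts.count 1 - 1)]
    · have e : p.parts.count 1 - 1 + 1 = p.parts.count 1 := by omega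
      rw [e, if_pos rfl, zpow_sub₀ hz, inv_pow, zpow_natCast, zpow_natCast, div_eq_mul_inv, mul_comm]
    · intro b _ hb
      rw [if_neg (by omega)]
    · intro h
      exfalso
      have h5 : p.parts.count 1 ≤ n := by
        have h7 := p.parts_sum
        have := Multiset.count_le_card 1 p.parts
        have h6 : p.parts.card • 1 ≤ p.parts.sum := Multiset.card_nsmul_le_sum (fun x hx => p.parts_pos hx)
        simp at h6
        omega
      simp at h
      omega

/-- truncated crank generating function -/
noncomputable def Cs (z w : A) (N : ℕ) : A := qp X X N * ip (z * X) N * ip (w * X) N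

theorem ip_split (a : A) (ha : constantCoeff a = 0) (j k : ℕ) : ip (a * X ^ j) k = qp a X j * ip a (j + k) := by
  have : ip a (j + k) = ip a j * ip (a * X ^ j) k := by
    unfold ip
    rw [prod_range_add]
    congr 1
    apply prod_congr rfl
    intro i _
    congr 2
    ring
  rw [this, ← mul_assoc, qp_mul_ip ha, one_mul]

theorem crank_gf {z : ℂ} (hz : z ≠ 0) {n N : ℕ} (hn : 2 ≤ n) (hN : n ≤ N) :
    ∑ p : n.Partition, z ^ (partitionCrank p) = coeff n (Cs (C z) (C z⁻¹) N) := by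
  rw [crank_split hz hn hN]
  have hzw : (C z * C z⁻¹ : A) = 1 := by rw [← map_mul, mul_inv_cancel₀ hz, map_one]
  set u : A := C z
  set w : A := C z⁻¹
  have key : pi (N + 1) (∑ m ∈ range N, u ^ (m + 2) * (X ^ (m + 2) * ip (X ^ 2) (m + 1)) +
        ∑ j ∈ range N, w ^ (j + 1) * (X ^ (j + 1) * ip (X ^ 2) j * ip (u * X ^ (j + 2)) (N - (j + 1))))
      = pi (N + 1) (Cs u w N - (1 + (u - 1) * X)) := by
    have hX1 : ∀ j, ip (X ^ 2) j = (1 - X) * ip X (j + 1) := by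
      intro j
      rw [ip_succ', ← mul_assoc, inv_cancel' (by simp), one_mul, sq]
    have a1 : ∑ m ∈ range N, u ^ (m + 2) * (X ^ (m + 2) * ip (X ^ 2) (m + 1)) =
        (1 - X) * (Fb 0 (u * X) (N + 2) - 1) - u * X := by
      rw [Fb, sum_range_succ', sum_range_succ']
      have : ip (X : A) 1 * (1 - X) = 1 := by
        simp [ip]
      simp only [hX1]
      have e : ∀ m, u ^ (m + 2) * (X ^ (m + 2) * ((1 - X) * ip X (m + 1 + 1))) = (1 - X) * ((u * X) ^ (m + 1 + 1) * qp 0 X (m + 1 + 1) * ip X (m + 1 + 1)) := by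
        intro m
        have : qp (0 : A) X (m + 1 + 1) = 1 := by simp [qp]
        rw [this]; ring
      rw [Finset.sum_congr rfl (fun m _ => e m), ← Finset.mul_sum]
      have e3 : qp (0 : A) X (0 + 1) = 1 := by simp [qp]
      have e4 : qp (0 : A) X 0 = 1 := by simp [qp]
      have e5 : ip (X : A) 0 = 1 := by simp [ip]
      rw [e3, e4, e5]
      linear_combination (-u * X) * this
    have a2 : ∑ j ∈ range N, w ^ (j + 1) * (X ^ (j + 1) * ip (X ^ 2) j * ip (u * X ^ (j + 2)) (N - (j + 1))) =
        (1 - X) * ip (u * X) N * (Fb (u * X) (w * X) (N + 1) - 1) := by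
      rw [Fb, sum_range_succ']
      have e : ∀ j ∈ range N, w ^ (j + 1) * (X ^ (j + 1) * ip (X ^ 2) j * ip (u * X ^ (j + 2)) (N - (j + 1))) = (1 - X) * ip (u * X) N * ((w * X) ^ (j + 1) * qp (u * X) X (j + 1) * ip X (j + 1)) := by
        intro j hj
        simp at hj
        have h := ip_split (u * X) (by simp) (j + 1) (N - (j + 1))
        have e : j + 1 + (N - (j + 1)) = N := by omega
        rw [e, mul_assoc, ← pow_succ'] at h
        rw [h, hX1]; ring
      rw [Finset.sum_congr rfl e, ← Finset.mul_sum]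
      have e4 : qp (u * X) X 0 = 1 := by simp [qp]
      have e5 : ip (X : A) 0 = 1 := by simp [ip]
      rw [e4, e5, pow_zero, mul_one, mul_one]
      ring
    rw [a1, a2]
    have b1 := qbin 0 (u * X) (Dvd.intro_left _ rfl) N
    have b2 := qbin (u * X) (w * X) (Dvd.intro_left _ rfl) N
    have e3 : qp (0 * (u * X)) X N = 1 := by simp [qp]
    have e6 : u * X * (w * X) = X * X := by linear_combination X ^ 2 * hzw
    rw [e3] at b1
    rw [e6] at b2
    have b3 : pi (N + 1) (Fb 0 (u * X) (N + 2)) = pi (N + 1) (Fb 0 (u * X) (N + 1)) := by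
      rw [Fb, sum_range_succ, map_add, ← Fb, mul_pow]
      simp only [map_mul, pi_X le_rfl]; simp
    have b4 : pi (N + 1) (qp X X N) = pi (N + 1) (qp X X (N + 1)) := by
      rw [qp_succ, ← pow_succ', map_mul, map_sub, pi_X le_rfl]; simp
    rw [qp_succ'] at b4
    have c1 := congrArg (pi (N + 1)) (qp_mul_ip (a := u * X) (by simp) N)
    have c2 := congrArg (pi (N + 1)) (qp_mul_ip (a := w * X) (by simp) N)
    unfold Cs
    simp only [map_mul, map_sub, map_add, map_one, b3] at *
    set p := pi (N + 1)
    rw [b4]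
    linear_combination (1 - p X) * p (ip (u * X) N) * b1 - (1 - p X) * p (Fb 0 (u * X) (N + 1)) * c1
      + (1 - p X) * p (ip (u * X) N) * (p (ip (w * X) N) * b2 - p (Fb (u * X) (w * X) (N + 1)) * c2)
  rw [pi_coeff key (by omega), map_sub, map_add]
  have t1 : coeff n ((u - 1) * X : A) = 0 := by
    rw [← map_one (C : ℂ →+* A), ← map_sub, coeff_C_mul, coeff_X, if_neg (by omega), mul_zero]
  rw [t1, coeff_one, if_neg (by omega)]
  simp

end RC

set_option linter.all false
namespace RC
open Finset

theorem pf {K ι : Type*} [Field K] [Fintype ι] [DecidableEq ι] [Nonempty ι] (y : ι → K) (z w : K) (hzw : z * w = 1)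
    (hy : ∀ i, y i ≠ 0) (hD : ∀ i, (1 - z * y i) * (1 - w * y i) ≠ 0)
    (hne : ∀ i j, i ≠ j → (1 - y j * (y i)⁻¹) * (1 - y j * y i) ≠ 0) :
    ∏ i, ((1 - z * y i) * (1 - w * y i))⁻¹ =
      ∑ i, (∏ j, if j = i then 1 else ((1 - y j * (y i)⁻¹) * (1 - y j * y i))⁻¹) *
        ((1 - z * y i) * (1 - w * y i))⁻¹ := by
  set v : ι → K := fun i => -(y i + (y i)⁻¹) with hv
  have e1 : ∀ i, (1 - z * y i) * (1 - w * y i) = y i * (-(z + w) - v i) := by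
    intro i
    simp only [hv]
    have := hy i
    field_simp
    linear_combination (y i) ^ 2 * hzw
  have e2 : ∀ i j, (1 - y j * (y i)⁻¹) * (1 - y j * y i) = y j * (v i - v j) := by
    intro i j
    simp only [hv]
    have := hy i
    have := hy j
    field_simp
    ring
  have hinj : Set.InjOn v (univ : Finset ι) := by
    intro a _ b _ h
    by_contra hab
    apply hne a b hab
    rw [e2, h, sub_self, mul_zero]
  have hx : ∀ i ∈ (univ : Finset ι), -(z + w) ≠ v i := by
    intro i _ h
    apply hD i
    rw [e1, h, sub_self, mul_zero]
  have h := Lagrange.eval_interpolate_not_at_node (s := univ) (v := v) (r := 1) (x := -(z + w)) hx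
  rw [Lagrange.interpolate_one hinj univ_nonempty, Polynomial.eval_one, Lagrange.eval_nodal] at h
  simp only [e1, e2]
  have hprod : ∏ i, (-(z + w) - v i) ≠ 0 := by
    rw [Finset.prod_ne_zero_iff]
    intro i hi h
    exact hx i hi (sub_eq_zero.1 h)
  have h2 : ∏ i, (-(z + w) - v i)⁻¹ = ∑ i, Lagrange.nodalWeight univ v i * (-(z + w) - v i)⁻¹ := by
    rw [Finset.prod_inv_distrib]
    simp only [Pi.one_apply, mul_one] at h
    exact inv_eq_of_mul_eq_one_right h.symm
  simp only [mul_inv]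
  rw [Finset.prod_mul_distrib, h2, Finset.mul_sum]
  apply Finset.sum_congr rfl
  intro i _
  have : (∏ j, if j = i then 1 else (y j)⁻¹ * (v i - v j)⁻¹) = (∏ j ∈ univ.erase i, (y j)⁻¹) * Lagrange.nodalWeight univ v i := by
    rw [Lagrange.nodalWeight, ← Finset.prod_mul_distrib]
    rw [← Finset.mul_prod_erase univ _ (mem_univ i), if_pos rfl, one_mul]
    apply Finset.prod_congr rfl
    intro j hj
    rw [if_neg (Finset.ne_of_mem_erase hj)]
  rw [this, ← Finset.mul_prod_erase univ _ (mem_univ i)]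
  ring

theorem lam_sum {K : Type*} [Field K] [CharZero K] (ζ y : K) (hζ : ζ ^ 4 = -1) (hy : y ^ 8 ≠ 1) :
    ∑ k ∈ range 8, ((1 - ζ ^ k * y) * (1 - ζ⁻¹ ^ k * y))⁻¹ =
      8 * (1 + y ^ 8) * (1 - y ^ 8)⁻¹ * (1 - y ^ 2)⁻¹ := by
  have hi : ζ⁻¹ = -ζ ^ 3 := by
    apply inv_eq_of_mul_eq_one_right
    linear_combination -hζ
  obtain ⟨r, hr⟩ : ∃ r, r = ζ - ζ ^ 3 := ⟨_, rfl⟩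
  have hr2 : r ^ 2 = 2 := by rw [hr]; linear_combination (-2 + ζ ^ 2) * hζ
  have h0 : (1 - ζ ^ 0 * y) * (1 - ζ⁻¹ ^ 0 * y) = (1 - y) ^ 2 := by simp; ring
  have h1 : (1 - ζ ^ 1 * y) * (1 - ζ⁻¹ ^ 1 * y) = 1 - r * y + y ^ 2 := by
    rw [hi, hr]; linear_combination (-y ^ 2) * hζ
  have h2 : (1 - ζ ^ 2 * y) * (1 - ζ⁻¹ ^ 2 * y) = 1 + y ^ 2 := by
    rw [hi]; linear_combination (y^2 * (ζ ^ 4 - 1) - ζ ^ 2 * y) * hζ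
  have h3 : (1 - ζ ^ 3 * y) * (1 - ζ⁻¹ ^ 3 * y) = 1 + r * y + y ^ 2 := by
    rw [hi, hr]; linear_combination (-y ^ 2 * (ζ ^ 8 - ζ ^ 4 + 1) + y * ζ * (ζ ^ 4 - 1)) * hζ
  have h4 : (1 - ζ ^ 4 * y) * (1 - ζ⁻¹ ^ 4 * y) = (1 + y) ^ 2 := by
    rw [inv_pow, hζ]; norm_num; ring
  have h5 : (1 - ζ ^ 5 * y) * (1 - ζ⁻¹ ^ 5 * y) = 1 + r * y + y ^ 2 := by
    have a : ζ ^ 5 = -ζ := by linear_combination ζ * hζ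
    have b : ζ⁻¹ ^ 5 = ζ ^ 3 := by rw [inv_pow, a, inv_neg, hi]; ring
    rw [a, b, hr]; linear_combination (-y ^ 2) * hζ
  have h6 : (1 - ζ ^ 6 * y) * (1 - ζ⁻¹ ^ 6 * y) = 1 + y ^ 2 := by
    have a : ζ ^ 6 = -ζ ^ 2 := by linear_combination ζ ^ 2 * hζ
    have b : ζ⁻¹ ^ 6 = ζ ^ 2 := by
      rw [inv_pow, a, inv_neg, ← inv_pow, hi]; linear_combination (-ζ ^ 2) * hζ
    rw [a, b]; linear_combination (-y ^ 2) * hζ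
  have h7 : (1 - ζ ^ 7 * y) * (1 - ζ⁻¹ ^ 7 * y) = 1 - r * y + y ^ 2 := by
    have a : ζ ^ 7 = -ζ ^ 3 := by linear_combination ζ ^ 3 * hζ
    have b : ζ⁻¹ ^ 7 = ζ := by
      rw [inv_pow, a, ← hi, inv_inv]
    rw [a, b, hr]; linear_combination (-y ^ 2) * hζ
  simp only [Finset.sum_range_succ, Finset.sum_range_zero, h0, h1, h2, h3, h4, h5, h6, h7]
  have f : (1 - y) * (1 + y) * (1 + y ^ 2) * ((1 - r * y + y ^ 2) * (1 + r * y + y ^ 2)) = 1 - y ^ 8 := by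
    linear_combination (- y ^ 2 * (1 - y^4)) * hr2
  have f0 : 1 - y ^ 8 ≠ 0 := by
    intro h; apply hy; linear_combination -h
  have n1 : 1 - y ≠ 0 := by intro h; apply f0; rw [← f, h]; ring
  have n2 : 1 + y ≠ 0 := by intro h; apply f0; rw [← f, h]; ring
  have n3 : 1 + y ^ 2 ≠ 0 := by intro h; apply f0; rw [← f, h]; ring
  have n4 : 1 - r * y + y ^ 2 ≠ 0 := by intro h; apply f0; rw [← f, h]; ring
  have n5 : 1 + r * y + y ^ 2 ≠ 0 := by intro h; apply f0; rw [← f, h]; ring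
  have g1 : (1 - r * y + y ^ 2)⁻¹ + (1 + r * y + y ^ 2)⁻¹ = 2 * (1 + y ^ 2) * (1 + y ^ 4)⁻¹ := by
    have : (1 - r * y + y ^ 2) * (1 + r * y + y ^ 2) = 1 + y ^ 4 := by linear_combination -y ^ 2 * hr2
    rw [← this]
    field_simp
    ring
  have n6 : 1 + y ^ 4 ≠ 0 := by
    have : (1 - r * y + y ^ 2) * (1 + r * y + y ^ 2) = 1 + y ^ 4 := by linear_combination -y ^ 2 * hr2
    rw [← this]; exact mul_ne_zero n4 n5
  have g2 : 1 - y ^ 8 = (1 - y) * (1 + y) * (1 + y ^ 2) * (1 + y ^ 4) := by ring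
  have g3 : 1 - y ^ 2 = (1 - y) * (1 + y) := by ring
  have : ((1 - y) ^ 2)⁻¹ + ((1 + y) ^ 2)⁻¹ + 2 * (1 + y ^ 2)⁻¹ + 2 * (2 * (1 + y ^ 2) * (1 + y ^ 4)⁻¹) = 8 * (1 + y ^ 8) * (1 - y ^ 8)⁻¹ * (1 - y ^ 2)⁻¹ := by
    rw [g2, g3]
    field_simp
    ring
  rw [← this, ← g1]
  ring

theorem prod_ite_split {R : Type*} [CommRing R] (f : ℕ → R) {k N : ℕ} (hk : k < N) :
    (∏ j ∈ range N, if j = k then 1 else f j) =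
      (∏ j ∈ range k, f j) * ∏ j ∈ range (N - 1 - k), f (k + 1 + j) := by
  have h : N = k + 1 + (N - 1 - k) := by omega
  conv_lhs => rw [h]
  rw [prod_range_add, prod_range_succ, if_pos rfl, mul_one]
  congr 1
  · apply prod_congr rfl
    intro j hj
    rw [if_neg (by simp at hj; omega)]
  · apply prod_congr rfl
    intro j hj
    rw [if_neg (by omega)]

/-- product with negative powers, `(1-q^{j-k})` for `j<k` -/
theorem neg_prod {K : Type*} [Field K] (q : K) (hq : q ≠ 0) (k : ℕ) :
    (∏ j ∈ range k, (1 - q ^ j * (q ^ k)⁻¹)) * ((-1) ^ k * q ^ (k * (k + 1) / 2)) = qp q q k := by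
  rw [← Finset.prod_range_reflect]
  have e : ∀ j ∈ range k, (1 - q ^ (k - 1 - j) * (q ^ k)⁻¹) = 1 - (q ^ (j + 1))⁻¹ := by
    intro j hj
    simp at hj
    have : q ^ k = q ^ (k - 1 - j) * q ^ (j + 1) := by rw [← pow_add]; congr 1; omega
    rw [this]
    field_simp
  rw [prod_congr rfl e]
  clear e
  induction k with
  | zero => simp [qp]
  | succ k ih =>
    have e : (k + 1) * (k + 1 + 1) / 2 = k * (k + 1) / 2 + (k + 1) := by
      have : (k + 1) * (k + 1 + 1) = k * (k + 1) + (k + 1) * 2 := by ring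
      rw [this, Nat.add_mul_div_right _ _ (by norm_num)]
    rw [prod_range_succ, e, qp_succ, ← ih]
    field_simp
    ring

/-- same with odd powers and plus signs -/
theorem neg_prod2 {K : Type*} [Field K] (q c : K) (hq : q ≠ 0) (hc : c ^ 2 = 1 ∨ c ^ 2 = -1) (k : ℕ) :
    (∏ j ∈ range k, (1 + c * q ^ (2 * j + 1) * (q ^ (2 * k))⁻¹)) * (q ^ (k ^ 2)) = 
     ∏ j ∈ range k, (c + q ^ (2 * j + 1)) := by
  rw [← Finset.prod_range_reflect]
  have e : ∀ j ∈ range k, (1 + c * q ^ (2 * (k - 1 - j) + 1) * (q ^ (2 * k))⁻¹) = 1 + c * (q ^ (2 * j + 1))⁻¹ := by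
    intro j hj
    simp at hj
    have : q ^ (2 * k) = q ^ (2 * (k - 1 - j) + 1) * q ^ (2 * j + 1) := by rw [← pow_add]; congr 1; omega
    rw [this]
    field_simp
  rw [prod_congr rfl e]
  clear e
  induction k with
  | zero => simp
  | succ k ih =>
    have e : (k + 1) ^ 2 = k ^ 2 + (2 * k + 1) := by ring
    rw [prod_range_succ, e, prod_range_succ, ← ih, pow_add]
    field_simp
    ring

end RC

set_option linter.all false
namespace RC
open Finset

theorem qp_add {R : Type*} [CommRing R] (a q : R) (m n : ℕ) :
    qp a q (m + n) = qp a q m * ∏ j ∈ range n, (1 - a * q ^ (m + j)) := by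
  unfold qp; rw [prod_range_add]

theorem k1 {K : Type*} [Field K] (q : K) (hq : q ≠ 0) {k N : ℕ} (hk : k < N) :
    (∏ j ∈ range N, if j = k then 1 else ((1 - q ^ (j + 1) * (q ^ (k + 1))⁻¹) * (1 - q ^ (j + 1) * q ^ (k + 1)))) *
     ((-1) ^ k * q ^ (k * (k + 1) / 2) * (1 - q ^ (k + 1)) * (1 - (q ^ (k + 1)) ^ 2)) =
      qp q q (N - 1 - k) * qp q q (N + k + 1) := by
  rw [prod_ite_split _ hk, prod_mul_distrib, prod_mul_distrib]
  have e1 : ∏ j ∈ range k, (1 - q ^ (j + 1) * (q ^ (k + 1))⁻¹) = ∏ j ∈ range k, (1 - q ^ j * (q ^ k)⁻¹) := by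
    apply prod_congr rfl; intro j _; field_simp; try ring
  have e2 : ∏ j ∈ range (N - 1 - k), (1 - q ^ (k + 1 + j + 1) * (q ^ (k + 1))⁻¹) = qp q q (N - 1 - k) := by
    unfold qp
    apply prod_congr rfl; intro j _
    field_simp
    try ring
  have e3 : qp q q (N + k + 1) = qp q q k * (1 - q ^ (k + 1)) * (∏ j ∈ range k, (1 - q ^ (j + 1) * q ^ (k + 1))) * (1 - (q ^ (k + 1)) ^ 2) * ∏ j ∈ range (N - 1 - k), (1 - q ^ (k + 1 + j + 1) * q ^ (k + 1)) := by
    have h : N + k + 1 = (k + 1 + k + 1) + (N - 1 - k) := by omega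
    rw [h, qp_add, qp_succ, qp_add, qp_succ]
    congr 1
    · congr 1
      · congr 1
        · ring
        · apply prod_congr rfl; intro j _; ring
      · ring
    · apply prod_congr rfl; intro j _; ring
  rw [e1, e2, e3, ← neg_prod q hq k]
  ring

theorem k2 {K : Type*} [Field K] (q : K) (hq : q ≠ 0) {k N : ℕ} (hk : k < N) :
    (∏ j ∈ range N, if j = k then 1 else ((1 - q ^ j * (q ^ k)⁻¹) * (1 - q ^ (j + k + 1)))) *
     ((-1) ^ k * q ^ (k * (k + 1) / 2) * (1 - q ^ (2 * k + 1))) =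
      qp q q (N - 1 - k) * qp q q (N + k) := by
  rw [prod_ite_split _ hk, prod_mul_distrib, prod_mul_distrib]
  have e2 : ∏ j ∈ range (N - 1 - k), (1 - q ^ (k + 1 + j) * (q ^ k)⁻¹) = qp q q (N - 1 - k) := by
    unfold qp
    apply prod_congr rfl; intro j _
    field_simp
    try ring
  have e3 : qp q q (N + k) = qp q q k * (∏ j ∈ range k, (1 - q ^ (j + k + 1))) * (1 - q ^ (2 * k + 1)) * ∏ j ∈ range (N - 1 - k), (1 - q ^ (k + 1 + j + k + 1)) := by
    have h : N + k = (k + k + 1) + (N - 1 - k) := by omega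
    rw [h, qp_add, qp_succ, qp_add]
    congr 1
    · congr 1
      · congr 1
        apply prod_congr rfl; intro j _; ring
      · ring
    · apply prod_congr rfl; intro j _; ring
  rw [e2, e3, ← neg_prod q hq k]
  ring

theorem k3 {K : Type*} [Field K] (q : K) (hq : q ≠ 0) {k N : ℕ} (hk : k ≤ N) :
    (∏ j ∈ range N, ((1 + q ^ (2 * j + 1) * (q ^ (2 * k))⁻¹) * (1 + q ^ (2 * j + 1) * q ^ (2 * k)))) *
     q ^ (k ^ 2) =
      qp (-q) (q ^ 2) (N - k) * qp (-q) (q ^ 2) (N + k) := by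
  rw [prod_mul_distrib]
  have h : N = k + (N - k) := by omega
  have e1 : ∏ j ∈ range N, (1 + q ^ (2 * j + 1) * (q ^ (2 * k))⁻¹) = (∏ j ∈ range k, (1 + 1 * q ^ (2 * j + 1) * (q ^ (2 * k))⁻¹)) * qp (-q) (q ^ 2) (N - k) := by
    conv_lhs => rw [h]
    rw [prod_range_add]
    congr 1
    · simp
    · unfold qp
      apply prod_congr rfl; intro j _
      field_simp
      ring
  have e2 : qp (-q) (q ^ 2) (N + k) = (∏ j ∈ range k, (1 + q ^ (2 * j + 1))) * ∏ j ∈ range N, (1 + q ^ (2 * j + 1) * q ^ (2 * k)) := by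
    rw [add_comm N k, qp_add]
    unfold qp
    congr 1
    · apply prod_congr rfl; intro j _; ring
    · apply prod_congr rfl; intro j _; ring
  have := neg_prod2 q 1 hq (by simp) k
  rw [e1, e2, ← this]
  ring

theorem k4 {K : Type*} [Field K] (t c : K) (ht : t ≠ 0) (hc : c ^ 2 = -1) {k N : ℕ} (hk : k ≤ N) :
    (∏ j ∈ range N, ((1 - (t ^ 2) ^ (j + 1) * (c * t ^ (2 * k + 1))⁻¹) * (1 - (t ^ 2) ^ (j + 1) * (c * t ^ (2 * k + 1))))) *
     (t ^ (k ^ 2) * (1 - c * t ^ (2 * k + 1))) =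
      c ^ k * qp (c * t) (t ^ 2) (N + k + 1) * qp (-c * t) (t ^ 2) (N - k) := by
  have hc0 : c ≠ 0 := by rintro rfl; norm_num at hc
  have hci : c⁻¹ = -c := by apply inv_eq_of_mul_eq_one_right; linear_combination -hc
  rw [prod_mul_distrib]
  have h : N = k + (N - k) := by omega
  have e1 : ∏ j ∈ range N, (1 - (t ^ 2) ^ (j + 1) * (c * t ^ (2 * k + 1))⁻¹) = (∏ j ∈ range k, (1 + c * t ^ (2 * j + 1) * (t ^ (2 * k))⁻¹)) * qp (-c * t) (t ^ 2) (N - k) := by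
    conv_lhs => rw [h]
    rw [prod_range_add]
    congr 1
    · apply prod_congr rfl; intro j _
      rw [mul_inv, hci]
      field_simp
      ring
    · unfold qp
      apply prod_congr rfl; intro j _
      rw [mul_inv, hci]
      field_simp
      ring
  have e2 : c ^ k * qp (c * t) (t ^ 2) (N + k + 1) = (∏ j ∈ range k, (c + t ^ (2 * j + 1))) * (1 - c * t ^ (2 * k + 1)) * ∏ j ∈ range N, (1 - (t ^ 2) ^ (j + 1) * (c * t ^ (2 * k + 1))) := by
    have h : N + k + 1 = k + 1 + N := by omega
    rw [h, qp_add, qp_succ, qp]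
    have : c ^ k * ∏ k ∈ range k, (1 - c * t * (t ^ 2) ^ k) = ∏ j ∈ range k, (c + t ^ (2 * j + 1)) := by
      conv_lhs => rw [← card_range k, ← prod_const, card_range, ← prod_mul_distrib]
      apply prod_congr rfl; intro j _
      linear_combination (-t * (t ^ 2) ^ j) * hc
    rw [← this]
    have e4 : ∏ j ∈ range N, (1 - c * t * (t ^ 2) ^ (k + 1 + j)) = ∏ j ∈ range N, (1 - (t ^ 2) ^ (j + 1) * (c * t ^ (2 * k + 1))) := by
      apply prod_congr rfl; intro j _
      ring
    rw [e4]
    ring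
  have := neg_prod2 t c ht (by simp [hc]) k
  rw [e1, e2, ← this]
  ring

end RC

set_option linter.all false
namespace RC
open PowerSeries Finset

abbrev KK := FractionRing A
noncomputable abbrev ph : A →+* KK := algebraMap A KK

theorem ph_inj : Function.Injective ph := IsFractionRing.injective A KK

theorem ph_inv {a : A} (h : constantCoeff a ≠ 0) : ph a⁻¹ = (ph a)⁻¹ := by
  symm
  apply inv_eq_of_mul_eq_one_right
  rw [← map_mul, inv_cancel' h, map_one]

theorem ph_ne {a : A} (h : a ≠ 0) : ph a ≠ 0 := by
  intro h2; apply h; apply ph_inj; rw [h2, map_zero]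

theorem cc_ne_zero {a : A} (h : constantCoeff a ≠ 0) : a ≠ 0 := by
  rintro rfl; simp at h

theorem ph_cc {a : A} (h : constantCoeff a ≠ 0) : ph a ≠ 0 := ph_ne (cc_ne_zero h)

theorem X_pow_ne_one {m : ℕ} (hm : m ≠ 0) : (X : A) ^ m ≠ 1 := by
  intro h
  have := congrArg (constantCoeff (R := ℂ)) h
  simp [hm] at this

theorem X_pow_inj {m n : ℕ} (h : (X : A) ^ m = X ^ n) : m = n := by
  have := congrArg (coeff (R := ℂ) m) h
  rw [coeff_X_pow, coeff_X_pow] at this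
  by_contra h2
  simp [h2] at this

instance : CharZero KK := charZero_of_injective_algebraMap (R := ℂ) (algebraMap ℂ KK).injective

/-- `8(1+X^e)/(1-X^e)` -/
noncomputable def Lam (e : ℕ) : A := 8 * (1 + X ^ e) * (1 - X ^ e)⁻¹

theorem R1 (ζ : ℂ) (hζ : ζ ^ 4 = -1) (n : ℕ) (hn : 1 ≤ n) :
    ∑ s ∈ range 8, ip (C (ζ ^ s) * X) n * ip (C (ζ⁻¹ ^ s) * X) n =
     ∑ k ∈ range n, (-1) ^ k * X ^ (k * (k + 1) / 2) * (1 - X ^ (k + 1)) * (ip X (n - 1 - k) * ip X (n + k + 1)) * Lam (8 * (k + 1)) := by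
  have hζ0 : ζ ≠ 0 := by rintro rfl; norm_num at hζ
  apply ph_inj
  set t : KK := ph X with ht
  have ht0 : t ≠ 0 := ph_ne X_ne_zero
  set Z : KK := ph (C ζ) with hZ
  have hZi : ph (C ζ⁻¹) = Z⁻¹ := by
    symm; apply inv_eq_of_mul_eq_one_right
    rw [hZ, ← map_mul, ← map_mul, mul_inv_cancel₀ hζ0]; simp
  have hZ4 : Z ^ 4 = -1 := by rw [hZ, ← map_pow, ← map_pow, hζ]; simp
  have hZ0 : Z ≠ 0 := by intro h; rw [h] at hZ4; norm_num at hZ4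
  have hip : ∀ u : ℂ, ∀ m, ph (ip (C u * X) m) = (∏ k ∈ range m, (1 - ph (C u) * t ^ (k + 1)))⁻¹ := by
    intro u m
    rw [ip, map_prod, ← prod_inv_distrib]
    apply prod_congr rfl
    intro k _
    rw [ph_inv (by simp)]
    simp only [map_sub, map_mul, map_one, map_pow]
    rw [pow_succ']
    ring
  have hip1 : ∀ m, ph (ip X m) = (qp t t m)⁻¹ := by
    intro m
    rw [ip_eq, ph_inv (by rw [cc_qp (by simp)]; simp), map_qp]
  have key : ∀ s ∈ range 8, ph (ip (C (ζ ^ s) * X) n * ip (C (ζ⁻¹ ^ s) * X) n) =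
      ∑ k ∈ range n, (∏ j ∈ range n, if j = k then 1 else ((1 - t ^ (j + 1) * (t ^ (k + 1))⁻¹) * (1 - t ^ (j + 1) * t ^ (k + 1))))⁻¹ * ((1 - Z ^ s * t ^ (k + 1)) * (1 - Z⁻¹ ^ s * t ^ (k + 1)))⁻¹ := by
    intro s _
    rw [map_mul, hip, hip, ← mul_inv, ← prod_mul_distrib]
    haveI : Nonempty (Fin n) := ⟨⟨0, hn⟩⟩
    have := pf (ι := Fin n) (fun i => t ^ (i.1 + 1)) (Z ^ s) (Z⁻¹ ^ s) (by rw [← mul_pow, mul_inv_cancel₀ hZ0, one_pow]) (fun i => pow_ne_zero _ ht0) ?_ ?_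
    · simp only [map_pow, ← hZ, hZi]
      rw [← prod_inv_distrib, ← Fin.prod_univ_eq_prod_range (fun k => ((1 - Z ^ s * t ^ (k + 1)) * (1 - Z⁻¹ ^ s * t ^ (k + 1)))⁻¹), this]
      simp only [Fin.ext_iff]
      rw [Fin.sum_univ_eq_sum_range (fun k => (∏ j : Fin n, if j.1 = k then 1 else ((1 - t ^ (j.1 + 1) * (t ^ (k + 1))⁻¹) * (1 - t ^ (j.1 + 1) * t ^ (k + 1)))⁻¹) * ((1 - Z ^ s * t ^ (k + 1)) * (1 - Z⁻¹ ^ s * t ^ (k + 1)))⁻¹) n]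
      apply sum_congr rfl
      intro k _
      congr 1
      rw [Fin.prod_univ_eq_prod_range (fun j => if j = k then 1 else ((1 - t ^ (j + 1) * (t ^ (k + 1))⁻¹) * (1 - t ^ (j + 1) * t ^ (k + 1)))⁻¹) n, ← prod_inv_distrib]
      apply prod_congr rfl
      intro j _
      split_ifs <;> simp
    · intro i
      have e : (1 - Z ^ s * t ^ (i.1 + 1)) * (1 - Z⁻¹ ^ s * t ^ (i.1 + 1)) = ph ((1 - C (ζ ^ s) * X ^ (i.1 + 1)) * (1 - C (ζ⁻¹ ^ s) * X ^ (i.1 + 1))) := by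
        simp only [map_sub, map_mul, map_one, map_pow, hZi, ← hZ, ht]
      rw [e]
      apply ph_cc
      simp
    · intro i j hij
      apply mul_ne_zero
      · intro h
        apply hij
        have h2 : t ^ (i.1 + 1) = t ^ (j.1 + 1) := by
          have h3 : t ^ (i.1 + 1) ≠ 0 := pow_ne_zero _ ht0
          field_simp at h
          linear_combination h
        rw [ht, ← map_pow, ← map_pow] at h2
        have := X_pow_inj (ph_inj h2)
        ext; omega
      · rw [← pow_add]
        have : ph (1 - X ^ (j.1 + 1 + (i.1 + 1))) ≠ 0 := ph_cc (by simp)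
        simpa using this
  rw [map_sum, sum_congr rfl key, sum_comm, map_sum]
  apply sum_congr rfl
  intro k hk
  rw [mem_range] at hk
  rw [← mul_sum]
  have hy8 : ∀ e : ℕ, e ≠ 0 → 1 - t ^ e ≠ 0 := by
    intro e he
    have : ph (1 - X ^ e) ≠ 0 := ph_cc (by simp [he])
    simpa using this
  rw [lam_sum Z (t ^ (k + 1)) hZ4 (by rw [← pow_mul]; intro h; exact hy8 ((k + 1) * 8) (by omega) (by rw [h, sub_self]))]
  have h1 := k1 t ht0 hk
  have hL : ph (Lam (8 * (k + 1))) = 8 * (1 + (t ^ (k + 1)) ^ 8) * (1 - (t ^ (k + 1)) ^ 8)⁻¹ := by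
    rw [Lam, map_mul, map_mul, ph_inv (by simp)]
    simp only [map_add, map_sub, map_one, map_pow, ← ht, ← pow_mul, mul_comm (k + 1) 8]
    rw [map_ofNat]
  rw [map_mul, hL]
  simp only [map_mul, map_pow, map_neg, map_one, map_sub, ← ht, hip1]
  have n1 := hy8 (k + 1) (by omega)
  have n2 := hy8 ((k + 1) * 2) (by omega)
  rw [pow_mul] at n2
  have n3 : qp t t (n - 1 - k) * qp t t (n + k + 1) ≠ 0 := by
    apply mul_ne_zero <;>
    · unfold qp
      rw [prod_ne_zero_iff]
      intro a _
      rw [← pow_succ']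
      exact hy8 _ (by omega)
  rw [← mul_inv (qp t t _), ← h1]
  rw [← h1] at n3
  have n4 := left_ne_zero_of_mul n3
  have n5 := right_ne_zero_of_mul n3
  generalize (∏ j ∈ range n, if j = k then 1 else ((1 - t ^ (j + 1) * (t ^ (k + 1))⁻¹) * (1 - t ^ (j + 1) * t ^ (k + 1)))) = P at *
  have n6 : t ^ (k * (k + 1) / 2) ≠ 0 := pow_ne_zero _ ht0
  have n7 : ((-1 : KK)) ^ k ≠ 0 := pow_ne_zero _ (by simp)
  generalize (-1 : KK) ^ k = S at *
  generalize t ^ (k * (k + 1) / 2) = TT at *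
  generalize (1 - (t ^ (k + 1)) ^ 8)⁻¹ = V at *
  field_simp

end RC

set_option linter.all false
namespace RC
open PowerSeries Finset

theorem pi_ip_stable {M n : ℕ} (h : M ≤ n) : pi M (ip X n) = pi M (ip X M) := by
  rw [ip_eq, ip_eq]
  apply pi_inv (by rw [cc_qp (by simp)]; simp) (by rw [cc_qp (by simp)]; simp)
  apply pi_qp_stable _ h
  intro m hm
  rw [← pow_succ']
  exact pow_dvd_pow _ (by omega)

noncomputable def Sa (a L : ℕ) : A := ∑ m ∈ range L, X ^ (m ^ 2 + a * m) * (ip X m * ip X (m + a))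

theorem ipX_succ (n : ℕ) : (1 - X ^ (n + 1)) * ip X (n + 1) = ip X n := by
  rw [ip_succ, ← pow_succ']
  have : (1 - X ^ (n + 1) : A) * (1 - X ^ (n + 1))⁻¹ = 1 := inv_cancel' (by simp)
  linear_combination ip X n * this

theorem Sa_rec (a L : ℕ) : Sa a (L + 1) - Sa (a + 1) (L + 1) = X ^ (a + 1) * (Sa (a + 2) L - Sa (a + 1) (L + 1)) := by
  have h : Sa a (L + 1) - Sa (a + 1) (L + 1) + X ^ (a + 1) * Sa (a + 1) (L + 1) = ∑ m ∈ range (L + 1), X ^ (m ^ 2 + a * m) * ((1 - X ^ m) * ip X m * ip X (m + a + 1)) := by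
    unfold Sa
    rw [mul_sum, ← sum_sub_distrib, ← sum_add_distrib]
    apply sum_congr rfl
    intro m _
    rw [← ipX_succ (m + a)]
    ring
  rw [sum_range_succ'] at h
  simp only [pow_zero, sub_self, zero_mul, mul_zero, add_zero] at h
  have h2 : X ^ (a + 1) * Sa (a + 2) L = ∑ m ∈ range L, X ^ ((m + 1) ^ 2 + a * (m + 1)) * ((1 - X ^ (m + 1)) * ip X (m + 1) * ip X (m + 1 + a + 1)) := by
    unfold Sa
    rw [mul_sum]
    apply sum_congr rfl
    intro m _
    rw [ipX_succ]
    have : m + (a + 2) = m + 1 + a + 1 := by ring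
    rw [this]
    ring
  rw [mul_sub, h2]
  linear_combination h

theorem Sa_stable {M a L : ℕ} (h : M ≤ L) : pi M (Sa a L) = pi M (Sa a M) := by
  obtain ⟨c, rfl⟩ := Nat.exists_eq_add_of_le h
  unfold Sa
  rw [sum_range_add, map_add, map_sum _ _ (range c), sum_eq_zero (s := range c), add_zero]
  intro m _
  rw [map_mul, pi_X (by nlinarith), zero_mul]

theorem Sa_diff (M j : ℕ) : ∀ a, X ^ (min j M) ∣ Sa a (M + 1) - Sa (a + 1) (M + 1) := by
  induction j with
  | zero => intro a; simp
  | succ j ih =>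
    intro a
    rw [Sa_rec]
    have h1 := ih (a + 1)
    have h2 : X ^ (min j M) ∣ Sa (a + 2) M - Sa (a + 1) (M + 1) := by
      have h3 : X ^ M ∣ Sa (a + 2) M - Sa (a + 2) (M + 1) := pi_eq.1 (Sa_stable (by omega)).symm
      have h4 : (X : A) ^ (min j M) ∣ X ^ M := pow_dvd_pow _ (by omega)
      have h5 : Sa (a + 2) M - Sa (a + 1) (M + 1) = (Sa (a + 2) M - Sa (a + 2) (M + 1)) - (Sa (a + 1) (M + 1) - Sa (a + 2) (M + 1)) := by ring
      rw [h5]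
      exact dvd_sub (h4.trans h3) h1
    have h6 := mul_dvd_mul (dvd_refl ((X : A) ^ (a + 1))) h2
    rw [← pow_add] at h6
    exact (pow_dvd_pow _ (by omega)).trans h6

theorem Sa_eval {M a L : ℕ} (h : M ≤ L) : pi M (Sa a L) = pi M (ip X M) := by
  have h1 : ∀ a, pi M (Sa a (M + 1)) = pi M (Sa (a + 1) (M + 1)) := by
    intro a
    have := Sa_diff M M a
    rw [min_self] at this
    exact pi_eq.2 this
  have h2 : ∀ b, pi M (Sa a (M + 1)) = pi M (Sa (a + b) (M + 1)) := by
    intro b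
    induction b with
    | zero => rfl
    | succ b ih => rw [ih, h1]; rfl
  rw [Sa_stable h, ← Sa_stable (L := M + 1) (by omega), h2 M]
  unfold Sa
  rw [sum_range_succ', map_add, map_sum, sum_eq_zero]
  · simp only [zero_add, pow_two, mul_zero, pow_zero, one_mul, ip, range_zero, prod_empty]
    exact pi_ip_stable (by omega)
  · intro m _
    rw [map_mul, pi_X (by nlinarith), zero_mul]

theorem Rsum (ζ : ℂ) (hζ : ζ ^ 4 = -1) {M L : ℕ} (hL : 2 * M + 1 ≤ L) :
    pi M (∑ s ∈ range 8, Rs (C (ζ ^ s)) (C (ζ⁻¹ ^ s)) (L + 1)) =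
     pi M (8 + ip X M * ∑ k ∈ range M, (-1) ^ k * X ^ (k * (k + 1) / 2 + (k + 1) ^ 2) * (1 - X ^ (k + 1)) * Lam (8 * (k + 1))) := by
  have e : ∑ s ∈ range 8, Rs (C (ζ ^ s)) (C (ζ⁻¹ ^ s)) (L + 1) = 8 + ∑ k ∈ range L,
     (-1) ^ k * X ^ (k * (k + 1) / 2 + (k + 1) ^ 2) * (1 - X ^ (k + 1)) * Lam (8 * (k + 1)) * Sa (2 * (k + 1)) (L - k) := by
    unfold Rs
    rw [sum_comm, sum_range_succ']
    have h0 : ∑ s ∈ range 8, X ^ 0 ^ 2 * ip (C (ζ ^ s) * X) 0 * ip (C (ζ⁻¹ ^ s) * X) 0 = 8 := by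
      simp [ip]
    rw [h0, add_comm]
    congr 1
    have h1 : ∀ n ∈ range L, ∑ s ∈ range 8, X ^ (n + 1) ^ 2 * ip (C (ζ ^ s) * X) (n + 1) * ip (C (ζ⁻¹ ^ s) * X) (n + 1) =
      ∑ k ∈ range (n + 1), (fun k m => (-1) ^ k * X ^ (k * (k + 1) / 2 + (k + 1) ^ 2) * (1 - X ^ (k + 1)) * Lam (8 * (k + 1)) * (X ^ (m ^ 2 + 2 * (k + 1) * m) * (ip X m * ip X (m + 2 * (k + 1))))) k (n - k) := by
      intro n _
      have := R1 ζ hζ (n + 1) (by omega)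
      simp only [mul_assoc, ← mul_sum] at this ⊢
      rw [this, mul_sum]
      apply sum_congr rfl
      intro k hk
      rw [mem_range] at hk
      obtain ⟨m, rfl⟩ : ∃ m, n = k + m := Nat.exists_eq_add_of_le (by omega)
      have a1 : k + m + 1 - 1 - k = m := by omega
      have a2 : k + m + 1 + k + 1 = m + 2 * (k + 1) := by omega
      have a3 : k + m - k = m := by omega
      rw [a1, a2, a3]
      ring
    rw [sum_congr rfl h1, sum_range_diag_flip L (fun k m => (-1) ^ k * X ^ (k * (k + 1) / 2 + (k + 1) ^ 2) * (1 - X ^ (k + 1)) * Lam (8 * (k + 1)) * (X ^ (m ^ 2 + 2 * (k + 1) * m) * (ip X m * ip X (m + 2 * (k + 1)))))]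
    apply sum_congr rfl
    intro k _
    rw [Sa, mul_sum]
  rw [e, map_add, map_add, mul_sum]
  congr 1
  obtain ⟨c, hc⟩ := Nat.exists_eq_add_of_le (show M ≤ L by omega)
  have e2 : ∀ k, L - k = M + c - k := by intro k; omega
  conv_lhs => rw [hc, sum_range_add]
  rw [map_add, map_sum _ _ (range c), sum_eq_zero (s := range c), add_zero, map_sum, map_sum]
  · apply sum_congr rfl
    intro k hk
    rw [mem_range] at hk
    rw [map_mul, Sa_eval (by omega), ← map_mul, mul_comm]
  · intro k _
    have : k * 0 = 0 := rfl
    simp only [map_mul]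
    rw [pi_X (by nlinarith [Nat.zero_le ((M + k) * (M + k + 1) / 2)])]
    ring

end RC

set_option linter.all false
namespace RC
open Finset

section
variable {K : Type*} [Field K]

def nd (t I : K) (N : ℕ) : Fin N ⊕ (Fin N × Bool) → K
  | Sum.inl k => (t ^ 2) ^ (k.1 + 1)
  | Sum.inr (k, b) => (if b then I else -I) * t ^ (2 * k.1 + 1)

def ndE (N : ℕ) : Fin N ⊕ (Fin N × Bool) → ℕ
  | Sum.inl k => 8 * (k.1 + 1)
  | Sum.inr (k, b) => 4 * (2 * k.1 + 1)

theorem nd4 (t I : K) (hI : I ^ 2 = -1) (N : ℕ) (i) : nd t I N i ^ 4 = t ^ (ndE N i) := by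
  rcases i with k | ⟨k, b⟩
  · simp only [nd, ndE]; ring
  · have : (if b then I else -I) ^ 4 = 1 := by
      cases b <;> simp <;> linear_combination (I ^ 2 - 1) * hI
    simp only [nd, ndE]
    rw [mul_pow, this]; ring

theorem ndE_pos (N : ℕ) (i) : 0 < ndE N i := by
  rcases i with k | ⟨k, b⟩ <;> simp [ndE]

theorem tinj {t : K} (ht : t ≠ 0) (ht1 : ∀ m, m ≠ 0 → t ^ m ≠ 1) {a b : ℕ} (h : t ^ a = t ^ b) : a = b := by
  by_contra hab
  wlog hlt : a < b generalizing a b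
  · exact this h.symm (by omega) (by omega)
  obtain ⟨c, rfl⟩ := Nat.exists_eq_add_of_lt hlt
  apply ht1 (c + 1) (by omega)
  have h2 : t ^ a * t ^ (c + 1) = t ^ a * 1 := by rw [← pow_add, mul_one, h]; rfl
  exact mul_left_cancel₀ (pow_ne_zero _ ht) h2

theorem nd_ne_zero {t I : K} (ht : t ≠ 0) (hI : I ^ 2 = -1) (N : ℕ) (i) : nd t I N i ≠ 0 := by
  intro h
  have := nd4 t I hI N i
  rw [h] at this
  exact pow_ne_zero _ ht (by rw [← this]; simp)

theorem nd_mul {t I : K} (ht1 : ∀ m, m ≠ 0 → t ^ m ≠ 1) (hI : I ^ 2 = -1) (N : ℕ) (i j) : nd t I N i * nd t I N j ≠ 1 := by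
  intro h
  have h1 := nd4 t I hI N i
  have h2 := nd4 t I hI N j
  apply ht1 (ndE N i + ndE N j) (by have := ndE_pos N i; omega)
  rw [pow_add, ← h1, ← h2, ← mul_pow, h, one_pow]

theorem nd_inj [CharZero K] {t I : K} (ht : t ≠ 0) (ht1 : ∀ m, m ≠ 0 → t ^ m ≠ 1) (hI : I ^ 2 = -1) (N : ℕ) (i j)
    (h : nd t I N i = nd t I N j) : i = j := by
  have h1 := nd4 t I hI N i
  have h2 := nd4 t I hI N j
  rw [h, h2] at h1
  have h3 := tinj ht ht1 h1
  have hI0 : I ≠ 0 := by rintro rfl; norm_num at hI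
  rcases i with k | ⟨k, b⟩ <;> rcases j with k' | ⟨k', b'⟩ <;> simp only [ndE] at h3
  · congr 1; ext; omega
  · omega
  · omega
  · have : k = k' := by ext; omega
    subst this
    simp only [nd] at h
    have h4 := mul_right_cancel₀ (pow_ne_zero _ ht) h
    have h5 : I ≠ -I := by
      intro h
      apply hI0
      have : 2 * I = 0 := by linear_combination h
      simpa using this
    cases b <;> cases b' <;> simp at h4 ⊢
    · exact h5 h4.symm
    · exact h5 h4

/-- weights -/
def wt (t I : K) (N : ℕ) (i : Fin N ⊕ (Fin N × Bool)) : K :=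
  ∏ j, if j = i then 1 else ((1 - nd t I N j * (nd t I N i)⁻¹) * (1 - nd t I N j * nd t I N i))⁻¹

theorem X1K [CharZero K] (t I Z : K) (ht : t ≠ 0) (ht1 : ∀ m, m ≠ 0 → t ^ m ≠ 1) (hI : I ^ 2 = -1) (hZ : Z ^ 4 = -1)
    (N : ℕ) (hN : 1 ≤ N) :
    ∑ s ∈ range 8, ∏ i, ((1 - Z ^ s * nd t I N i) * (1 - Z⁻¹ ^ s * nd t I N i))⁻¹ =
      ∑ i, wt t I N i * (8 * (1 + nd t I N i ^ 8) * (1 - nd t I N i ^ 8)⁻¹ * (1 - nd t I N i ^ 2)⁻¹) := by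
  have hZ0 : Z ≠ 0 := by rintro rfl; norm_num at hZ
  have hy8 : ∀ i, nd t I N i ^ 8 ≠ 1 := by
    intro i h
    have h1 := nd4 t I hI N i
    apply ht1 (ndE N i * 2) (by have := ndE_pos N i; omega)
    rw [pow_mul, ← h1, ← pow_mul, h]
  haveI : Nonempty (Fin N ⊕ (Fin N × Bool)) := ⟨Sum.inl ⟨0, hN⟩⟩
  have hZ8 : Z ^ 8 = 1 := by linear_combination (Z ^ 4 - 1) * hZ
  have hfac : ∀ u : K, u ^ 8 = 1 → ∀ i, 1 - u * nd t I N i ≠ 0 := by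
    intro u hu i h
    apply hy8 i
    have : u * nd t I N i = 1 := by linear_combination -h
    have : (u * nd t I N i) ^ 8 = 1 := by rw [this, one_pow]
    rw [mul_pow, hu, one_mul] at this
    exact this
  have key : ∀ s ∈ range 8, ∏ i, ((1 - Z ^ s * nd t I N i) * (1 - Z⁻¹ ^ s * nd t I N i))⁻¹ = 
      ∑ i, wt t I N i * ((1 - Z ^ s * nd t I N i) * (1 - Z⁻¹ ^ s * nd t I N i))⁻¹ := by
    intro s _
    apply pf (nd t I N) (Z ^ s) (Z⁻¹ ^ s) (by rw [← mul_pow, mul_inv_cancel₀ hZ0, one_pow]) (nd_ne_zero ht hI N)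
    · intro i
      apply mul_ne_zero
      · apply hfac; rw [← pow_mul, mul_comm, pow_mul, hZ8, one_pow]
      · apply hfac; rw [← pow_mul, mul_comm, pow_mul, inv_pow, hZ8, inv_one, one_pow]
    · intro i j hij
      apply mul_ne_zero
      · intro h
        apply hij
        apply nd_inj ht ht1 hI N
        have := nd_ne_zero ht hI N i
        field_simp at h
        linear_combination h
      · intro h
        exact nd_mul ht1 hI N j i (by linear_combination -h)
  rw [sum_congr rfl key, sum_comm]
  apply sum_congr rfl
  intro i _
  rw [← mul_sum, lam_sum Z _ hZ (hy8 i)]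

theorem wt_inl (t I : K) (ht : t ≠ 0) (hI : I ^ 2 = -1)
    (N : ℕ) (k : Fin N) : (wt t I N (Sum.inl k))⁻¹ * ((-1) ^ k.1 * (t ^ 2) ^ (k.1 * (k.1 + 1) / 2 + (k.1 + 1) ^ 2) * (1 - (t ^ 2) ^ (k.1 + 1)) * (1 - ((t ^ 2) ^ (k.1 + 1)) ^ 2)) =
     qp (t ^ 2) (t ^ 2) (N - 1 - k) * qp (t ^ 2) (t ^ 2) (N + k + 1) * (qp (-t ^ 2) ((t ^ 2) ^ 2) (N - 1 - k) * qp (-t ^ 2) ((t ^ 2) ^ 2) (N + k + 1)) := by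
  have h1 := k1 (t ^ 2) (pow_ne_zero _ ht) k.2
  have h3 := k3 (t ^ 2) (pow_ne_zero _ ht) (k := k.1 + 1) (N := N) k.2
  rw [show N - 1 - k.1 = N - (k.1 + 1) by omega] at *
  rw [show N + (k.1 + 1) = N + k.1 + 1 by omega] at h3
  rw [← h1, ← h3]
  rw [wt, ← prod_inv_distrib, Fintype.prod_sum_type, Fintype.prod_prod_type]
  simp only [Fintype.prod_bool, reduceCtorEq, if_false, Sum.inl.injEq, Fin.ext_iff, nd, Bool.false_eq_true, inv_inv, if_true, if_pos]
  rw [← Fin.prod_univ_eq_prod_range, ← Fin.prod_univ_eq_prod_range]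
  have e1 : ∀ x : Fin N, (if x.1 = k.1 then (1 : K) else ((1 - (t ^ 2) ^ (x.1 + 1) * ((t ^ 2) ^ (k.1 + 1))⁻¹) * (1 - (t ^ 2) ^ (x.1 + 1) * (t ^ 2) ^ (k.1 + 1)))⁻¹)⁻¹ = if x.1 = k.1 then (1 : K) else ((1 - (t ^ 2) ^ (x.1 + 1) * ((t ^ 2) ^ (k.1 + 1))⁻¹) * (1 - (t ^ 2) ^ (x.1 + 1) * (t ^ 2) ^ (k.1 + 1))) := by
    intro x; split_ifs <;> simp
  rw [prod_congr rfl (fun x _ => e1 x)]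
  have e2 : ∀ x : Fin N, ((1 - I * t ^ (2 * x.1 + 1) * ((t ^ 2) ^ (k.1 + 1))⁻¹) * (1 - I * t ^ (2 * x.1 + 1) * (t ^ 2) ^ (k.1 + 1))) * ((1 - -I * t ^ (2 * x.1 + 1) * ((t ^ 2) ^ (k.1 + 1))⁻¹) * (1 - -I * t ^ (2 * x.1 + 1) * (t ^ 2) ^ (k.1 + 1))) =
     (1 + (t ^ 2) ^ (2 * x.1 + 1) * ((t ^ 2) ^ (2 * (k.1 + 1)))⁻¹) * (1 + (t ^ 2) ^ (2 * x.1 + 1) * (t ^ 2) ^ (2 * (k.1 + 1))) := by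
    intro x
    have a : ((t ^ 2) ^ (2 * (k.1 + 1)))⁻¹ = (((t ^ 2) ^ (k.1 + 1))⁻¹) ^ 2 := by rw [inv_pow]; ring
    rw [a]
    generalize ((t ^ 2) ^ (k.1 + 1))⁻¹ = u
    have b : (1 - I * t ^ (2 * x.1 + 1) * u) * (1 - -I * t ^ (2 * x.1 + 1) * u) = 1 + (t ^ 2) ^ (2 * x.1 + 1) * u ^ 2 := by
      linear_combination (-(t ^ 2) ^ (2 * x.1 + 1) * u ^ 2) * hI
    have c : (1 - I * t ^ (2 * x.1 + 1) * (t ^ 2) ^ (k.1 + 1)) * (1 - -I * t ^ (2 * x.1 + 1) * (t ^ 2) ^ (k.1 + 1)) = 1 + (t ^ 2) ^ (2 * x.1 + 1) * (t ^ 2) ^ (2 * (k.1 + 1)) := by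
      linear_combination (-(t ^ 2) ^ (2 * x.1 + 1) * (t ^ 2) ^ (2 * (k.1 + 1))) * hI
    rw [← b, ← c]
    ring
  rw [prod_congr rfl (fun x _ => e2 x)]
  rw [pow_add (t ^ 2)]
  ring

theorem wt_inr (t I : K) (ht : t ≠ 0) (hI : I ^ 2 = -1)
    (N : ℕ) (k : Fin N) (b : Bool) (c : K) (hc : c = if b then I else -I) : (wt t I N (Sum.inr (k, b)))⁻¹ * (((-1) ^ k.1 * ((t ^ 2) ^ 2) ^ (k.1 * (k.1 + 1) / 2) * (1 + (t ^ 2) ^ (2 * k.1 + 1)) * (t ^ (k.1 ^ 2) * (1 - c * t ^ (2 * k.1 + 1))))) =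
     2 * c ^ k.1 * (qp ((t ^ 2) ^ 2) ((t ^ 2) ^ 2) (N - 1 - k) * qp ((t ^ 2) ^ 2) ((t ^ 2) ^ 2) (N + k) * (qp (c * t) (t ^ 2) (N + k + 1) * qp (-c * t) (t ^ 2) (N - k))) := by
  have hc2 : c ^ 2 = -1 := by rw [hc]; cases b <;> simp [hI]
  have hcI : c * c⁻¹ = 1 := by apply mul_inv_cancel₀; rintro rfl; norm_num at hc2
  have hci : c⁻¹ = -c := by apply inv_eq_of_mul_eq_one_right; linear_combination -hc2
  have h1 := k2 ((t ^ 2) ^ 2) (pow_ne_zero _ (pow_ne_zero _ ht)) k.2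
  have h3 := k4 t c ht hc2 (k := k.1) (N := N) (by omega)
  have h4 : 2 * c ^ k.1 * (qp ((t ^ 2) ^ 2) ((t ^ 2) ^ 2) (N - 1 - k) * qp ((t ^ 2) ^ 2) ((t ^ 2) ^ 2) (N + k) * (qp (c * t) (t ^ 2) (N + k + 1) * qp (-c * t) (t ^ 2) (N - k))) = 2 * (qp ((t ^ 2) ^ 2) ((t ^ 2) ^ 2) (N - 1 - k) * qp ((t ^ 2) ^ 2) ((t ^ 2) ^ 2) (N + k)) * (c ^ k.1 * qp (c * t) (t ^ 2) (N + k + 1) * qp (-c * t) (t ^ 2) (N - k)) := by ring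
  rw [h4, ← h1, ← h3]
  clear h1 h3 h4
  rw [wt, ← prod_inv_distrib, Fintype.prod_sum_type, Fintype.prod_prod_type]
  rw [← Fin.prod_univ_eq_prod_range, ← Fin.prod_univ_eq_prod_range]
  have e1 : ∀ x : Fin N, (∏ y : Bool, (if (Sum.inr (x, y) : Fin N ⊕ (Fin N × Bool)) = Sum.inr (k, b) then (1 : K) else ((1 - nd t I N (Sum.inr (x, y)) * (nd t I N (Sum.inr (k, b)))⁻¹) * (1 - nd t I N (Sum.inr (x, y)) * nd t I N (Sum.inr (k, b))))⁻¹)⁻¹) =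
     (if x.1 = k.1 then 1 else ((1 - ((t ^ 2) ^ 2) ^ x.1 * (((t ^ 2) ^ 2) ^ k.1)⁻¹) * (1 - ((t ^ 2) ^ 2) ^ (x.1 + k.1 + 1)))) * (if x = k then 2 * (1 - (t ^ 2) ^ (2 * k.1 + 1)) else 1) := by
    intro x
    by_cases hx : x = k
    · subst hx
      have hu : t ^ (2 * x.1 + 1) ≠ 0 := pow_ne_zero _ ht
      have hu2 : (t ^ 2) ^ (2 * x.1 + 1) = (t ^ (2 * x.1 + 1)) ^ 2 := by ring
      rw [hu2]
      cases b
      · simp [nd] at hc ⊢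
        generalize t ^ (2 * x.1 + 1) = u at *
        subst hc
        have hI0 : I ≠ 0 := by rintro rfl; norm_num at hI
        field_simp
        linear_combination 2 * u ^ 2 * hI
      · simp [nd] at hc ⊢
        generalize t ^ (2 * x.1 + 1) = u at *
        subst hc
        have hI0 : c ≠ 0 := by rintro rfl; norm_num at hI
        field_simp
        linear_combination 2 * u ^ 2 * hI
    · have hx' : x.1 ≠ k.1 := fun h => hx (Fin.ext h)
      have e0 : nd t I N (Sum.inr (k, b)) = c * t ^ (2 * k.1 + 1) := by simp [nd, hc]
      rw [e0]
      simp only [Fintype.prod_bool, Sum.inr.injEq, Prod.mk.injEq, hx, hx', if_false, false_and, nd, inv_inv, mul_one, if_true, Bool.false_eq_true]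
      rw [mul_inv, hci]
      have a1 : ((t ^ 2) ^ 2) ^ x.1 * (((t ^ 2) ^ 2) ^ k.1)⁻¹ = (t ^ (2 * x.1 + 1) * (t ^ (2 * k.1 + 1))⁻¹) ^ 2 := by
        field_simp; ring
      have a2 : ((t ^ 2) ^ 2) ^ (x.1 + k.1 + 1) = (t ^ (2 * x.1 + 1) * (t ^ (2 * k.1 + 1))) ^ 2 := by ring
      rw [a1, a2]
      generalize (t ^ (2 * k.1 + 1))⁻¹ = v
      generalize t ^ (2 * k.1 + 1) = v'
      generalize t ^ (2 * x.1 + 1) = u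
      have b1 : (1 - I * u * (-c * v)) * (1 - -I * u * (-c * v)) = 1 - (u * v) ^ 2 := by
        linear_combination (- (u * v) ^ 2 * c ^ 2) * hI + (u * v) ^ 2 * hc2
      have b2 : (1 - I * u * (c * v')) * (1 - -I * u * (c * v')) = 1 - (u * v') ^ 2 := by
        linear_combination (- (u * v') ^ 2 * c ^ 2) * hI + (u * v') ^ 2 * hc2
      rw [← b1, ← b2]
      ring
  rw [prod_congr rfl (fun x _ => e1 x), prod_mul_distrib, prod_ite_eq' univ k, if_pos (mem_univ k)]
  have e2 : ∀ x : Fin N, (if (Sum.inl x : Fin N ⊕ (Fin N × Bool)) = Sum.inr (k, b) then (1 : K) else ((1 - nd t I N (Sum.inl x) * (nd t I N (Sum.inr (k, b)))⁻¹) * (1 - nd t I N (Sum.inl x) * nd t I N (Sum.inr (k, b))))⁻¹)⁻¹ = 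
    (1 - (t ^ 2) ^ (x.1 + 1) * (c * t ^ (2 * k.1 + 1))⁻¹) * (1 - (t ^ 2) ^ (x.1 + 1) * (c * t ^ (2 * k.1 + 1))) := by
    intro x
    simp only [reduceCtorEq, if_false, inv_inv, nd, ← hc]
  rw [prod_congr rfl (fun x _ => e2 x)]
  have e3 : 1 - ((t ^ 2) ^ 2) ^ (2 * k.1 + 1) = (1 - (t ^ 2) ^ (2 * k.1 + 1)) * (1 + (t ^ 2) ^ (2 * k.1 + 1)) := by ring
  rw [e3]
  ring

end
end RC

set_option linter.all false
namespace RC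
open PowerSeries Finset

noncomputable def XQ (z w : A) (N : ℕ) : A := qp (z * X ^ 2) (X ^ 2) N * qp (w * X ^ 2) (X ^ 2) N * (qp (-z ^ 2 * X ^ 2) ((X ^ 2) ^ 2) N * qp (-w ^ 2 * X ^ 2) ((X ^ 2) ^ 2) N)

noncomputable def K1d (N k : ℕ) : A := qp (X ^ 2) (X ^ 2) (N - 1 - k) * qp (X ^ 2) (X ^ 2) (N + k + 1) * (qp (-X ^ 2) ((X ^ 2) ^ 2) (N - 1 - k) * qp (-X ^ 2) ((X ^ 2) ^ 2) (N + k + 1))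
noncomputable def Gd (c : ℂ) (N k : ℕ) : A := qp ((X ^ 2) ^ 2) ((X ^ 2) ^ 2) (N - 1 - k) * qp ((X ^ 2) ^ 2) ((X ^ 2) ^ 2) (N + k) * (qp (C c * X) (X ^ 2) (N + k + 1) * qp (-C c * X) (X ^ 2) (N - k))
noncomputable def Kt (N k : ℕ) : A := ((-1) ^ k * (X ^ 2) ^ (k * (k + 1) / 2 + (k + 1) ^ 2) * (1 - (X ^ 2) ^ (k + 1))) * (K1d N k)⁻¹
noncomputable def Gt (c : ℂ) (N k : ℕ) : A := C (2⁻¹ * c⁻¹ ^ k) * ((-1) ^ k * ((X ^ 2) ^ 2) ^ (k * (k + 1) / 2) * (X ^ (k ^ 2) * (1 - C c * X ^ (2 * k + 1)))) * (Gd c N k)⁻¹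

theorem cc_XQ (z w : A) (N : ℕ) : constantCoeff (XQ z w N) = 1 := by
  unfold XQ; simp only [map_mul]
  rw [cc_qp (by simp), cc_qp (by simp), cc_qp (by simp), cc_qp (by simp)]; simp
theorem cc_K1d (N k : ℕ) : constantCoeff (K1d N k) = 1 := by
  unfold K1d; simp only [map_mul]
  rw [cc_qp (by simp), cc_qp (by simp), cc_qp (by simp), cc_qp (by simp)]; simp
theorem cc_Gd (c : ℂ) (N k : ℕ) : constantCoeff (Gd c N k) = 1 := by
  unfold Gd; simp only [map_mul]
  rw [cc_qp (by simp), cc_qp (by simp), cc_qp (by simp), cc_qp (by simp)]; simp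

theorem ph_Lam (e : ℕ) (he : e ≠ 0) : ph (Lam e) = 8 * (1 + ph X ^ e) * (1 - ph X ^ e)⁻¹ := by
  rw [Lam, map_mul, map_mul, ph_inv (by simp [he])]
  simp only [map_add, map_sub, map_one, map_pow]
  rw [map_ofNat]

theorem X1 (ζ : ℂ) (hζ : ζ ^ 4 = -1) (N : ℕ) (hN : 1 ≤ N) :
    ∑ s ∈ range 8, (XQ (C (ζ ^ s)) (C (ζ⁻¹ ^ s)) N)⁻¹ =
      ∑ k ∈ range N, Kt N k * Lam (16 * (k + 1)) +
      ∑ k ∈ range N, (Gt Complex.I N k + Gt (-Complex.I) N k) * Lam (8 * (2 * k + 1)) := by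
  have hζ0 : ζ ≠ 0 := by rintro rfl; norm_num at hζ
  apply ph_inj
  set t : KK := ph X with ht
  have ht0 : t ≠ 0 := ph_ne X_ne_zero
  set Z : KK := ph (C ζ) with hZ
  set I : KK := ph (C Complex.I) with hI
  have hI2 : I ^ 2 = -1 := by rw [hI, ← map_pow, ← map_pow, Complex.I_sq]; simp
  have hZi : ph (C ζ⁻¹) = Z⁻¹ := by
    symm; apply inv_eq_of_mul_eq_one_right
    rw [hZ, ← map_mul, ← map_mul, mul_inv_cancel₀ hζ0]; simp
  have hZ4 : Z ^ 4 = -1 := by rw [hZ, ← map_pow, ← map_pow, hζ]; simp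
  have hy8 : ∀ e : ℕ, e ≠ 0 → 1 - t ^ e ≠ 0 := by
    intro e he
    have : ph (1 - X ^ e) ≠ 0 := ph_cc (by simp [he])
    simpa using this
  have key : ∀ s ∈ range 8, ph ((XQ (C (ζ ^ s)) (C (ζ⁻¹ ^ s)) N)⁻¹) = ∏ i, ((1 - Z ^ s * nd t I N i) * (1 - Z⁻¹ ^ s * nd t I N i))⁻¹ := by
    intro s _
    rw [ph_inv (by rw [cc_XQ]; simp), prod_inv_distrib]
    congr 1
    rw [Fintype.prod_sum_type, Fintype.prod_prod_type]
    rw [XQ]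
    simp only [map_mul, map_qp, map_pow, map_neg, ← hZ, hZi, ← ht]
    congr 1
    · unfold qp
      rw [← prod_mul_distrib, ← Fin.prod_univ_eq_prod_range]
      apply prod_congr rfl
      intro k _
      simp only [nd]
      ring
    · unfold qp
      rw [← prod_mul_distrib, ← Fin.prod_univ_eq_prod_range]
      apply prod_congr rfl
      intro k _
      simp only [nd, Fintype.prod_bool, if_true, Bool.false_eq_true, if_false]
      generalize Z ^ s = z
      generalize Z⁻¹ ^ s = w
      have h1 : ∀ z : KK, (1 - z * (I * t ^ (2 * k.1 + 1))) * (1 - z * (-I * t ^ (2 * k.1 + 1))) = 1 - -z ^ 2 * t ^ 2 * ((t ^ 2) ^ 2) ^ k.1 := by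
        intro z
        linear_combination (- z ^ 2 * t ^ (4 * k.1 + 2)) * hI2
      rw [← h1, ← h1]
      ring
  rw [map_sum, sum_congr rfl key, X1K t I Z ht0 (fun m hm h => hy8 m hm (by rw [h, sub_self])) hI2 hZ4 N hN,
    Fintype.sum_sum_type, Fintype.sum_prod_type, map_add, map_sum, map_sum]
  congr 1
  · rw [← Fin.sum_univ_eq_sum_range]
    apply sum_congr rfl
    intro k _
    rw [map_mul, ph_Lam _ (by omega), ← ht]
    have h := wt_inl t I ht0 hI2 N k
    have hK : ph (K1d N k) = qp (t ^ 2) (t ^ 2) (N - 1 - k) * qp (t ^ 2) (t ^ 2) (N + k + 1) * (qp (-t ^ 2) ((t ^ 2) ^ 2) (N - 1 - k) * qp (-t ^ 2) ((t ^ 2) ^ 2) (N + k + 1)) := by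
      unfold K1d
      simp only [map_mul, map_qp, map_pow, map_neg, ← ht]
    rw [← hK] at h
    have hK0 : ph (K1d N k) ≠ 0 := ph_cc (by rw [cc_K1d]; simp)
    rw [Kt, map_mul, ph_inv (by rw [cc_K1d]; simp)]
    simp only [map_mul, map_sub, map_one, map_pow, map_neg, ← ht]
    have e8 : nd t I N (Sum.inl k) ^ 8 = t ^ (16 * (k.1 + 1)) := by simp only [nd]; ring
    have e2 : nd t I N (Sum.inl k) ^ 2 = ((t ^ 2) ^ (k.1 + 1)) ^ 2 := by simp only [nd]
    rw [e8, e2]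
    rw [← h] at hK0 ⊢
    have n1 : wt t I N (Sum.inl k) ≠ 0 := by
      intro h2; rw [h2] at hK0; simp at hK0
    have n2 := right_ne_zero_of_mul hK0
    have n3 := right_ne_zero_of_mul n2
    have n4 := left_ne_zero_of_mul n2
    generalize (-1) ^ k.1 * (t ^ 2) ^ (k.1 * (k.1 + 1) / 2 + (k.1 + 1) ^ 2) * (1 - (t ^ 2) ^ (k.1 + 1)) = a at *
    generalize (1 - ((t ^ 2) ^ (k.1 + 1)) ^ 2) = b at *
    generalize (1 - t ^ (16 * (k.1 + 1)))⁻¹ = v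
    field_simp
  · rw [← Fin.sum_univ_eq_sum_range]
    apply sum_congr rfl
    intro k _
    rw [map_mul, ph_Lam _ (by omega), ← ht]
    have gen : ∀ (b : Bool) (c : ℂ) (hc : c = if b then Complex.I else -Complex.I), wt t I N (Sum.inr (k, b)) * (8 * (1 + nd t I N (Sum.inr (k, b)) ^ 8) * (1 - nd t I N (Sum.inr (k, b)) ^ 8)⁻¹ * (1 - nd t I N (Sum.inr (k, b)) ^ 2)⁻¹) = ph (Gt c N k) * (8 * (1 + t ^ (8 * (2 * k.1 + 1))) * (1 - t ^ (8 * (2 * k.1 + 1)))⁻¹) := by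
      intro b c hc
      have hc' : ph (C c) = if b then I else -I := by
        rw [hc, hI]; cases b <;> simp
      have hc0 : c ≠ 0 := by rw [hc]; cases b <;> simp
      have h := wt_inr t I ht0 hI2 N k b _ hc'
      have hK : ph (Gd c N k) = (qp ((t ^ 2) ^ 2) ((t ^ 2) ^ 2) (N - 1 - k) * qp ((t ^ 2) ^ 2) ((t ^ 2) ^ 2) (N + k) * (qp (ph (C c) * t) (t ^ 2) (N + k + 1) * qp (-ph (C c) * t) (t ^ 2) (N - k))) := by
        unfold Gd
        simp only [map_mul, map_qp, map_pow, map_neg, ← ht]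
      rw [← hK] at h
      have hK0 : ph (Gd c N k) ≠ 0 := ph_cc (by rw [cc_Gd]; simp)
      rw [Gt, map_mul, ph_inv (by rw [cc_Gd]; simp)]
      simp only [map_mul, map_sub, map_one, map_pow, map_neg, ← ht]
      have hcc : (ph (C c)) ^ 2 = -1 := by rw [hc']; cases b <;> simp [hI2]
      have e2 : nd t I N (Sum.inr (k, b)) ^ 2 = - (t ^ 2) ^ (2 * k.1 + 1) := by
        simp only [nd]
        rw [← hc', mul_pow, hcc]; ring
      have e8 : nd t I N (Sum.inr (k, b)) ^ 8 = t ^ (8 * (2 * k.1 + 1)) := by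
        have : nd t I N (Sum.inr (k, b)) ^ 8 = (nd t I N (Sum.inr (k, b)) ^ 2) ^ 4 := by ring
        rw [this, e2]; ring
      rw [e8, e2]
      have g0 : ph (C c) ≠ 0 := by intro h; rw [h] at hcc; norm_num at hcc
      have gi : ph (C c⁻¹) = (ph (C c))⁻¹ := by
        symm; apply inv_eq_of_mul_eq_one_right
        rw [← map_mul, ← map_mul, mul_inv_cancel₀ hc0]; simp
      have g2 : ph (C 2⁻¹) = (2 : KK)⁻¹ := by
        symm; apply inv_eq_of_mul_eq_one_right
        have : (2 : KK) = ph (C 2) := by rw [map_ofNat, map_ofNat]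
        rw [this, ← map_mul, ← map_mul]; norm_num
      have g4 : ph (C c) ^ k.1 ≠ 0 := pow_ne_zero _ g0
      rw [gi, g2, sub_neg_eq_add, inv_pow]
      have hQ : 2 * ph (C c) ^ k.1 * ph (Gd c N k) ≠ 0 := mul_ne_zero (mul_ne_zero (by norm_num) g4) hK0
      have n1 : wt t I N (Sum.inr (k, b)) ≠ 0 := by
        intro h2; rw [← h, h2] at hQ; simp at hQ
      have e5 : 2⁻¹ * (ph (C c) ^ k.1)⁻¹ * ((-1) ^ k.1 * ((t ^ 2) ^ 2) ^ (k.1 * (k.1 + 1) / 2) * (t ^ k.1 ^ 2 * (1 - ph (C c) * t ^ (2 * k.1 + 1)))) * (ph (Gd c N k))⁻¹ = ((-1) ^ k.1 * ((t ^ 2) ^ 2) ^ (k.1 * (k.1 + 1) / 2) * (t ^ k.1 ^ 2 * (1 - ph (C c) * t ^ (2 * k.1 + 1)))) * (2 * ph (C c) ^ k.1 * ph (Gd c N k))⁻¹ := by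
        rw [mul_inv, mul_inv]; ring
      rw [e5]
      rw [← h] at hQ ⊢
      have n2 := right_ne_zero_of_mul hQ
      have n3 := right_ne_zero_of_mul n2
      have n4 := left_ne_zero_of_mul n2
      have n5 := right_ne_zero_of_mul n4
      have n6 := left_ne_zero_of_mul n4
      generalize t ^ k.1 ^ 2 * (1 - ph (C c) * t ^ (2 * k.1 + 1)) = a at *
      generalize (-1) ^ k.1 * ((t ^ 2) ^ 2) ^ (k.1 * (k.1 + 1) / 2) = a' at *
      generalize (1 + (t ^ 2) ^ (2 * k.1 + 1)) = b at *
      generalize (1 - t ^ (8 * (2 * k.1 + 1)))⁻¹ = v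
      generalize wt t I N _ = W at *
      field_simp
    rw [Fintype.sum_bool, gen true Complex.I (by simp), gen false (-Complex.I) (by simp), map_add]
    ring

end RC

set_option linter.all false
namespace RC
open PowerSeries Finset

theorem st {M n : ℕ} {a q : A} (hq : X ∣ q) (h : M ≤ n) : pi M (qp a q n) = pi M (qp a q M) := by
  apply pi_qp_stable _ h
  intro m hm
  exact ((pow_dvd_pow_of_dvd hq M).trans (pow_dvd_pow q hm)).trans (Dvd.intro_left _ rfl)

theorem st2 {M n n' : ℕ} {a q : A} (hq : X ∣ q) (h : M ≤ n) (h' : M ≤ n') : pi M (qp a q n) = pi M (qp a q n') := by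
  rw [st hq h, st hq h']

theorem pi_quot {M : ℕ} {E D F : A} (hD : constantCoeff D ≠ 0) (hF : constantCoeff F ≠ 0) (h : pi M (E * F) = pi M D) :
    pi M (E * D⁻¹) = pi M F⁻¹ := by
  have h1 := congrArg (pi M) (inv_cancel' hD)
  have h2 := congrArg (pi M) (inv_cancel' hF)
  rw [map_mul, map_one] at h1 h2
  rw [map_mul] at h ⊢
  linear_combination (pi M F⁻¹ * pi M D⁻¹) * h - pi M E * pi M D⁻¹ * h2 + pi M F⁻¹ * h1

noncomputable def ex (d : ℕ) (hd : d ≠ 0) : A →+* A := (expand (R := ℂ) d hd : A →+* A)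

theorem ex_X (d : ℕ) (hd : d ≠ 0) : ex d hd X = X ^ d := expand_X d hd
theorem ex_C (d : ℕ) (hd : d ≠ 0) (c : ℂ) : ex d hd (C c) = C c := expand_C d hd c
theorem ex_cc (d : ℕ) (hd : d ≠ 0) (a : A) : constantCoeff (ex d hd a) = constantCoeff a := constantCoeff_expand d hd a
theorem ex_coeff (d : ℕ) (hd : d ≠ 0) (a : A) (n : ℕ) : coeff (d * n) (ex d hd a) = coeff n a := coeff_expand_mul d hd a n
theorem ex_coeff0 (d : ℕ) (hd : d ≠ 0) (a : A) (n : ℕ) (h : ¬ d ∣ n) : coeff n (ex d hd a) = 0 := coeff_expand_of_not_dvd d hd a h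
theorem ex_inv (d : ℕ) (hd : d ≠ 0) {a : A} (h : constantCoeff a ≠ 0) : ex d hd a⁻¹ = (ex d hd a)⁻¹ := by
  have h1 := congrArg (ex d hd) (inv_cancel' h)
  rw [map_mul, map_one] at h1
  have h2 := inv_cancel' (a := ex d hd a) (by rwa [ex_cc])
  linear_combination (ex d hd a)⁻¹ * h1 - ex d hd a⁻¹ * h2

theorem ex_Lam (d : ℕ) (hd : d ≠ 0) (e : ℕ) (he : e ≠ 0) : ex d hd (Lam e) = Lam (d * e) := by
  unfold Lam
  rw [map_mul, map_mul, ex_inv d hd (by simp [he])]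
  simp only [map_add, map_sub, map_one, map_pow, ex_X, ← pow_mul]
  rw [map_ofNat]

noncomputable def Et (N : ℕ) : A := qp (X ^ 2) (X ^ 2) N * (qp (-X ^ 2) ((X ^ 2) ^ 2) N * qp (-X ^ 2) ((X ^ 2) ^ 2) N)

/-- splitting into even and odd -/
theorem qp_two {R : Type*} [CommRing R] (q : R) (N : ℕ) : qp q q (2 * N) = qp q (q ^ 2) N * qp (q ^ 2) (q ^ 2) N := by
  induction N with
  | zero => simp [qp]
  | succ N ih =>
    rw [show 2 * (N + 1) = 2 * N + 1 + 1 by ring, qp_succ, qp_succ, ih, qp_succ, qp_succ]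
    ring

theorem qp_sq {R : Type*} [CommRing R] (a q : R) (N : ℕ) : qp a q N * qp (-a) q N = qp (a ^ 2) (q ^ 2) N := by
  unfold qp
  rw [← prod_mul_distrib]
  apply prod_congr rfl
  intro k _
  ring

theorem four_id {R : Type*} [CommRing R] (q : R) (N : ℕ) :
    qp q q (2 * N) * qp (-q) (q ^ 2) N * qp ((q ^ 2) ^ 2) ((q ^ 2) ^ 2) N = qp (q ^ 2) (q ^ 2) N * qp (q ^ 2) (q ^ 2) (2 * N) := by
  rw [qp_two q, qp_two (q ^ 2), ← qp_sq q (q ^ 2)]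
  ring

theorem pi_K1d {M N k : ℕ} (hN : 2 * M ≤ N) (hk : k < M) : pi M (Et N * (K1d N k)⁻¹) = pi M (ex 2 (by simp) (ip X M)) := by
  have h2 : (X : A) ∣ X ^ 2 := dvd_pow_self _ (by simp)
  have h4 : (X : A) ∣ (X ^ 2) ^ 2 := h2.trans (dvd_pow_self _ (by simp))
  rw [ip_eq, ex_inv _ _ (by rw [cc_qp (by simp)]; simp), map_qp, ex_X]
  apply pi_quot (by rw [cc_K1d]; simp) (by rw [cc_qp (by simp)]; simp)
  unfold Et K1d
  simp only [map_mul]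
  rw [st h2 (show M ≤ N by omega), st h4 (show M ≤ N by omega), st h2 (show M ≤ N - 1 - k by omega), st h2 (show M ≤ N + k + 1 by omega),
    st h4 (show M ≤ N - 1 - k by omega), st h4 (show M ≤ N + k + 1 by omega)]
  ring

theorem pi_Gd {M N k : ℕ} (c : ℂ) (hc : c ^ 2 = -1) (hN : 2 * M ≤ N) (hk : k < M) : pi M (Et N * (Gd c N k)⁻¹) = pi M (qp (X ^ 8) (X ^ 8) M)⁻¹ := by
  have h2 : (X : A) ∣ X ^ 2 := dvd_pow_self _ (by simp)
  have h4 : (X : A) ∣ (X ^ 2) ^ 2 := h2.trans (dvd_pow_self _ (by simp))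
  apply pi_quot (by rw [cc_Gd]; simp) (by rw [cc_qp (by simp)]; simp)
  unfold Et Gd
  have e := four_id (X ^ 2 : A) M
  rw [show (((X : A) ^ 2) ^ 2) ^ 2 = X ^ 8 by ring] at e
  have e' := congrArg (pi M) e
  have f := qp_sq (C c * X) (X ^ 2) M
  have f2 : (C c * X) ^ 2 = -(X ^ 2 : A) := by rw [mul_pow, ← map_pow, hc]; simp
  rw [f2, ← neg_mul] at f
  have f' := congrArg (pi M) f
  simp only [map_mul] at e' f' ⊢
  rw [st h2 (show M ≤ 2 * M by omega), st h4 (show M ≤ 2 * M by omega)] at e'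
  rw [st h2 (show M ≤ N by omega), st h4 (show M ≤ N by omega), st h4 (show M ≤ N - 1 - k by omega), st h4 (show M ≤ N + k by omega),
    st h2 (show M ≤ N + k + 1 by omega), st h2 (show M ≤ N - k by omega), f']
  linear_combination (pi M (qp (-X ^ 2) ((X ^ 2) ^ 2) M)) * e'

theorem gsum (k : ℕ) : ∃ (e : ℂ) (b : ℕ), (X : A) ^ (4 * (k * (k + 1) / 2) + k ^ 2) * (C (2⁻¹ * Complex.I⁻¹ ^ k) * (1 - C Complex.I * X ^ (2 * k + 1)) + C (2⁻¹ * (-Complex.I)⁻¹ ^ k) * (1 - C (-Complex.I) * X ^ (2 * k + 1))) = C e * X ^ (8 * b) := by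
  rcases Nat.even_or_odd' k with ⟨j, rfl | rfl⟩
  · obtain ⟨b, hb⟩ : ∃ b, 2 * b = j * (3 * j + 1) := by
      rcases Nat.even_or_odd' j with ⟨i, rfl | rfl⟩
      · exact ⟨i * (3 * (2 * i) + 1), by ring⟩
      · exact ⟨(2 * i + 1) * (3 * i + 2), by ring⟩
    refine ⟨(-1) ^ j, b, ?_⟩
    have h1 : (2 * j) * (2 * j + 1) / 2 = j * (2 * j + 1) := by
      rw [mul_assoc, Nat.mul_div_cancel_left _ (by norm_num)]
    have h2 : 4 * (j * (2 * j + 1)) + (2 * j) ^ 2 = 8 * b := by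
      have : 8 * b = 4 * (2 * b) := by ring
      rw [this, hb]; ring
    rw [h1, h2, pow_mul Complex.I⁻¹, pow_mul (-Complex.I)⁻¹]
    have h3 : Complex.I⁻¹ ^ 2 = -1 := by simp
    have h4 : (-Complex.I)⁻¹ ^ 2 = -1 := by simp
    rw [h3, h4]
    have h5 : (C (2⁻¹ * (-1 : ℂ) ^ j) : A) + C (2⁻¹ * (-1 : ℂ) ^ j) = C ((-1) ^ j) := by
      rw [← map_add]; congr 1; ring
    rw [map_neg]
    linear_combination (X : A) ^ (8 * b) * h5
  · obtain ⟨b, hb⟩ : ∃ b, 2 * b = (j + 1) * (3 * j + 2) := by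
      rcases Nat.even_or_odd' j with ⟨i, rfl | rfl⟩
      · exact ⟨(2 * i + 1) * (3 * i + 1), by ring⟩
      · exact ⟨(i + 1) * (3 * (2 * i + 1) + 2), by ring⟩
    refine ⟨-(-1) ^ j, b, ?_⟩
    have h1 : (2 * j + 1) * (2 * j + 1 + 1) / 2 = (2 * j + 1) * (j + 1) := by
      rw [show (2 * j + 1) * (2 * j + 1 + 1) = 2 * ((2 * j + 1) * (j + 1)) by ring, Nat.mul_div_cancel_left _ (by norm_num)]
    have h2 : 8 * b = 4 * ((2 * j + 1) * (j + 1)) + (2 * j + 1) ^ 2 + (2 * (2 * j + 1) + 1) := by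
      have : 8 * b = 4 * (2 * b) := by ring
      rw [this, hb]; ring
    rw [h1, h2, pow_add X _ (2 * (2 * j + 1) + 1), pow_succ Complex.I⁻¹ (2 * j), pow_mul Complex.I⁻¹, pow_succ (-Complex.I)⁻¹ (2 * j), pow_mul (-Complex.I)⁻¹]
    have h3 : Complex.I⁻¹ ^ 2 = -1 := by simp
    have h4 : (-Complex.I)⁻¹ ^ 2 = -1 := by simp
    rw [h3, h4]
    have h5 : (C (2⁻¹ * ((-1 : ℂ) ^ j * Complex.I⁻¹)) : A) + C (2⁻¹ * ((-1 : ℂ) ^ j * (-Complex.I)⁻¹)) = 0 := by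
      rw [← map_add, ← map_zero C]; congr 1; rw [inv_neg]; ring
    have h6 : (C (2⁻¹ * ((-1 : ℂ) ^ j * Complex.I⁻¹)) * C Complex.I : A) + C (2⁻¹ * ((-1 : ℂ) ^ j * (-Complex.I)⁻¹)) * C (-Complex.I) = C ((-1) ^ j) := by
      rw [← map_mul, ← map_mul, ← map_add]; congr 1; rw [inv_neg]; simp; ring_nf; try simp
    rw [map_neg C ((-1) ^ j), ← h6]
    generalize C (2⁻¹ * ((-1 : ℂ) ^ j * Complex.I⁻¹)) = a at *
    generalize C (2⁻¹ * ((-1 : ℂ) ^ j * (-Complex.I)⁻¹)) = b at *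
    linear_combination (X : A) ^ (4 * ((2 * j + 1) * (j + 1)) + (2 * j + 1) ^ 2) * h5

theorem vanish_t (ζ : ℂ) (hζ : ζ ^ 4 = -1) {M N : ℕ} (hN : 2 * M ≤ N) (hM : 1 ≤ M) :
    ∃ g : A, pi M (Et N * ∑ s ∈ range 8, (XQ (C (ζ ^ s)) (C (ζ⁻¹ ^ s)) N)⁻¹) =
      pi M (ex 2 (by simp) (ip X M * ∑ k ∈ range M, (-1) ^ k * X ^ (k * (k + 1) / 2 + (k + 1) ^ 2) * (1 - X ^ (k + 1)) * Lam (8 * (k + 1))) + ex 8 (by simp) g) := by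
  choose e b heb using gsum
  refine ⟨∑ k ∈ range M, (qp X X M)⁻¹ * ((-1) ^ k * (C (e k) * X ^ (b k))) * Lam (2 * k + 1), ?_⟩
  rw [X1 ζ hζ N (by omega), mul_add, map_add, map_add]
  obtain ⟨c, hc⟩ := Nat.exists_eq_add_of_le (show M ≤ N by omega)
  congr 1
  · rw [mul_sum, mul_sum]
    conv_lhs => rw [show range N = range (M + c) by rw [← hc], sum_range_add]
    rw [map_add, map_sum _ _ (range c), sum_eq_zero (s := range c), add_zero, map_sum, map_sum, map_sum]
    · apply sum_congr rfl
      intro k hk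
      rw [mem_range] at hk
      have h := pi_K1d hN hk
      have h3 : Et N * (Kt N k * Lam (16 * (k + 1))) = (Et N * (K1d N k)⁻¹) * (((-1) ^ k * (X ^ 2) ^ (k * (k + 1) / 2 + (k + 1) ^ 2) * (1 - (X ^ 2) ^ (k + 1))) * Lam (16 * (k + 1))) := by
        unfold Kt; ring
      rw [h3, map_mul (pi M), h, ← map_mul (pi M)]
      congr 1
      rw [map_mul (ex _ _), map_mul (ex _ _), ex_Lam _ _ _ (by omega), show 2 * (8 * (k + 1)) = 16 * (k + 1) by ring]
      simp only [map_mul, map_neg, map_pow, map_one, map_sub, ex_X]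
    · intro k _
      unfold Kt
      simp only [map_mul]
      have hx : M ≤ 2 * ((M + k) * (M + k + 1) / 2 + (M + k + 1) ^ 2) := by
        have : M + k + 1 ≤ (M + k + 1) ^ 2 := Nat.le_self_pow (by simp) _
        omega
      rw [← pow_mul, pi_X hx]
      ring
  · rw [mul_sum]
    conv_lhs => rw [show range N = range (M + c) by rw [← hc], sum_range_add]
    rw [map_add, map_sum _ _ (range c), sum_eq_zero (s := range c), add_zero, map_sum, map_sum, map_sum]
    · apply sum_congr rfl
      intro k hk
      rw [mem_range] at hk
      have h := pi_Gd Complex.I (by simp) hN hk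
      have h' := pi_Gd (-Complex.I) (by simp) hN hk
      have h3 : Et N * ((Gt Complex.I N k + Gt (-Complex.I) N k) * Lam (8 * (2 * k + 1))) =
        ((Et N * (Gd Complex.I N k)⁻¹) * (C (2⁻¹ * Complex.I⁻¹ ^ k) * (1 - C Complex.I * X ^ (2 * k + 1))) + (Et N * (Gd (-Complex.I) N k)⁻¹) * (C (2⁻¹ * (-Complex.I)⁻¹ ^ k) * (1 - C (-Complex.I) * X ^ (2 * k + 1)))) * ((-1) ^ k * X ^ (4 * (k * (k + 1) / 2) + k ^ 2) * Lam (8 * (2 * k + 1))) := by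
        unfold Gt; ring
      rw [h3, map_mul (pi M), map_add (pi M), map_mul (pi M), h, map_mul (pi M) (_ * _) (_ * _), h', ← map_mul, ← map_mul, ← map_add, ← map_mul]
      congr 1
      rw [map_mul (ex _ _), map_mul (ex _ _), ex_Lam _ _ _ (by omega), ex_inv _ _ (by rw [cc_qp (by simp)]; simp), map_qp]
      simp only [map_mul, map_neg, map_pow, map_one, map_sub, ex_X, ex_C]
      have hk := heb k
      rw [pow_mul (X : A) 8] at hk
      simp only [map_mul, map_neg, map_pow, map_one, map_sub] at hk ⊢
      rw [← hk]
      ring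
    · intro k _
      unfold Gt
      have hz : pi M (((X ^ 2) ^ 2) ^ ((M + k) * (M + k + 1) / 2)) = 0 := by
        rw [← pow_mul, ← pow_mul, pi_X]
        have : M + k ≤ (M + k) * (M + k + 1) / 2 := by
          rw [Nat.le_div_iff_mul_le (by norm_num)]; nlinarith
        omega
      simp only [map_mul, map_add, hz]
      ring

/-- crank-type product in `q` -/
noncomputable def CP (z w : A) (N : ℕ) : A := qp X X N * (qp (-X) (X ^ 2) N * qp (-X) (X ^ 2) N) *
  (qp (z * X) X N * qp (w * X) X N * (qp (-z ^ 2 * X) (X ^ 2) N * qp (-w ^ 2 * X) (X ^ 2) N))⁻¹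

theorem vanish (ζ : ℂ) (hζ : ζ ^ 4 = -1) {n N L : ℕ} (hn : ¬ 4 ∣ n) (hL : 4 * n + 4 ≤ L) (hN : 4 * n + 4 ≤ N) :
    coeff n (∑ s ∈ range 8, Rs (C (ζ ^ s)) (C (ζ⁻¹ ^ s)) (L + 1)) = coeff n (∑ s ∈ range 8, CP (C (ζ ^ s)) (C (ζ⁻¹ ^ s)) N) := by
  have hn0 : n ≠ 0 := by rintro rfl; simp at hn
  have h1 := pi_coeff (Rsum ζ hζ (M := 2 * n + 1) (L := L) (by omega)) (show n < 2 * n + 1 by omega)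
  obtain ⟨g, hg⟩ := vanish_t ζ hζ (M := 2 * n + 1) (N := N) (by omega) (by omega)
  have h2 := pi_coeff hg (show 2 * n < 2 * n + 1 by omega)
  rw [map_add, ex_coeff, ex_coeff0 8 _ _ _ (by omega), add_zero] at h2
  rw [h1, map_add, ← h2]
  have h8 : coeff n (8 : A) = 0 := by
    have : (8 : A) = C 8 := by rw [map_ofNat]
    rw [this, coeff_C, if_neg hn0]
  rw [h8, zero_add, ← ex_coeff 2 (by simp) (∑ s ∈ range 8, CP (C (ζ ^ s)) (C (ζ⁻¹ ^ s)) N)]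
  congr 1
  rw [mul_sum, map_sum]
  apply sum_congr rfl
  intro s _
  unfold CP Et XQ
  rw [map_mul, ex_inv]
  · simp only [map_mul, map_qp, map_neg, map_pow, ex_X, ex_C]
  · simp only [map_mul]
    rw [cc_qp (by simp), cc_qp (by simp), cc_qp (by simp), cc_qp (by simp)]; simp

end RC

set_option linter.all false
namespace RC
open PowerSeries Finset

section
variable {R : Type*} [CommRing R]

def gb (p : R) : ℕ → ℕ → R
  | _, 0 => 1
  | 0, _ + 1 => 0
  | n + 1, k + 1 => gb p n (k + 1) + p ^ (n - k) * gb p n k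

theorem gb_zero (p : R) (n : ℕ) : gb p n 0 = 1 := by cases n <;> rfl

theorem gb_gt (p : R) (n : ℕ) : ∀ k, n < k → gb p n k = 0 := by
  induction n with
  | zero => intro k hk; obtain ⟨k, rfl⟩ := Nat.exists_eq_succ_of_ne_zero (by omega : k ≠ 0); rfl
  | succ n ih =>
    intro k hk
    obtain ⟨k, rfl⟩ := Nat.exists_eq_succ_of_ne_zero (by omega : k ≠ 0)
    show gb p n (k + 1) + p ^ (n - k) * gb p n k = 0
    rw [ih _ (by omega), ih _ (by omega)]; ring

theorem gb_fac (p : R) (n : ℕ) : ∀ k, k ≤ n → gb p n k * (qp p p k * qp p p (n - k)) = qp p p n := by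
  induction n with
  | zero => intro k hk; obtain rfl : k = 0 := by omega
            simp [gb, qp]
  | succ n ih =>
    intro k hk
    rcases k with _ | k
    · rw [gb_zero]; simp [qp]
    show (gb p n (k + 1) + p ^ (n - k) * gb p n k) * _ = _
    rw [show n + 1 - (k + 1) = n - k by omega]
    have h1 := ih k (by omega)
    rcases Nat.lt_or_ge k n with h | h
    · have h2 := ih (k + 1) (by omega)
      obtain ⟨c, rfl⟩ := Nat.exists_eq_add_of_lt h
      have e1 : k + c + 1 - k = c + 1 := by omega
      have e2 : k + c + 1 - (k + 1) = c := by omega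
      rw [e1] at h1 ⊢
      rw [e2] at h2
      rw [qp_succ _ _ (k + c + 1)]
      simp only [qp_succ _ _ k, qp_succ _ _ c] at h1 h2 ⊢
      linear_combination (1 - p * p ^ c) * h2 + p ^ (c + 1) * (1 - p * p ^ k) * h1
    · obtain rfl : k = n := by omega
      rw [gb_gt p k (k + 1) (by omega)]
      rw [qp_succ]
      simp at h1 ⊢
      linear_combination (1 - p * p ^ k) * h1

theorem gb_sum (p x y : R) (n : ℕ) :
    ∏ k ∈ range n, (y + x * p ^ k) = ∑ k ∈ range (n + 1), gb p n k * p ^ (k * (k - 1) / 2) * x ^ k * y ^ (n - k) := by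
  induction n with
  | zero => simp [gb_zero]
  | succ n ih =>
    rw [prod_range_succ, ih, sum_range_succ' _ (n + 1)]
    have e : ∀ k ∈ range (n + 1), gb p (n + 1) (k + 1) * p ^ ((k + 1) * (k + 1 - 1) / 2) * x ^ (k + 1) * y ^ (n + 1 - (k + 1)) =
      gb p n (k + 1) * p ^ ((k + 1) * (k + 1 - 1) / 2) * x ^ (k + 1) * y ^ (n - k) + (gb p n k * p ^ (k * (k - 1) / 2) * x ^ k * y ^ (n - k)) * (x * p ^ n) := by
      intro k hk
      rw [mem_range] at hk
      have h1 : (k + 1) * (k + 1 - 1) / 2 = k * (k - 1) / 2 + k := by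
        rcases k with _ | k
        · rfl
        · have : (k + 1 + 1) * (k + 1 + 1 - 1) = (k + 1) * (k + 1 - 1) + (k + 1) * 2 := by simp; ring
          rw [this, Nat.add_mul_div_right _ _ (by norm_num)]
      have h2 : n + 1 - (k + 1) = n - k := by omega
      rw [h1, h2]
      show (gb p n (k + 1) + p ^ (n - k) * gb p n k) * _ * _ * _ = _
      have h3 : p ^ n = p ^ (n - k) * p ^ k := by rw [← pow_add]; congr 1; omega
      rw [h3]
      ring
    rw [sum_congr rfl e, sum_add_distrib, ← sum_mul, mul_add]
    have e2 : (∑ k ∈ range (n + 1), gb p n k * p ^ (k * (k - 1) / 2) * x ^ k * y ^ (n - k)) * y =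
       ∑ k ∈ range (n + 1), gb p n (k + 1) * p ^ ((k + 1) * (k + 1 - 1) / 2) * x ^ (k + 1) * y ^ (n - k) + gb p (n + 1) 0 * p ^ (0 * (0 - 1) / 2) * x ^ 0 * y ^ (n + 1 - 0) := by
      conv_rhs => rw [sum_range_succ _ n, gb_gt p n (n + 1) (by omega)]
      rw [sum_range_succ', add_mul, sum_mul]
      simp only [zero_mul, add_zero, gb_zero]
      congr 1
      · apply sum_congr rfl
        intro k hk
        rw [mem_range] at hk
        have : n - k = n - (k + 1) + 1 := by omega
        rw [this]; ring
      · simp; ring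
    rw [e2]; ring

end

theorem tri_add (N j : ℕ) : (N + j) * (N + j - 1) / 2 = N * (N - 1) / 2 + N * j + j * (j - 1) / 2 := by
  have h : ∀ m : ℕ, 2 * (m * (m - 1) / 2) = m * (m - 1) := fun m => Nat.mul_div_cancel' (Nat.even_mul_pred_self m).two_dvd
  have h1 := h (N + j); have h2 := h N; have h3 := h j
  rcases N with _ | N
  · simp
  rcases j with _ | j
  · simp
  simp only [Nat.add_sub_cancel] at *
  have e : N + 1 + (j + 1) - 1 = N + 1 + j := by omega
  rw [e] at h1 ⊢
  have e3 : (N+1+(j+1))*(N+1+j) = (N+1)*N + 2*((N+1)*(j+1)) + (j+1)*j := by ring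
  omega

/-- finite Jacobi triple product -/
theorem jtp_fin {R : Type*} [CommRing R] [IsDomain R] (p a b : R) (hp : p ≠ 0) (ha : a ≠ 0) (hab : a * b = p) (N : ℕ) :
    ∏ k ∈ range N, ((1 + a * p ^ k) * (1 + b * p ^ k)) = gb p (2 * N) N +
      ∑ i ∈ range N, (gb p (2 * N) (N + (i + 1)) * (p ^ ((i + 1) * i / 2) * a ^ (i + 1)) + gb p (2 * N) (N - (i + 1)) * (p ^ ((i + 1) * i / 2) * b ^ (i + 1))) := by
  have h := gb_sum p a (p ^ N) (2 * N)
  have hne : p ^ (N * (N - 1) / 2 + N * N) * a ^ N ≠ 0 := mul_ne_zero (pow_ne_zero _ hp) (pow_ne_zero _ ha)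
  apply mul_left_cancel₀ hne
  have hL : p ^ (N * (N - 1) / 2 + N * N) * a ^ N * ∏ k ∈ range N, ((1 + a * p ^ k) * (1 + b * p ^ k)) = ∏ k ∈ range (2 * N), (p ^ N + a * p ^ k) := by
    rw [two_mul, prod_range_add, prod_mul_distrib]
    have e1 : ∏ k ∈ range N, (p ^ N + a * p ^ (N + k)) = p ^ (N * N) * ∏ k ∈ range N, (1 + a * p ^ k) := by
      have : p ^ (N * N) = ∏ k ∈ range N, p ^ N := by rw [prod_const, card_range, ← pow_mul]
      rw [this, ← prod_mul_distrib]
      apply prod_congr rfl; intro k _; ring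
    have e2 : ∏ k ∈ range N, (p ^ N + a * p ^ k) = p ^ (N * (N - 1) / 2) * (a ^ N * ∏ k ∈ range N, (1 + b * p ^ k)) := by
      have h1 : a ^ N = ∏ k ∈ range N, a := by rw [prod_const, card_range]
      have h2 : p ^ (N * (N - 1) / 2) = ∏ k ∈ range N, p ^ k := by
        rw [prod_pow_eq_pow_sum, sum_range_id]
      rw [h1, h2, ← prod_range_reflect (fun k => 1 + b * p ^ k), ← prod_mul_distrib, ← prod_mul_distrib]
      apply prod_congr rfl
      intro k hk
      rw [mem_range] at hk
      have : p ^ N = p ^ k * p ^ (N - 1 - k) * p := by rw [← pow_add, ← pow_succ]; congr 1; omega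
      rw [this]
      linear_combination (- p ^ k * p ^ (N - 1 - k)) * hab
    rw [e1, e2, pow_add]; ring
  rw [hL, h, show 2 * N + 1 = N + (1 + N) by ring, sum_range_add, sum_range_add, mul_add, mul_sum]
  simp only [mul_add, sum_add_distrib]
  rw [← sum_range_reflect]
  have e0 : ∑ x ∈ range 1, gb p (2 * N) (N + x) * p ^ ((N + x) * (N + x - 1) / 2) * a ^ (N + x) * (p ^ N) ^ (2 * N - (N + x)) = p ^ (N * (N - 1) / 2 + N * N) * a ^ N * gb p (2 * N) N := by
    simp
    rw [show 2 * N - N = N by omega, ← pow_mul, pow_add]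
    ring
  have e1 : ∑ x ∈ range N, gb p (2 * N) (N + (1 + x)) * p ^ ((N + (1 + x)) * (N + (1 + x) - 1) / 2) * a ^ (N + (1 + x)) * (p ^ N) ^ (2 * N - (N + (1 + x))) =
     ∑ i ∈ range N, p ^ (N * (N - 1) / 2 + N * N) * a ^ N * (gb p (2 * N) (N + (i + 1)) * (p ^ ((i + 1) * i / 2) * a ^ (i + 1))) := by
    apply sum_congr rfl
    intro i hi
    rw [mem_range] at hi
    rw [add_comm 1 i, tri_add]
    simp only [Nat.add_sub_cancel]
    obtain ⟨c, rfl⟩ := Nat.exists_eq_add_of_lt hi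
    have e : 2 * (i + c + 1) - (i + c + 1 + (i + 1)) = c := by omega
    rw [e, ← pow_mul]
    have : p ^ ((i + c + 1) * (i + c + 1)) = p ^ ((i + c + 1) * (i + 1)) * p ^ ((i + c + 1) * c) := by rw [← pow_add]; congr 1; ring
    simp only [pow_add] at this ⊢
    rw [this]; ring
  have e2 : ∑ x ∈ range N, gb p (2 * N) (N - 1 - x) * p ^ ((N - 1 - x) * (N - 1 - x - 1) / 2) * a ^ (N - 1 - x) * (p ^ N) ^ (2 * N - (N - 1 - x)) =
     ∑ i ∈ range N, p ^ (N * (N - 1) / 2 + N * N) * a ^ N * (gb p (2 * N) (N - (i + 1)) * (p ^ ((i + 1) * i / 2) * b ^ (i + 1))) := by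
    apply sum_congr rfl
    intro i hi
    rw [mem_range] at hi
    obtain ⟨c, rfl⟩ := Nat.exists_eq_add_of_lt hi
    have t0 : i + c + 1 - (i + 1) = c := by omega
    have t1 : i + c + 1 - 1 - i = c := by omega
    rw [t0, t1]
    have e : 2 * (i + c + 1) - c = (i + c + 1) + (i + 1) := by omega
    have t3 := tri_add c (i + 1)
    simp only [Nat.add_sub_cancel] at t3
    rw [show c + (i + 1) = i + c + 1 by ring] at t3
    rw [e, ← pow_mul, t3]
    have hb : a ^ (i + 1) * b ^ (i + 1) = p ^ (i + 1) := by rw [← mul_pow, hab]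
    have hx : p ^ ((i + c + 1) * (i + c + 1 + (i + 1))) = p ^ ((i + c + 1) * (i + c + 1)) * p ^ (c * (i + 1)) * p ^ ((i + 1) * i / 2 * 2) * p ^ (i + 1) := by
      rw [← pow_add, ← pow_add, ← pow_add]
      congr 1
      have : (i + 1) * i / 2 * 2 = (i + 1) * i := Nat.div_mul_cancel (by have := Nat.even_mul_succ_self i; rw [mul_comm]; exact this.two_dvd)
      rw [this]; ring
    rw [hx, ← hb]
    have ha2 : a ^ (i + c + 1) = a ^ c * a ^ (i + 1) := by rw [← pow_add]; congr 1; ring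
    rw [ha2, pow_add, pow_add, pow_add, pow_mul p ((i + 1) * i / 2) 2]
    ring
  rw [e0, e1, e2]
  ring

/-- truncated triple product -/
theorem jtp {M N : ℕ} (p a b : A) (hp : X ∣ p) (hp0 : p ≠ 0) (ha : a ≠ 0) (hab : a * b = p) (hN : 2 * M + 4 ≤ N) :
    pi M (qp p p N * (qp (-a) p N * qp (-b) p N)) = pi M (1 + ∑ i ∈ range (M + 1), p ^ ((i + 1) * i / 2) * (a ^ (i + 1) + b ^ (i + 1))) := by
  have h := jtp_fin p a b hp0 ha hab N
  have e : qp (-a) p N * qp (-b) p N = ∏ k ∈ range N, ((1 + a * p ^ k) * (1 + b * p ^ k)) := by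
    unfold qp; rw [← prod_mul_distrib]; apply prod_congr rfl; intro k _; ring
  have ccp : constantCoeff p = 0 := X_dvd_iff.1 hp
  have hu : pi M (qp p p M) * pi M (qp p p M)⁻¹ = 1 := by
    rw [← map_mul, inv_cancel' (by rw [cc_qp ccp]; simp), map_one]
  have hg : ∀ k, k ≤ 2 * N → M ≤ k → M ≤ 2 * N - k → pi M (qp p p N) * pi M (gb p (2 * N) k) = 1 := by
    intro k h1 h2 h3
    have := congrArg (pi M) (gb_fac p (2 * N) k h1)
    rw [map_mul, map_mul, st hp h2, st hp h3, st hp (show M ≤ 2 * N by omega)] at this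
    rw [st hp (show M ≤ N by omega)]
    linear_combination pi M (qp p p M)⁻¹ * this + (1 - pi M (gb p (2 * N) k) * pi M (qp p p M)) * hu
  rw [e, h, map_mul, map_add, mul_add, hg N (by omega) (by omega) (by omega), map_add, map_one]
  congr 1
  obtain ⟨c, hc⟩ := Nat.exists_eq_add_of_le (show M + 1 ≤ N by omega)
  conv_lhs => rw [show range N = range (M + 1 + c) by rw [← hc], sum_range_add]
  rw [map_add, map_sum _ _ (range c), sum_eq_zero (s := range c), add_zero, map_sum, map_sum, mul_sum]
  · apply sum_congr rfl
    intro i hi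
    rw [mem_range] at hi
    have h1 := hg (N + (i + 1)) (by omega) (by omega) (by omega)
    have h2 := hg (N - (i + 1)) (by omega) (by omega) (by omega)
    simp only [map_add, map_mul]
    linear_combination pi M (p ^ ((i + 1) * i / 2)) * (pi M (a ^ (i + 1)) * h1 + pi M (b ^ (i + 1)) * h2)
  · intro i _
    have hz : pi M (p ^ ((M + 1 + i + 1) * (M + 1 + i) / 2)) = 0 := by
      apply pi_zero.2
      have : M ≤ (M + 1 + i + 1) * (M + 1 + i) / 2 := by
        rw [Nat.le_div_iff_mul_le (by norm_num)]; nlinarith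
      exact (pow_dvd_pow_of_dvd hp M).trans (pow_dvd_pow p this)
    simp only [map_add, map_mul, hz]
    ring

end RC

set_option linter.all false
namespace RC
open PowerSeries Finset

noncomputable def chi (z w : ℂ) : ℕ → ℂ
  | 0 => 1
  | i + 1 => z ^ (i + 1) + w ^ (i + 1) - chi z w i

theorem chi_mul {z w : ℂ} (h : z * w = 1) (i : ℕ) : (1 + w) * chi z w i = z ^ i + w ^ (i + 1) := by
  induction i with
  | zero => simp [chi]
  | succ i ih =>
    show (1 + w) * (z ^ (i + 1) + w ^ (i + 1) - chi z w i) = _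
    have : z ^ (i + 1) * w = z ^ i := by rw [pow_succ, mul_assoc, h, mul_one]
    rw [pow_succ w (i + 1)]
    linear_combination this - ih

theorem chi_one (i : ℕ) : chi 1 1 i = 1 := by
  induction i with
  | zero => rfl
  | succ i ih => show (1:ℂ) ^ (i + 1) + 1 ^ (i + 1) - chi 1 1 i = 1; rw [ih]; norm_num

theorem J1 {M N : ℕ} {z w : ℂ} (h : z * w = 1) (hw : 1 + w ≠ 0) (hN : 2 * M + 4 ≤ N) :
    pi M (qp X X N * (qp (-(C z * X)) X N * qp (-(C w * X)) X N)) =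
      pi M (∑ i ∈ range (M + 1), X ^ ((i + 1) * i / 2) * C (chi z w i)) := by
  have hz : z ≠ 0 := left_ne_zero_of_mul_eq_one h
  have hab : C z * X * C w = (X : A) := by
    rw [mul_right_comm, ← map_mul, h]; simp
  have hj := jtp (M := M) (N := N) (X : A) (C z * X) (C w) dvd_rfl X_ne_zero
    (mul_ne_zero (by simpa using hz) X_ne_zero) hab hN
  have e1 : pi M (qp (-C w) X N) = pi M (C (1 + w)) * pi M (qp (-(C w * X)) X N) := by
    obtain ⟨K, rfl⟩ := Nat.exists_eq_add_of_le' (show 1 ≤ N by omega)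
    rw [qp_succ', map_mul, st2 (n' := K + 1) dvd_rfl (show M ≤ K by omega) (by omega)]
    simp
  have e2 : pi M (1 + ∑ i ∈ range (M + 1), X ^ ((i + 1) * i / 2) * ((C z * X) ^ (i + 1) + (C w) ^ (i + 1))) =
      pi M (C (1 + w)) * pi M (∑ i ∈ range (M + 1), X ^ ((i + 1) * i / 2) * C (chi z w i)) := by
    rw [← map_mul, mul_sum]
    have t1 : ∀ i ∈ range (M + 1), C (1 + w) * (X ^ ((i + 1) * i / 2) * C (chi z w i)) =
        (X : A) ^ ((i + 1) * i / 2) * C z ^ i + X ^ ((i + 1) * i / 2) * C w ^ (i + 1) := by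
      intro i _
      have := congrArg (C (R := ℂ)) (chi_mul h i)
      simp only [map_mul, map_add, map_pow] at this ⊢
      linear_combination (X : A) ^ ((i + 1) * i / 2) * this
    have t2 : ∀ i ∈ range (M + 1), (X : A) ^ ((i + 1) * i / 2) * ((C z * X) ^ (i + 1) + (C w) ^ (i + 1)) =
        (X : A) ^ ((i + 1 + 1) * (i + 1) / 2) * C z ^ (i + 1) + X ^ ((i + 1) * i / 2) * C w ^ (i + 1) := by
      intro i _
      have : (i + 1 + 1) * (i + 1) / 2 = (i + 1) * i / 2 + (i + 1) := by
        rw [show (i + 1 + 1) * (i + 1) = (i + 1) * i + (i + 1) * 2 by ring, Nat.add_mul_div_right _ _ (by norm_num)]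
      rw [this]; ring
    rw [sum_congr rfl t1, sum_congr rfl t2, sum_add_distrib, sum_add_distrib]
    have t3 := sum_range_succ' (fun i => (X : A) ^ ((i + 1) * i / 2) * C z ^ i) (M + 1)
    rw [sum_range_succ] at t3
    simp only [zero_add, mul_zero, Nat.zero_div, pow_zero, one_mul] at t3
    have t4 : pi M ((X : A) ^ ((M + 1 + 1) * (M + 1) / 2)) = 0 := by
      apply pi_X
      rw [Nat.le_div_iff_mul_le (by norm_num)]; nlinarith
    have t5 := congrArg (pi M) t3
    simp only [map_add, map_mul, t4, map_one] at t5 ⊢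
    linear_combination -t5
  rw [map_mul, map_mul, e1, e2] at hj
  have hu : pi M (C (1 + w)) * pi M (C (1 + w)⁻¹) = 1 := by
    rw [← map_mul, ← map_mul, mul_inv_cancel₀ hw, map_one, map_one]
  rw [map_mul, map_mul]
  rw [show (-(C z * X : A)) = -(C z * X) from rfl] at hj
  linear_combination pi M (C (1 + w)⁻¹) * hj + (-(pi M (qp X X N) * (pi M (qp (-(C z * X)) X N) * pi M (qp (-(C w * X)) X N))) + pi M (∑ i ∈ range (M + 1), X ^ ((i + 1) * i / 2) * C (chi z w i))) * hu

noncomputable def sg (a : ℕ) : ℂ := if a % 4 = 0 ∨ a % 4 = 3 then 1 else -1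

noncomputable def T3 (M : ℕ) : A := 1 + 2 * ∑ i ∈ range (M + 1), X ^ ((i + 1) ^ 2)
noncomputable def T4 (M : ℕ) : A := 1 + 2 * ∑ i ∈ range (M + 1), (-1) ^ (i + 1) * X ^ (2 * (i + 1) ^ 2)
noncomputable def Psi (M : ℕ) : A := ∑ i ∈ range (M + 1), X ^ ((i + 1) * i / 2)
noncomputable def Es (M : ℕ) : A := ∑ i ∈ range (M + 1), X ^ ((i + 1) * i / 2) * C (sg ((i + 1) * i / 2))

theorem tri2 (i : ℕ) : 2 * ((i + 1) * i / 2) = (i + 1) * i :=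
  Nat.mul_div_cancel' (by have := Nat.even_mul_succ_self i; rw [mul_comm]; exact this.two_dvd)

theorem J2 {M N : ℕ} (hN : 2 * M + 4 ≤ N) :
    pi M (qp (X ^ 2) (X ^ 2) N * (qp (-X) (X ^ 2) N * qp (-X) (X ^ 2) N)) = pi M (T3 M) := by
  rw [jtp (X ^ 2 : A) X X (dvd_pow_self _ (by simp)) (pow_ne_zero _ X_ne_zero) X_ne_zero (by ring) hN]
  unfold T3
  congr 2
  rw [mul_sum]
  apply sum_congr rfl
  intro i _
  rw [← pow_mul, tri2]
  ring

theorem J3 {M N : ℕ} (hN : 2 * M + 4 ≤ N) :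
    pi M (qp (X ^ 4) (X ^ 4) N * (qp (X ^ 2) (X ^ 4) N * qp (X ^ 2) (X ^ 4) N)) = pi M (T4 M) := by
  have := jtp (M := M) (N := N) (X ^ 4 : A) (-X ^ 2) (-X ^ 2) (dvd_pow_self _ (by simp)) (pow_ne_zero _ X_ne_zero) (neg_ne_zero.2 (pow_ne_zero _ X_ne_zero)) (by ring) hN
  rw [neg_neg] at this
  rw [this]
  unfold T4
  congr 2
  rw [mul_sum]
  apply sum_congr rfl
  intro i _
  have e : (X : A) ^ (2 * (i + 1) ^ 2) = (X ^ 4) ^ ((i + 1) * i / 2) * (X ^ 2) ^ (i + 1) := by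
    rw [← pow_mul, ← pow_mul, ← pow_add]; congr 1
    have := tri2 i; nlinarith
  rw [e, neg_pow (X ^ 2 : A)]
  ring

theorem J1one {M N : ℕ} (hN : 2 * M + 4 ≤ N) :
    pi M (qp X X N * (qp (-X) X N * qp (-X) X N)) = pi M (Psi M) := by
  have := J1 (M := M) (N := N) (z := 1) (w := 1) (by norm_num) (by norm_num) hN
  simp only [map_one, one_mul, chi_one, mul_one] at this
  exact this

theorem psum (ζ : ℂ) (hζ : ζ ^ 4 = -1) (m : ℕ) : (ζ ^ 1) ^ m + (ζ ^ 3) ^ m + (ζ ^ 5) ^ m + (ζ ^ 7) ^ m =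
    if m % 8 = 0 then 4 else if m % 8 = 4 then -4 else 0 := by
  have h8 : ζ ^ 8 = 1 := by linear_combination (ζ ^ 4 - 1) * hζ
  obtain ⟨j, r, hr, rfl⟩ : ∃ j r, r < 8 ∧ m = 8 * j + r := ⟨m / 8, m % 8, Nat.mod_lt _ (by norm_num), (Nat.div_add_mod m 8).symm⟩
  have e : ∀ a, (ζ ^ a) ^ (8 * j + r) = ζ ^ (a * r) := by
    intro a
    rw [← pow_mul, mul_add, pow_add, show a * (8 * j) = 8 * (a * j) by ring, pow_mul, h8, one_pow, one_mul]
  rw [e, e, e, e, show (8 * j + r) % 8 = r by omega]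
  have p : ∀ a b, ζ ^ (4 * a + b) = (-1) ^ a * ζ ^ b := by intro a b; rw [pow_add, pow_mul, hζ]
  interval_cases r
  · norm_num
  · rw [p 0 1, p 0 3, p 1 1, p 1 3]; norm_num
  · rw [p 0 2, p 1 2, p 2 2, p 3 2]; norm_num
  · rw [p 0 3, p 2 1, p 3 3, p 5 1]; norm_num
  · rw [p 1 0, p 3 0, p 5 0, p 7 0]; norm_num
  · rw [p 1 1, p 3 3, p 6 1, p 8 3]; norm_num
  · rw [p 1 2, p 4 2, p 7 2, p 10 2]; norm_num
  · rw [p 1 3, p 5 1, p 8 3, p 12 1]; norm_num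

theorem sgT (j r : ℕ) : sg ((8 * j + r + 1) * (8 * j + r) / 2) = sg ((r + 1) * r / 2) := by
  have h1 := tri2 (8 * j + r)
  have h2 := tri2 r
  have : (8 * j + r + 1) * (8 * j + r) / 2 = (r + 1) * r / 2 + 4 * (8 * j * j + 2 * (j * r) + j) := by nlinarith
  unfold sg
  rw [this, Nat.add_mul_mod_self_left]

theorem chisum (ζ : ℂ) (hζ : ζ ^ 4 = -1) (i : ℕ) :
    chi (ζ ^ 1) (ζ⁻¹ ^ 1) i + chi (ζ ^ 3) (ζ⁻¹ ^ 3) i + chi (ζ ^ 5) (ζ⁻¹ ^ 5) i + chi (ζ ^ 7) (ζ⁻¹ ^ 7) i = 4 * sg ((i + 1) * i / 2) := by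
  have hζ' : ζ⁻¹ ^ 4 = -1 := by rw [inv_pow, hζ]; norm_num
  induction i with
  | zero => simp [chi, sg]; norm_num
  | succ i ih =>
    simp only [chi]
    have h1 := psum ζ hζ (i + 1)
    have h2 := psum ζ⁻¹ hζ' (i + 1)
    have h3 : 4 * sg ((i + 1 + 1) * (i + 1) / 2) = (if (i + 1) % 8 = 0 then 8 else if (i + 1) % 8 = 4 then -8 else 0) - 4 * sg ((i + 1) * i / 2) := by
      obtain ⟨j, r, hr, rfl⟩ : ∃ j r, r < 8 ∧ i = 8 * j + r := ⟨i / 8, i % 8, Nat.mod_lt _ (by norm_num), (Nat.div_add_mod i 8).symm⟩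
      rw [show 8 * j + r + 1 = 8 * j + (r + 1) by ring, sgT, show 8 * j + (r + 1) = 8 * j + r + 1 by ring, sgT]
      rw [show (8 * j + r + 1) % 8 = (r + 1) % 8 by omega]
      interval_cases r <;> norm_num [sg]
    have h4 : (if (i + 1) % 8 = 0 then (4:ℂ) else if (i + 1) % 8 = 4 then -4 else 0) * 2 = (if (i + 1) % 8 = 0 then 8 else if (i + 1) % 8 = 4 then -8 else 0) := by
      split_ifs <;> norm_num
    linear_combination h1 + h2 - ih - h3 + h4

end RC

set_option linter.all false
namespace RC
open PowerSeries Finset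

noncomputable def tau (f : A) : A := PowerSeries.mk fun a => sg a * coeff a f

theorem tau_coeff (f : A) (n : ℕ) : coeff n (tau f) = sg n * coeff n f := by simp [tau]

theorem tau_mul_ex (f g : A) : tau (f * ex 4 (by simp) g) = tau f * ex 4 (by simp) g := by
  ext n
  rw [tau_coeff, coeff_mul, coeff_mul, mul_sum]
  apply sum_congr rfl
  rintro ⟨a, b⟩ hab
  rw [HasAntidiagonal.mem_antidiagonal] at hab
  simp only at hab ⊢
  rw [tau_coeff]
  by_cases h : 4 ∣ b
  · have : sg n = sg a := by unfold sg; rw [show n % 4 = a % 4 by omega]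
    rw [this, mul_assoc]
  · rw [ex_coeff0 4 _ _ _ h]; ring

theorem pi_tau {M : ℕ} {f g : A} (h : pi M f = pi M g) : pi M (tau f) = pi M (tau g) := by
  rw [pi_eq, X_pow_dvd_iff]
  intro m hm
  rw [map_sub, tau_coeff, tau_coeff, pi_coeff h hm, sub_self]

theorem tau_Psi (M : ℕ) : tau (Psi M) = Es M := by
  ext n
  rw [tau_coeff]
  unfold Psi Es
  rw [map_sum, map_sum, mul_sum]
  apply sum_congr rfl
  intro i _
  rw [coeff_mul_C, coeff_X_pow]
  split_ifs with h
  · rw [h]; ring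
  · simp

section
variable {M N : ℕ}

theorem r_u1 (hN : 2 * M + 4 ≤ N) : pi M (qp X X N) = pi M (qp X (X ^ 2) N) * pi M (qp (X ^ 2) (X ^ 2) N) := by
  rw [← map_mul, ← qp_two, st2 (n' := 2 * N) dvd_rfl (by omega) (by omega)]

theorem r_u2 (hN : 2 * M + 4 ≤ N) : pi M (qp (X ^ 2) (X ^ 2) N) = pi M (qp (X ^ 2) (X ^ 4) N) * pi M (qp (X ^ 4) (X ^ 4) N) := by
  have := qp_two (X ^ 2 : A) N
  rw [show (X ^ 2 : A) ^ 2 = X ^ 4 by ring] at this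
  rw [← map_mul, ← this, st2 (n' := 2 * N) (dvd_pow_self _ (by simp)) (by omega) (by omega)]

theorem r_split {R : Type*} [CommRing R] (q : R) (N : ℕ) : qp (-q) q (2 * N) = qp (-q) (q ^ 2) N * qp (-q ^ 2) (q ^ 2) N := by
  induction N with
  | zero => simp [qp_zero]
  | succ N ih =>
    rw [show 2 * (N + 1) = 2 * N + 1 + 1 by ring, qp_succ, qp_succ, ih, qp_succ, qp_succ]
    ring

theorem r_m1 (hN : 2 * M + 4 ≤ N) : pi M (qp (-X) X N) = pi M (qp (-X) (X ^ 2) N) * pi M (qp (-X ^ 2) (X ^ 2) N) := by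
  rw [← map_mul, ← r_split, st2 (n' := 2 * N) dvd_rfl (by omega) (by omega)]

theorem r_m2 (hN : 2 * M + 4 ≤ N) : pi M (qp (-X ^ 2) (X ^ 2) N) = pi M (qp (-X ^ 2) (X ^ 4) N) * pi M (qp (-X ^ 4) (X ^ 4) N) := by
  have := r_split (X ^ 2 : A) N
  rw [show (X ^ 2 : A) ^ 2 = X ^ 4 by ring] at this
  rw [← map_mul, ← this, st2 (n' := 2 * N) (dvd_pow_self _ (by simp)) (by omega) (by omega)]

/-- Euler -/
theorem euler {q : A} (hq : X ∣ q) (hN : 2 * M + 4 ≤ N) : pi M (qp (-q) q N) * pi M (qp q (q ^ 2) N) = 1 := by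
  have h1 := congrArg (pi M) (qp_two q N)
  have h2 := congrArg (pi M) (qp_sq q q N)
  rw [st2 (n' := N) hq (by omega) (by omega)] at h1
  rw [map_mul] at h1 h2
  have hc : constantCoeff q = 0 := X_dvd_iff.1 hq
  have h3 : pi M (qp (q ^ 2) (q ^ 2) N) * pi M (qp (q ^ 2) (q ^ 2) N)⁻¹ = 1 := by
    rw [← map_mul, inv_cancel' (by rw [cc_qp (by simp [hc])]; simp), map_one]
  rw [h1] at h2
  linear_combination pi M (qp (q ^ 2) (q ^ 2) N)⁻¹ * h2 + (1 - pi M (qp (-q) q N) * pi M (qp q (q ^ 2) N)) * h3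

theorem sq1 : pi M (qp X (X ^ 2) N) * pi M (qp (-X) (X ^ 2) N) = pi M (qp (X ^ 2) (X ^ 4) N) := by
  rw [← map_mul, qp_sq]; ring_nf

theorem psi_eq (hN : 2 * M + 4 ≤ N) : pi M (Psi M) = pi M (qp (-X) (X ^ 2) N) * pi M (qp (X ^ 4) (X ^ 4) N) := by
  rw [← J1one hN, map_mul, map_mul]
  have h1 := r_u1 hN
  have h2 := r_u2 hN
  have h3 := r_m1 hN
  have h4 := euler (M := M) (N := N) (q := X) dvd_rfl hN
  have h5 := euler (M := M) (N := N) (q := X ^ 2) (dvd_pow_self _ (by simp)) hN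
  rw [show (X ^ 2 : A) ^ 2 = X ^ 4 by ring] at h5
  rw [h1, h2]
  linear_combination (pi M (qp (X ^ 2) (X ^ 4) N) * pi M (qp (X ^ 4) (X ^ 4) N) * pi M (qp (-X) X N)) * h4 + (pi M (qp (X ^ 2) (X ^ 4) N) * pi M (qp (X ^ 4) (X ^ 4) N)) * h3 + pi M (qp (-X) (X ^ 2) N) * pi M (qp (X ^ 4) (X ^ 4) N) * h5

theorem Es_eq (hN : 2 * M + 4 ≤ N) : pi M (Es M) = pi M (tau (qp (-X) (X ^ 2) N)) * pi M (qp (X ^ 4) (X ^ 4) N) := by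
  have h := psi_eq hN
  have e : qp (X ^ 4) (X ^ 4) N = ex 4 (by simp) (qp X X N) := by rw [map_qp, ex_X]
  rw [e, ← map_mul] at h ⊢
  rw [← tau_Psi, pi_tau h, tau_mul_ex]

/-- value at `z = ± i` -/
theorem CP_i (hN : 2 * M + 4 ≤ N) {z w : ℂ} (hzw : w = -z) (hz : z ^ 2 = -1) :
    pi M (CP (C z) (C w) N) = pi M (T3 M * qp (-X) (X ^ 2) N) := by
  have e1 : qp (C z * X) X N * qp (C w * X) X N = (qp (-X ^ 2) (X ^ 2) N : A) := by
    rw [hzw, map_neg, neg_mul, qp_sq, mul_pow, ← map_pow, hz]; simp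
  have e2 : -(C z) ^ 2 * X = (X : A) := by rw [← map_pow, hz]; simp
  have e3 : -(C w) ^ 2 * X = (X : A) := by rw [hzw, ← map_pow, neg_sq, hz]; simp
  unfold CP
  rw [e1, e2, e3]
  have hD : pi M (qp (-X ^ 2) (X ^ 2) N * (qp X (X ^ 2) N * qp X (X ^ 2) N)) * pi M (qp (-X ^ 2) (X ^ 2) N * (qp X (X ^ 2) N * qp X (X ^ 2) N))⁻¹ = 1 := by
    rw [← map_mul, inv_cancel', map_one]
    rw [map_mul, map_mul, cc_qp (by simp), cc_qp (by simp)]; simp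
  have h1 := r_u1 hN
  have h3 := r_m1 hN
  have h4 := euler (M := M) (N := N) (q := X) dvd_rfl hN
  have h2 := J2 hN
  simp only [map_mul] at h2 hD ⊢
  rw [h3] at h4
  rw [← h2, h1]
  generalize pi M ((qp (-X ^ 2) (X ^ 2) N * (qp X (X ^ 2) N * qp X (X ^ 2) N))⁻¹) = I at *
  generalize pi M (qp (-X ^ 2) (X ^ 2) N) = m2 at *
  generalize pi M (qp X (X ^ 2) N) = o1 at *
  generalize pi M (qp (-X) (X ^ 2) N) = d at *
  generalize pi M (qp (X ^ 2) (X ^ 2) N) = u2 at *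
  linear_combination u2 * d * d * d * hD - u2 * d * d * o1 * I * h4

theorem Cs_i (hN : 2 * M + 4 ≤ N) {z w : ℂ} (hzw : w = -z) (hz : z ^ 2 = -1) :
    pi M (Cs (C z) (C w) N) = pi M (T4 M * qp X (X ^ 2) N) := by
  have e1 : qp (C z * X) X N * qp (C w * X) X N = (qp (-X ^ 2) (X ^ 2) N : A) := by
    rw [hzw, map_neg, neg_mul, qp_sq, mul_pow, ← map_pow, hz]; simp
  have hz1 := qp_mul_ip (a := C z * X) (by simp) N
  have hz2 := qp_mul_ip (a := C w * X) (by simp) N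
  have hD : pi M (qp (-X ^ 2) (X ^ 2) N) * (pi M (ip (C z * X) N) * pi M (ip (C w * X) N)) = 1 := by
    rw [← e1, ← map_mul, ← map_mul, ← map_one (pi M)]; congr 1
    linear_combination qp (C w * X) X N * ip (C w * X) N * hz1 + hz2
  have h1 := r_u1 hN
  have h2 := r_u2 hN
  have h5 := euler (M := M) (N := N) (q := X ^ 2) (dvd_pow_self _ (by simp)) hN
  rw [show (X ^ 2 : A) ^ 2 = X ^ 4 by ring] at h5
  have h3 := J3 hN
  unfold Cs
  simp only [map_mul] at h3 ⊢
  rw [← h3, h1, h2]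
  generalize pi M (qp (-X ^ 2) (X ^ 2) N) = m2 at *
  generalize pi M (qp X (X ^ 2) N) = o1 at *
  generalize pi M (qp (X ^ 2) (X ^ 4) N) = o2 at *
  generalize pi M (qp (X ^ 4) (X ^ 4) N) = u4 at *
  generalize pi M (ip (C z * X) N) = i1 at *
  generalize pi M (ip (C w * X) N) = i2 at *
  linear_combination o1 * o2 * u4 * (o2 * hD - i1 * i2 * h5)

/-- primitive eighth roots -/
theorem Cs_8 (hN : 2 * M + 4 ≤ N) {z w : ℂ} (hzw : z * w = 1) (hz : z ^ 4 = -1) :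
    pi M (Cs (C z) (C w) N) = pi M ((∑ i ∈ range (M + 1), X ^ ((i + 1) * i / 2) * C (chi z w i)) * qp (X ^ 4) (X ^ 8) N) := by
  have hw4 : w ^ 4 = -1 := by
    have : z ^ 4 * w ^ 4 = 1 := by rw [← mul_pow, hzw, one_pow]
    rw [hz] at this; linear_combination -this
  have hw : 1 + w ≠ 0 := by
    intro h
    rw [show w = -1 by linear_combination h] at hw4
    norm_num at hw4
  have hww : w ^ 2 = - z ^ 2 := by
    have : z ^ 2 * (w ^ 2 + z ^ 2) = 0 := by linear_combination (z * w + 1) * hzw + hz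
    rcases mul_eq_zero.1 this with h | h
    · exfalso; rw [show z ^ 4 = z ^ 2 * z ^ 2 by ring, h] at hz; norm_num at hz
    · linear_combination h
  have hJ := J1 (M := M) hzw hw hN
  have e1 : (qp (C z * X) X N * qp (-(C z * X)) X N) * (qp (C w * X) X N * qp (-(C w * X)) X N) = (qp (-X ^ 4) (X ^ 4) N : A) := by
    rw [qp_sq, qp_sq, mul_pow, mul_pow, ← map_pow, ← map_pow, hww, map_neg, neg_mul, qp_sq, mul_pow, ← map_pow, ← pow_mul, hz]
    simp; ring_nf
  have hz1 := qp_mul_ip (a := C z * X) (by simp) N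
  have hz2 := qp_mul_ip (a := C w * X) (by simp) N
  have h5 := euler (M := M) (N := N) (q := X ^ 4) (dvd_pow_self _ (by simp)) hN
  rw [show (X ^ 4 : A) ^ 2 = X ^ 8 by ring, ← e1] at h5
  have hz1' := congrArg (pi M) hz1
  have hz2' := congrArg (pi M) hz2
  unfold Cs
  rw [map_mul _ _ (qp (X ^ 4) (X ^ 8) N), ← hJ]
  simp only [map_mul, map_one] at *
  generalize pi M (qp (X ^ 4) (X ^ 8) N) = o4 at *
  generalize pi M (ip (C z * X) N) = i1 at *
  generalize pi M (ip (C w * X) N) = i2 at *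
  generalize pi M (qp (C z * X) X N) = a1 at *
  generalize pi M (qp (C w * X) X N) = a2 at *
  generalize pi M (qp (-(C z * X)) X N) = b1 at *
  generalize pi M (qp (-(C w * X)) X N) = b2 at *
  generalize pi M (qp X X N) = u at *
  linear_combination -u * i1 * i2 * h5 + u * b1 * b2 * o4 * (a2 * i2 * hz1' + hz2')

theorem CP_8 (hN : 2 * M + 4 ≤ N) {z w : ℂ} (hzw : z * w = 1) (hz : z ^ 4 = -1) :
    pi M (CP (C z) (C w) N) * pi M (qp (X ^ 4) (X ^ 4) N) = pi M (∑ i ∈ range (M + 1), X ^ ((i + 1) * i / 2) * C (chi z w i)) * pi M (T3 M) := by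
  have hww : w ^ 2 = - z ^ 2 := by
    have : z ^ 2 * (w ^ 2 + z ^ 2) = 0 := by linear_combination (z * w + 1) * hzw + hz
    rcases mul_eq_zero.1 this with h | h
    · exfalso; rw [show z ^ 4 = z ^ 2 * z ^ 2 by ring, h] at hz; norm_num at hz
    · linear_combination h
  have hC := Cs_8 hN hzw hz
  have e1 : qp (-C z ^ 2 * X) (X ^ 2) N * qp (-C w ^ 2 * X) (X ^ 2) N = (qp (-X ^ 2) (X ^ 4) N : A) := by
    rw [← map_pow, ← map_pow, hww, map_neg, neg_neg, mul_comm, show -C (z ^ 2) * (X : A) = -(C (z ^ 2) * X) by ring, qp_sq, mul_pow, ← map_pow, ← pow_mul, hz]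
    simp; ring_nf
  unfold CP
  rw [e1]
  unfold Cs at hC
  have hz1 := congrArg (pi M) (qp_mul_ip (a := C z * X) (by simp) N)
  have hz2 := congrArg (pi M) (qp_mul_ip (a := C w * X) (by simp) N)
  have hD : pi M (qp (C z * X) X N * qp (C w * X) X N * qp (-X ^ 2) (X ^ 4) N) * pi M (qp (C z * X) X N * qp (C w * X) X N * qp (-X ^ 2) (X ^ 4) N)⁻¹ = 1 := by
    rw [← map_mul, inv_cancel', map_one]
    rw [map_mul, map_mul, cc_qp (by simp), cc_qp (by simp), cc_qp (by simp)]; simp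
  have h2 := r_u2 hN
  have hm2 := r_m2 hN
  have h4 := euler (M := M) (N := N) (q := X ^ 4) (dvd_pow_self _ (by simp)) hN
  have h5 := euler (M := M) (N := N) (q := X ^ 2) (dvd_pow_self _ (by simp)) hN
  rw [show (X ^ 2 : A) ^ 2 = X ^ 4 by ring, hm2] at h5
  rw [show (X ^ 4 : A) ^ 2 = X ^ 8 by ring] at h4
  have hJ := J2 hN
  rw [← hJ]
  simp only [map_mul, map_one] at *
  rw [h2]
  generalize pi M (qp (C z * X) X N * qp (C w * X) X N * qp (-X ^ 2) (X ^ 4) N)⁻¹ = I at *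
  generalize pi M (∑ i ∈ range (M + 1), X ^ ((i + 1) * i / 2) * C (chi z w i)) = E at *
  generalize pi M (qp (X ^ 4) (X ^ 8) N) = o4 at *
  generalize pi M (ip (C z * X) N) = i1 at *
  generalize pi M (ip (C w * X) N) = i2 at *
  generalize pi M (qp (C z * X) X N) = a1 at *
  generalize pi M (qp (C w * X) X N) = a2 at *
  generalize pi M (qp X X N) = u at *
  generalize pi M (qp (-X ^ 2) (X ^ 4) N) = d2 at *
  generalize pi M (qp (-X ^ 4) (X ^ 4) N) = m4 at *
  generalize pi M (qp (X ^ 2) (X ^ 4) N) = o2 at *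
  generalize pi M (qp (X ^ 4) (X ^ 4) N) = u4 at *
  generalize pi M (qp (-X) (X ^ 2) N) = d at *
  have hI : I = i1 * i2 * m4 * o2 := by
    linear_combination i1 * i2 * m4 * o2 * hD - I * (a2 * i2 * d2 * m4 * o2 * hz1 + d2 * m4 * o2 * hz2 + h5)
  rw [hI]
  linear_combination d * d * u4 * m4 * o2 * hC + E * d * d * u4 * o2 * h4

theorem main_id (ζ : ℂ) (hζ : ζ ^ 4 = -1) (hN : 2 * M + 4 ≤ N) :
    pi M (∑ s ∈ range 8, (CP (C (ζ ^ s)) (C (ζ⁻¹ ^ s)) N - Cs (C (ζ ^ s)) (C (ζ⁻¹ ^ s)) N)) =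
      pi M (2 * (T3 M * qp (-X) (X ^ 2) N - T4 M * qp X (X ^ 2) N) + 4 * (T3 M * tau (qp (-X) (X ^ 2) N) - Es M * qp (X ^ 4) (X ^ 8) N)) := by
  have hz : ζ ≠ 0 := by rintro rfl; norm_num at hζ
  have hinv : ζ⁻¹ = - ζ ^ 3 := by
    rw [inv_eq_iff_eq_inv, eq_comm, inv_eq_iff_eq_inv]
    apply eq_inv_of_mul_eq_one_left; linear_combination -hζ
  have hzw : ∀ s, ζ ^ s * ζ⁻¹ ^ s = 1 := by intro s; rw [← mul_pow, mul_inv_cancel₀ hz, one_pow]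
  have triv : ∀ z : ℂ, z ^ 2 = 1 → CP (C z) (C z) N = Cs (C z) (C z) N := by
    intro z hz
    unfold CP Cs
    rw [show -C z ^ 2 * (X : A) = -X by rw [← map_pow, hz]; simp]
    have hz1 := qp_mul_ip (a := C z * X) (by simp) N
    have hD : (qp (C z * X) X N * qp (C z * X) X N * (qp (-X) (X ^ 2) N * qp (-X) (X ^ 2) N)) * (qp (C z * X) X N * qp (C z * X) X N * (qp (-X) (X ^ 2) N * qp (-X) (X ^ 2) N))⁻¹ = 1 := by
      rw [inv_cancel']
      simp only [map_mul]
      rw [cc_qp (by simp), cc_qp (by simp)]; simp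
    generalize (qp (C z * X) X N * qp (C z * X) X N * (qp (-X) (X ^ 2) N * qp (-X) (X ^ 2) N))⁻¹ = I at *
    generalize qp (C z * X) X N = a at *
    generalize ip (C z * X) N = i at *
    generalize qp (-X) (X ^ 2 : A) N = d at *
    linear_combination (qp X X N * i ^ 2) * hD - qp X X N * d ^ 2 * I * (a * i + 1) * hz1
  have h0 := triv 1 (by norm_num)
  have h4 := triv (-1) (by norm_num)
  have i4 : ζ⁻¹ ^ 4 = -1 := by rw [inv_pow, hζ]; norm_num
  have w2 : ζ⁻¹ ^ 2 = - ζ ^ 2 := by rw [hinv]; linear_combination ζ ^ 2 * hζ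
  have w6 : ζ⁻¹ ^ 6 = - ζ ^ 6 := by rw [show ζ⁻¹ ^ 6 = ζ⁻¹ ^ 4 * ζ⁻¹ ^ 2 by ring, i4, w2]; linear_combination ζ ^ 2 * hζ
  have q2 : (ζ ^ 2) ^ 2 = -1 := by rw [← pow_mul, hζ]
  have q6 : (ζ ^ 6) ^ 2 = -1 := by linear_combination (ζ ^ 8 - ζ ^ 4 + 1) * hζ
  have a2 := CP_i hN w2 q2
  have b2 := Cs_i hN w2 q2
  have a6 := CP_i hN w6 q6
  have b6 := Cs_i hN w6 q6
  have f1 : (ζ ^ 1) ^ 4 = -1 := by rw [pow_one, hζ]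
  have f3 : (ζ ^ 3) ^ 4 = -1 := by linear_combination (ζ ^ 8 - ζ ^ 4 + 1) * hζ
  have f5 : (ζ ^ 5) ^ 4 = -1 := by linear_combination (ζ ^ 16 - ζ ^ 12 + ζ ^ 8 - ζ ^ 4 + 1) * hζ
  have f7 : (ζ ^ 7) ^ 4 = -1 := by linear_combination (ζ ^ 24 - ζ ^ 20 + ζ ^ 16 - ζ ^ 12 + ζ ^ 8 - ζ ^ 4 + 1) * hζ
  have c1 := Cs_8 hN (hzw 1) f1
  have c3 := Cs_8 hN (hzw 3) f3
  have c5 := Cs_8 hN (hzw 5) f5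
  have c7 := Cs_8 hN (hzw 7) f7
  have d1 := CP_8 hN (hzw 1) f1
  have d3 := CP_8 hN (hzw 3) f3
  have d5 := CP_8 hN (hzw 5) f5
  have d7 := CP_8 hN (hzw 7) f7
  have hE : (∑ i ∈ range (M + 1), (X : A) ^ ((i + 1) * i / 2) * C (chi (ζ ^ 1) (ζ⁻¹ ^ 1) i)) + (∑ i ∈ range (M + 1), (X : A) ^ ((i + 1) * i / 2) * C (chi (ζ ^ 3) (ζ⁻¹ ^ 3) i)) + (∑ i ∈ range (M + 1), (X : A) ^ ((i + 1) * i / 2) * C (chi (ζ ^ 5) (ζ⁻¹ ^ 5) i)) + (∑ i ∈ range (M + 1), (X : A) ^ ((i + 1) * i / 2) * C (chi (ζ ^ 7) (ζ⁻¹ ^ 7) i)) = 4 * Es M := by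
    unfold Es
    rw [← sum_add_distrib, ← sum_add_distrib, ← sum_add_distrib, mul_sum]
    apply sum_congr rfl
    intro i _
    have := congrArg (C (R := ℂ)) (chisum ζ hζ i)
    simp only [map_add, map_mul] at this
    rw [show (C (4:ℂ) : A) = 4 from map_ofNat _ _] at this
    linear_combination (X : A) ^ ((i + 1) * i / 2) * this
  have hE' := congrArg (pi M) hE
  have hEs := Es_eq (M := M) hN
  have hu : pi M (qp (X ^ 4) (X ^ 4) N) * pi M (qp (X ^ 4) (X ^ 4) N)⁻¹ = 1 := by
    rw [← map_mul, inv_cancel', map_one]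
    rw [cc_qp (by simp)]; simp
  simp only [sum_range_succ, sum_range_zero, zero_add]
  rw [pow_zero, pow_zero, h0, hζ, i4, h4]
  simp only [map_add, map_sub, map_mul, map_ofNat, sub_self, map_zero] at *
  rw [a2, b2, a6, b6, c1, c3, c5, c7]
  generalize pi M (∑ i ∈ range (M + 1), (X : A) ^ ((i + 1) * i / 2) * C (chi (ζ ^ 1) (ζ⁻¹ ^ 1) i)) = E1 at *
  generalize pi M (∑ i ∈ range (M + 1), (X : A) ^ ((i + 1) * i / 2) * C (chi (ζ ^ 3) (ζ⁻¹ ^ 3) i)) = E3 at *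
  generalize pi M (∑ i ∈ range (M + 1), (X : A) ^ ((i + 1) * i / 2) * C (chi (ζ ^ 5) (ζ⁻¹ ^ 5) i)) = E5 at *
  generalize pi M (∑ i ∈ range (M + 1), (X : A) ^ ((i + 1) * i / 2) * C (chi (ζ ^ 7) (ζ⁻¹ ^ 7) i)) = E7 at *
  generalize pi M (CP (C (ζ ^ 1)) (C (ζ⁻¹ ^ 1)) N) = P1 at *
  generalize pi M (CP (C (ζ ^ 3)) (C (ζ⁻¹ ^ 3)) N) = P3 at *
  generalize pi M (CP (C (ζ ^ 5)) (C (ζ⁻¹ ^ 5)) N) = P5 at *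
  generalize pi M (CP (C (ζ ^ 7)) (C (ζ⁻¹ ^ 7)) N) = P7 at *
  generalize pi M (qp (X ^ 4) (X ^ 4) N)⁻¹ = v at *
  generalize pi M (qp (X ^ 4) (X ^ 4) N) = u at *
  generalize pi M (tau (qp (-X) (X ^ 2) N)) = td at *
  generalize pi M (Es M) = Ee at *
  generalize pi M (T3 M) = t3 at *
  generalize pi M (qp (X ^ 4) (X ^ 8) N) = o4 at *
  have key : P1 + P3 + P5 + P7 = 4 * (t3 * td) := by
    have h : (P1 + P3 + P5 + P7) * u = 4 * (t3 * td) * u := by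
      linear_combination d1 + d3 + d5 + d7 + t3 * hE' + 4 * t3 * hEs
    linear_combination v * h + (4 * (t3 * td) - (P1 + P3 + P5 + P7)) * hu
  linear_combination key - o4 * hE'

end
end RC

set_option linter.all false
namespace RC
open PowerSeries Finset

theorem root_sum {ζ : ℂ} (h : IsPrimitiveRoot ζ 8) (r : ℤ) : ∑ s ∈ range 8, (ζ ^ s) ^ r = if r % ((8 : ℕ) : ℤ) = 0 % ((8 : ℕ) : ℤ) then 8 else 0 := by
  have e : ∀ s ∈ range 8, (ζ ^ s) ^ r = (ζ ^ r) ^ s := by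
    intro s _
    rw [← zpow_natCast, ← zpow_natCast, zpow_comm]
  rw [sum_congr rfl e]
  split_ifs with hr
  · have : ζ ^ r = 1 := (h.zpow_eq_one_iff_dvd r).2 (by push_cast at hr ⊢; omega)
    rw [this]; simp
  · have hne : ζ ^ r ≠ 1 := by
      intro h1
      have := (h.zpow_eq_one_iff_dvd r).1 h1
      push_cast at hr this; omega
    rw [geom_sum_eq hne]
    have : (ζ ^ r) ^ 8 = 1 := by
      rw [← zpow_natCast, zpow_comm, zpow_natCast, h.pow_eq_one, one_zpow]
    rw [this]; simp

theorem count_eq {ζ : ℂ} (h : IsPrimitiveRoot ζ 8) {n : ℕ} (f : n.Partition → ℤ) :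
    8 * (((univ.filter fun p : n.Partition => f p % ((8 : ℕ) : ℤ) = 0 % ((8 : ℕ) : ℤ)).card : ℕ) : ℂ) = ∑ s ∈ range 8, ∑ p : n.Partition, (ζ ^ s) ^ (f p) := by
  rw [sum_comm]
  simp only [root_sum h]
  rw [card_filter, Nat.cast_sum, mul_sum]
  apply sum_congr rfl
  intro p _
  split_ifs <;> simp

theorem diff_eq {n : ℕ} (hn : 2 ≤ n) (h4 : ¬ 4 ∣ n) :
    8 * (rankCount 0 8 n : ℂ) - 8 * (crankCount 0 8 n : ℂ) =
      coeff n (2 * (T3 (n + 1) * qp (-X) (X ^ 2) (4 * n + 8) - T4 (n + 1) * qp X (X ^ 2) (4 * n + 8)) + 4 * (T3 (n + 1) * tau (qp (-X) (X ^ 2) (4 * n + 8)) - Es (n + 1) * qp (X ^ 4) (X ^ 8) (4 * n + 8))) := by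
  have hp := Complex.isPrimitiveRoot_exp 8 (by norm_num)
  generalize Complex.exp (2 * Real.pi * Complex.I / (8 : ℕ)) = ζ at hp
  have h8 : ζ ^ 8 = 1 := hp.pow_eq_one
  have hζ : ζ ^ 4 = -1 := by
    have h1 : ζ ^ 4 ≠ 1 := by
      intro h
      have := (hp.pow_eq_one_iff_dvd 4).1 h
      omega
    have : (ζ ^ 4 - 1) * (ζ ^ 4 + 1) = 0 := by linear_combination h8
    rcases mul_eq_zero.1 this with h | h
    · exact absurd (by linear_combination h) h1
    · linear_combination h
  have hz : ζ ≠ 0 := by rintro rfl; norm_num at hζ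
  unfold rankCount crankCount
  rw [count_eq hp, count_eq hp]
  have e1 : ∀ s ∈ range 8, ∑ p : n.Partition, (ζ ^ s) ^ (partitionRank p) = coeff n (Rs (C (ζ ^ s)) (C (ζ⁻¹ ^ s)) (4 * n + 8 + 1)) := by
    intro s _
    rw [rank_durfee (pow_ne_zero s hz) (by omega) (show n < 4 * n + 8 by omega), inv_pow]
  have e2 : ∀ s ∈ range 8, ∑ p : n.Partition, (ζ ^ s) ^ (partitionCrank p) = coeff n (Cs (C (ζ ^ s)) (C (ζ⁻¹ ^ s)) (4 * n + 8)) := by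
    intro s _
    rw [crank_gf (pow_ne_zero s hz) hn (show n ≤ 4 * n + 8 by omega), inv_pow]
  rw [sum_congr rfl e1, sum_congr rfl e2, ← map_sum, ← map_sum, vanish ζ hζ h4 (by omega) (show 4 * n + 4 ≤ 4 * n + 8 by omega)]
  rw [← map_sub, ← sum_sub_distrib]
  exact pi_coeff (main_id (M := n + 1) (N := 4 * n + 8) ζ hζ (by omega)) (by omega)

end RC

set_option linter.all false
namespace RC
open PowerSeries Finset

def maj (f g : A) : Prop := ∀ n, ∃ r : ℝ, coeff n g = (r : ℂ) ∧ ‖coeff n f‖ ≤ r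

theorem maj_add {f g f' g' : A} (h : maj f g) (h' : maj f' g') : maj (f + f') (g + g') := by
  intro n
  obtain ⟨r, hr, hn⟩ := h n
  obtain ⟨r', hr', hn'⟩ := h' n
  refine ⟨r + r', by rw [map_add, hr, hr']; push_cast; rfl, ?_⟩
  rw [map_add]
  exact (norm_add_le _ _).trans (add_le_add hn hn')

theorem maj_neg {f g : A} (h : maj f g) : maj (-f) g := by
  intro n
  obtain ⟨r, hr, hn⟩ := h n
  exact ⟨r, hr, by rwa [map_neg, norm_neg]⟩

theorem maj_sub {f g f' g' : A} (h : maj f g) (h' : maj f' g') : maj (f - f') (g + g') := by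
  rw [sub_eq_add_neg]; exact maj_add h (maj_neg h')

theorem maj_mul {f g f' g' : A} (h : maj f g) (h' : maj f' g') : maj (f * f') (g * g') := by
  intro n
  choose r hr hn using h
  choose r' hr' hn' using h'
  refine ⟨∑ x ∈ antidiagonal n, r x.1 * r' x.2, ?_, ?_⟩
  · rw [coeff_mul]; push_cast
    apply sum_congr rfl; intro x _; rw [hr, hr']
  · rw [coeff_mul]
    refine (norm_sum_le _ _).trans (sum_le_sum ?_)
    intro x _
    rw [norm_mul]
    exact mul_le_mul (hn _) (hn' _) (norm_nonneg _) ((norm_nonneg _).trans (hn _))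

theorem maj_trans {f g k : A} (h : maj f g) (h' : maj g k) : maj f k := by
  intro n
  obtain ⟨r, hr, hn⟩ := h n
  obtain ⟨r', hr', hn'⟩ := h' n
  refine ⟨r', hr', hn.trans ?_⟩
  rw [hr] at hn'
  exact (le_abs_self r).trans (by simpa using hn')

theorem maj_zero : maj 0 0 := fun n => ⟨0, by simp, by simp⟩

theorem maj_sum {ι : Type*} (s : Finset ι) (f g : ι → A) (h : ∀ i ∈ s, maj (f i) (g i)) : maj (∑ i ∈ s, f i) (∑ i ∈ s, g i) := by
  classical
  induction s using Finset.induction_on with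
  | empty => simpa using maj_zero
  | insert a s ha ih =>
    rw [sum_insert ha, sum_insert ha]
    exact maj_add (h a (mem_insert_self _ _)) (ih fun i hi => h i (mem_insert_of_mem hi))

theorem maj_X (k : ℕ) : maj (X ^ k) (X ^ k) := by
  intro n
  refine ⟨if n = k then 1 else 0, ?_, ?_⟩
  · rw [coeff_X_pow]; split_ifs <;> simp
  · rw [coeff_X_pow]; split_ifs <;> simp

theorem maj_one : maj 1 1 := by simpa using maj_X 0

theorem maj_le {f g : A} (h : maj f f) (h' : maj (g - f) (g - f)) : maj f g := by
  have : g = f + (g - f) := by ring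
  rw [this]
  have := maj_add h (maj_trans (f := 0) (fun n => by
    obtain ⟨r, hr, hn⟩ := h' n
    exact ⟨r, hr, by simpa using (norm_nonneg _).trans hn⟩) h')
  simpa using this

theorem maj_ex {f g : A} (h : maj f g) : maj (ex 4 (by simp) f) (ex 4 (by simp) g) := by
  intro n
  by_cases hn : 4 ∣ n
  · obtain ⟨m, rfl⟩ := hn
    rw [ex_coeff, ex_coeff]; exact h m
  · rw [ex_coeff0 4 _ _ _ hn, ex_coeff0 4 _ _ _ hn]; exact ⟨0, by simp, by simp⟩

theorem maj_geo {F : A} {k : ℕ} (h : F = 1 + X ^ (k + 1) * F) : maj F F := by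
  intro n
  induction n using Nat.strong_induction_on with
  | _ n ih =>
    rw [h, map_add, coeff_X_pow_mul']
    obtain ⟨r, hr, hn⟩ := maj_one n
    split_ifs with hk
    · obtain ⟨r', hr', hn'⟩ := ih (n - (k + 1)) (by omega)
      exact ⟨r + r', by rw [hr, hr']; push_cast; rfl, (norm_add_le _ _).trans (add_le_add hn hn')⟩
    · rw [add_zero]; exact ⟨r, hr, hn⟩

noncomputable def F (k : ℕ) : A := (1 - X * X ^ k)⁻¹

theorem F_eq (k : ℕ) : F k = 1 + X ^ (k + 1) * F k := by
  have := inv_cancel' (a := 1 - X * X ^ k) (cc_one_sub (by simp))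
  unfold F
  rw [pow_succ]
  linear_combination this

theorem maj_F (k : ℕ) : maj (F k) (F k) := maj_geo (F_eq k)

theorem maj_1F (k : ℕ) : maj 1 (F k) := by
  apply maj_le maj_one
  rw [show F k - 1 = X ^ (k + 1) * F k by linear_combination F_eq k]
  exact maj_mul (maj_X _) (maj_F _)

theorem maj_2F (k : ℕ) : maj (1 - X ^ (k + 1)) (F k) := by
  refine maj_trans (maj_sub maj_one (maj_X (k + 1))) (maj_le (maj_add maj_one (maj_X _)) ?_)
  rw [show F k - (1 + X ^ (k + 1)) = X ^ (k + 1) * (X ^ (k + 1) * F k) by linear_combination (1 + X ^ (k + 1)) * F_eq k]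
  exact maj_mul (maj_X _) (maj_mul (maj_X _) (maj_F _))

theorem ip_F (n : ℕ) : ip X (n + 1) = ip X n * F n := ip_succ X n

theorem maj_ip (n : ℕ) : maj (ip X n) (ip X n) := by
  induction n with
  | zero => simpa [ip] using maj_one
  | succ n ih => rw [ip_F]; exact maj_mul ih (maj_F n)

theorem maj_o (N : ℕ) : maj (qp X (X ^ 2) N) (ip X (2 * N)) := by
  induction N with
  | zero => simpa [ip, qp] using maj_one
  | succ N ih =>
    rw [qp_succ, show 2 * (N + 1) = 2 * N + 1 + 1 by ring, ip_F, ip_F, mul_assoc]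
    apply maj_mul ih
    have := maj_mul (maj_2F (2 * N)) (maj_1F (2 * N + 1))
    rw [mul_one] at this
    convert this using 2
    rw [← pow_mul, pow_succ']

theorem maj_o2 (N : ℕ) : maj (qp X (X ^ 2) (N + 1)) (1 + X * ip X (2 * N)) := by
  induction N with
  | zero =>
    have := maj_sub maj_one (maj_X 1)
    simpa [qp, ip] using this
  | succ N ih =>
    have h2 := maj_mul (maj_X (2 * N + 3)) (maj_o (N + 1))
    have e : qp (X : A) (X ^ 2) (N + 1 + 1) = qp X (X ^ 2) (N + 1) - X ^ (2 * N + 3) * qp X (X ^ 2) (N + 1) := by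
      rw [qp_succ _ _ (N + 1), ← pow_mul]; ring
    rw [e]
    refine maj_trans (maj_sub ih h2) (maj_le (maj_add (maj_add maj_one (by simpa using maj_mul (maj_X 1) (maj_ip (2 * N)))) (maj_mul (maj_X _) (maj_ip _))) ?_)
    have i1 : ip X (2 * (N + 1)) = ip X (2 * N) * F (2 * N) * F (2 * N + 1) := by
      rw [show 2 * (N + 1) = 2 * N + 1 + 1 by ring, ip_F, ip_F]
    have : 1 + X * ip X (2 * (N + 1)) - (1 + X * ip X (2 * N) + X ^ (2 * N + 3) * ip X (2 * (N + 1))) = X ^ (2 * N + 2) * (ip X (2 * N) * F (2 * N)) := by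
      rw [i1]
      have f1 := F_eq (2 * N)
      have f2 := F_eq (2 * N + 1)
      linear_combination X * ip X (2 * N) * F (2 * N) * f2 + X * ip X (2 * N) * f1
    rw [this, ← ip_F]
    exact maj_mul (maj_X _) (maj_ip _)

theorem maj_Es (M : ℕ) : maj (Es M) (Psi M) := by
  unfold Es Psi
  apply maj_sum
  intro i _ n
  refine ⟨if n = (i + 1) * i / 2 then 1 else 0, ?_, ?_⟩
  · rw [coeff_X_pow]; split_ifs <;> simp
  · rw [coeff_mul_C, coeff_X_pow]
    unfold sg
    split_ifs <;> simp

theorem Psi_le (M n : ℕ) : (coeff n (Psi M)).re ≤ 1 := by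
  unfold Psi
  rw [map_sum]
  simp only [coeff_X_pow]
  rw [sum_boole]
  have : ((range (M + 1)).filter fun i => n = (i + 1) * i / 2).card ≤ 1 := by
    rw [card_le_one]
    intro a ha b hb
    rw [mem_filter] at ha hb
    have h1 := tri2 a
    have h2 := tri2 b
    rw [← ha.2] at h1; rw [← hb.2] at h2
    rcases lt_trichotomy a b with h | h | h
    · nlinarith
    · exact h
    · nlinarith
  simpa using this

theorem T4_bound {M N n : ℕ} (hN : 2 * M + 4 ≤ N) (h4 : 4 ≤ n) (hn : n < M) :
    ‖coeff n (Es M * qp (X ^ 4) (X ^ 8) N)‖ ≤ 1 + (coeff (n - 4) (qp (-X : A) (X ^ 2) N)).re := by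
  obtain ⟨K, rfl⟩ := Nat.exists_eq_add_of_le' (show 1 ≤ N by omega)
  have e : qp (X ^ 4 : A) (X ^ 8) (K + 1) = ex 4 (by simp) (qp X (X ^ 2) (K + 1)) := by
    rw [map_qp, map_pow, ex_X, ← pow_mul]
  obtain ⟨r, hr, hle⟩ := maj_mul (maj_Es M) (maj_ex (maj_o2 K)) n
  rw [← e] at hle
  refine hle.trans ?_
  have hpsi := psi_eq (M := M) (N := 2 * K) (by omega)
  have hu : pi M (qp (X ^ 4 : A) (X ^ 4) (2 * K)) * pi M (ex 4 (by simp) (ip X (2 * K))) = 1 := by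
    have : qp (X ^ 4 : A) (X ^ 4) (2 * K) = ex 4 (by simp) (qp X X (2 * K)) := by rw [map_qp, ex_X]
    rw [this, ← map_mul, ← map_mul, qp_mul_ip (by simp), map_one, map_one]
  have h1 : pi M (Psi M * ex 4 (by simp) (1 + X * ip X (2 * K))) = pi M (Psi M + X ^ 4 * qp (-X) (X ^ 2) (K + 1)) := by
    rw [map_add (ex 4 _), map_one, map_mul (ex 4 _), ex_X]
    have := st2 (M := M) (n := K + 1) (n' := 2 * K) (a := -X) (q := X ^ 2) (dvd_pow_self _ (by simp)) (by omega) (by omega)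
    simp only [map_mul, map_add, map_one] at *
    rw [this]
    linear_combination pi M (X ^ 4) * pi M (qp (-X : A) (X ^ 2) (2 * K)) * hu + pi M (X ^ 4) * pi M (ex 4 (by simp) (ip X (2 * K))) * hpsi
  rw [pi_coeff h1 hn, map_add, coeff_X_pow_mul', if_pos h4] at hr
  have := congrArg Complex.re hr
  simp only [Complex.add_re, Complex.ofReal_re] at this
  have := Psi_le M n
  linarith

/-- coefficients of `(-q;q^2)` -/
theorem maj_qn (j N : ℕ) : maj (qp (-X ^ j) (X ^ 2) N) (qp (-X ^ j) (X ^ 2) N) := by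
  induction N with
  | zero => simpa [qp] using maj_one
  | succ N ih =>
    rw [qp_succ]
    apply maj_mul ih
    have := maj_add maj_one (maj_X (j + 2 * N))
    rw [show (1 : A) - -X ^ j * (X ^ 2) ^ N = 1 + X ^ (j + 2 * N) by rw [← pow_mul, pow_add]; ring]
    exact this

theorem g_mono (N : ℕ) : maj (qp (-X ^ 3) (X ^ 2) (N + 1) - X ^ 2 * (qp (-X ^ 3) (X ^ 2) N - 1)) (qp (-X ^ 3) (X ^ 2) (N + 1) - X ^ 2 * (qp (-X ^ 3) (X ^ 2) N - 1)) := by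
  induction N with
  | zero =>
    have := maj_add maj_one (maj_X 3)
    simpa [qp] using this
  | succ N ih =>
    have e : qp (-X ^ 3 : A) (X ^ 2) (N + 1 + 1) - X ^ 2 * (qp (-X ^ 3) (X ^ 2) (N + 1) - 1) =
       (qp (-X ^ 3) (X ^ 2) (N + 1) - X ^ 2 * (qp (-X ^ 3) (X ^ 2) N - 1)) + X ^ (4 * N + 8) * qp (-X ^ 3) (X ^ 2) N := by
      rw [qp_succ _ _ (N + 1), qp_succ _ _ N, ← pow_mul, ← pow_mul]
      ring
    rw [e]
    exact maj_add ih (maj_mul (maj_X _) (maj_qn 3 N))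

theorem qn_dvd (k N : ℕ) : (X : A) ^ k ∣ qp (-X ^ k) (X ^ 2) N - 1 := by
  induction N with
  | zero => simp [qp]
  | succ N ih =>
    obtain ⟨c, hc⟩ := ih
    refine ⟨c + qp (-X ^ k) (X ^ 2) N * (X ^ 2) ^ N, ?_⟩
    rw [qp_succ]; linear_combination hc

theorem dr_props (N : ℕ) (hN : 2 ≤ N) : ∃ dr : ℕ → ℝ, (∀ m, coeff m (qp (-X : A) (X ^ 2) N) = (dr m : ℂ)) ∧ (∀ m, 0 ≤ dr m) ∧
    dr 0 = 1 ∧ dr 1 = 1 ∧ dr 2 = 0 ∧ dr 3 = 1 ∧ ∀ m, 2 ≤ m → m < 2 * N → dr m ≤ dr (m + 1) := by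
  obtain ⟨K, rfl⟩ := Nat.exists_eq_add_of_le' hN
  have hd := maj_qn 1 (K + 2)
  rw [pow_one] at hd
  choose dr h1 h2 using hd
  have e1 : qp (-X : A) (X ^ 2) (K + 2) = (1 + X) * qp (-X ^ 3) (X ^ 2) (K + 1) := by
    rw [qp_succ']; congr 1
    · ring
    · congr 1; ring
  have e2 : pi 5 (qp (-X : A) (X ^ 2) (K + 2)) = pi 5 (1 + X + X ^ 3 + X ^ 4) := by
    have : qp (-X ^ 3 : A) (X ^ 2) (K + 1) = (1 + X ^ 3) * qp (-X ^ 5) (X ^ 2) K := by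
      rw [qp_succ']; congr 1
      · ring
      · congr 1; ring
    rw [e1, this, pi_eq]
    obtain ⟨c, hc⟩ := qn_dvd 5 K
    refine ⟨(1 + X) * (1 + X ^ 3) * c, ?_⟩
    linear_combination (1 + X) * (1 + X ^ 3) * hc
  have hv : ∀ m, m < 5 → dr m = (coeff m (1 + X + X ^ 3 + X ^ 4 : A)).re := by
    intro m hm
    rw [← pi_coeff e2 hm, h1, Complex.ofReal_re]
  refine ⟨dr, h1, fun m => (norm_nonneg _).trans (h2 m), ?_, ?_, ?_, ?_, ?_⟩
  · rw [hv 0 (by norm_num)]; simp [coeff_X_pow]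
  · rw [hv 1 (by norm_num)]; simp [coeff_X_pow, coeff_X, coeff_one]
  · rw [hv 2 (by norm_num)]; simp [coeff_X_pow, coeff_X, coeff_one]
  · rw [hv 3 (by norm_num)]; simp [coeff_X_pow, coeff_X, coeff_one]
  · intro m hm hmN
    obtain ⟨j, rfl⟩ := Nat.exists_eq_add_of_le' hm
    choose g hg1 hg2 using maj_qn 3 (K + 1)
    have hgd : ∀ m, dr (m + 1) = g (m + 1) + g m := by
      intro m
      have := h1 (m + 1)
      rw [e1, add_mul, one_mul, map_add, coeff_succ_X_mul, hg1, hg1] at this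
      exact_mod_cast this.symm
    rw [hgd, show j + 2 = j + 1 + 1 by ring, hgd]
    have : g (j + 1) ≤ g (j + 1 + 1 + 1) := by
      obtain ⟨r, hr, hn⟩ := g_mono (K + 1) (j + 3)
      have hr0 := (norm_nonneg _).trans hn
      rw [qp_succ _ _ (K + 1)] at hr
      have ee : qp (-X ^ 3 : A) (X ^ 2) (K + 1) * (1 - -X ^ 3 * (X ^ 2) ^ (K + 1)) - X ^ 2 * (qp (-X ^ 3) (X ^ 2) (K + 1) - 1) = qp (-X ^ 3) (X ^ 2) (K + 1) + X ^ (2 * K + 5) * qp (-X ^ 3) (X ^ 2) (K + 1) - X ^ 2 * qp (-X ^ 3) (X ^ 2) (K + 1) + X ^ 2 := by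
        rw [← pow_mul]; ring
      rw [ee, map_add, map_sub, map_add, coeff_X_pow_mul', if_neg (by omega), coeff_X_pow_mul', if_pos (by omega), coeff_X_pow, if_neg (by omega), hg1, show j + 3 - 2 = j + 1 by omega, hg1] at hr
      have : g (j + 3) - g (j + 1) = r := by
        have h' : ((g (j + 3) - g (j + 1) : ℝ) : ℂ) = r := by rw [← hr]; push_cast; ring
        exact_mod_cast h'
      show g (j + 1) ≤ g (j + 3)
      linarith
    linarith

end RC

set_option linter.all false
namespace RC
open PowerSeries Finset

theorem o_coeff (N m : ℕ) : coeff m (qp (X : A) (X ^ 2) N) = (-1) ^ m * coeff m (qp (-X : A) (X ^ 2) N) := by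
  have : qp (X : A) (X ^ 2) N = rescale (-1 : ℂ) (qp (-X : A) (X ^ 2) N) := by
    rw [map_qp, map_neg, map_pow, rescale_X]
    simp
  rw [this, coeff_rescale]

def sgr (a : ℕ) : ℝ := if a % 4 = 0 ∨ a % 4 = 3 then 1 else -1

theorem sg_r (a : ℕ) : sg a = (sgr a : ℂ) := by unfold sg sgr; split_ifs <;> simp

def DD (dr : ℕ → ℝ) (n k : ℕ) : ℝ := if k ≤ n then dr (n - k) else 0

theorem coeff_T3 (M n : ℕ) (f : A) : coeff n (T3 M * f) = coeff n f + 2 * ∑ i ∈ range (M + 1), if (i + 1) ^ 2 ≤ n then coeff (n - (i + 1) ^ 2) f else 0 := by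
  unfold T3
  rw [add_mul, one_mul, map_add, mul_assoc, show (2 : A) = C 2 from (map_ofNat _ _).symm, coeff_C_mul, sum_mul, map_sum]
  simp only [coeff_X_pow_mul']

theorem coeff_T4 (M n : ℕ) (f : A) : coeff n (T4 M * f) = coeff n f + 2 * ∑ i ∈ range (M + 1), if 2 * (i + 1) ^ 2 ≤ n then (-1) ^ (i + 1) * coeff (n - 2 * (i + 1) ^ 2) f else 0 := by
  unfold T4
  rw [add_mul, one_mul, map_add, mul_assoc, show (2 : A) = C 2 from (map_ofNat _ _).symm, coeff_C_mul, sum_mul, map_sum]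
  congr 2
  apply sum_congr rfl
  intro i _
  rw [show (-1 : A) = C (-1) by simp, ← map_pow, mul_assoc, coeff_C_mul, coeff_X_pow_mul']
  split_ifs <;> simp

theorem formula {n : ℕ} (hn : 4 ≤ n) (h4 : ¬ 4 ∣ n) : ∃ (dr : ℕ → ℝ) (t : ℝ), (∀ m, 0 ≤ dr m) ∧
    dr 0 = 1 ∧ dr 1 = 1 ∧ dr 2 = 0 ∧ dr 3 = 1 ∧ (∀ m, 2 ≤ m → m ≤ n → dr m ≤ dr (m + 1)) ∧ |t| ≤ 1 + dr (n - 4) ∧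
    4 * ((rankCount 0 8 n : ℝ) - crankCount 0 8 n) = dr n * (1 - (-1) ^ n + 2 * sgr n) +
      ∑ i ∈ range (n + 2), 2 * (1 + 2 * sgr (n - (i + 1) ^ 2)) * DD dr n ((i + 1) ^ 2) -
      2 * (-1) ^ n * ∑ i ∈ range (n + 2), (-1) ^ (i + 1) * DD dr n (2 * (i + 1) ^ 2) - 2 * t := by
  obtain ⟨dr, h1, h0, d0, d1, d2, d3, hm⟩ := dr_props (4 * n + 8) (by omega)
  refine ⟨dr, (coeff n (Es (n + 1) * qp (X ^ 4) (X ^ 8) (4 * n + 8))).re, h0, d0, d1, d2, d3, fun m a b => hm m a (by omega), ?_, ?_⟩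
  · refine (Complex.abs_re_le_norm _).trans ?_
    have := T4_bound (M := n + 1) (N := 4 * n + 8) (n := n) (by omega) hn (by omega)
    rwa [h1, Complex.ofReal_re] at this
  · have h := diff_eq (by omega) h4
    rw [map_add, show (2 : A) = C 2 from (map_ofNat _ _).symm, show (4 : A) = C 4 from (map_ofNat _ _).symm, coeff_C_mul, coeff_C_mul, map_sub, map_sub,
      coeff_T3, coeff_T3, coeff_T4, tau_coeff, o_coeff] at h
    have e1 : ∀ i, (if (i + 1) ^ 2 ≤ n then coeff (n - (i + 1) ^ 2) (qp (-X : A) (X ^ 2) (4 * n + 8)) else 0) = ((DD dr n ((i + 1) ^ 2) : ℝ) : ℂ) := by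
      intro i; unfold DD; split_ifs
      · rw [h1]
      · simp
    have e2 : ∀ i, (if (i + 1) ^ 2 ≤ n then coeff (n - (i + 1) ^ 2) (tau (qp (-X : A) (X ^ 2) (4 * n + 8))) else 0) = ((sgr (n - (i + 1) ^ 2) * DD dr n ((i + 1) ^ 2) : ℝ) : ℂ) := by
      intro i; unfold DD; split_ifs
      · rw [tau_coeff, h1, sg_r]; push_cast; rfl
      · simp
    have e3 : ∀ i, (if 2 * (i + 1) ^ 2 ≤ n then (-1) ^ (i + 1) * coeff (n - 2 * (i + 1) ^ 2) (qp (X : A) (X ^ 2) (4 * n + 8)) else 0) = (((-1) ^ n * ((-1) ^ (i + 1) * DD dr n (2 * (i + 1) ^ 2)) : ℝ) : ℂ) := by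
      intro i; unfold DD; split_ifs with hi
      · rw [o_coeff, h1]; push_cast
        have : (-1 : ℂ) ^ n = (-1) ^ (n - 2 * (i + 1) ^ 2) := by
          conv_lhs => rw [← Nat.sub_add_cancel hi, pow_add, pow_mul]
          simp
        rw [this]; ring
      · simp
    simp only [e1, e2, e3] at h
    simp only [h1, sg_r] at h
    have h' := congrArg Complex.re h
    rw [← Complex.ofReal_sum, ← Complex.ofReal_sum, ← Complex.ofReal_sum] at h'
    have er : ∀ x : ℝ, ((-1 : ℂ) ^ n * x).re = (-1) ^ n * x := by
      intro x
      rw [show (-1 : ℂ) ^ n * x = (((-1) ^ n * x : ℝ) : ℂ) by push_cast; rfl, Complex.ofReal_re]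
    simp only [Complex.sub_re, Complex.add_re, Complex.natCast_re, Complex.ofReal_re, er, Complex.re_ofReal_mul, Complex.mul_re, Complex.re_ofNat, Complex.im_ofNat, Complex.natCast_im, Complex.ofReal_im, mul_zero, zero_mul, sub_zero] at h'
    have s1 : ∑ i ∈ range (n + 2), 2 * (1 + 2 * sgr (n - (i + 1) ^ 2)) * DD dr n ((i + 1) ^ 2) = 2 * ∑ i ∈ range (n + 2), DD dr n ((i + 1) ^ 2) + 4 * ∑ i ∈ range (n + 2), sgr (n - (i + 1) ^ 2) * DD dr n ((i + 1) ^ 2) := by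
      rw [mul_sum, mul_sum, ← sum_add_distrib]; apply sum_congr rfl; intro i _; ring
    rw [← mul_sum] at h'
    rw [s1]
    simp only [show n + 1 + 1 = n + 2 by ring] at h'
    linear_combination h' / 2

theorem alt_nonneg (a : ℕ → ℝ) (h1 : ∀ j, 0 ≤ a (2 * j)) (h2 : ∀ j, 0 ≤ a (2 * j) + a (2 * j + 1)) (K : ℕ) : 0 ≤ ∑ i ∈ range K, a i := by
  have h : ∀ j, 0 ≤ ∑ i ∈ range (2 * j), a i := by
    intro j
    induction j with
    | zero => simp
    | succ j ih =>
      rw [show 2 * (j + 1) = 2 * j + 1 + 1 by ring, sum_range_succ, sum_range_succ]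
      linarith [h2 j]
  rcases Nat.even_or_odd' K with ⟨j, rfl | rfl⟩
  · exact h j
  · rw [sum_range_succ]; linarith [h j, h1 j]

theorem alt1 (f : ℕ → ℝ) (h0 : ∀ i, 0 ≤ f i) (h1 : ∀ i, f (i + 1) ≤ f i) (K : ℕ) : 0 ≤ ∑ i ∈ range K, (-1) ^ i * f i := by
  apply alt_nonneg
  · intro j; simpa [pow_mul] using h0 (2 * j)
  · intro j; simpa [pow_mul, pow_succ] using h1 (2 * j)

theorem alt2 (f : ℕ → ℝ) (h0 : ∀ i, 0 ≤ f i) (h1 : ∀ i, f (i + 1) ≤ f i) (K : ℕ) (c : ℕ → ℝ) (hc : ∀ i, c i = if i % 2 = 0 then 6 else -2) :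
    4 * f 0 ≤ ∑ i ∈ range (K + 1), c i * f i := by
  have e : ∀ i ∈ range (K + 1), c i * f i = 2 * ((-1) ^ i * f i) + if i % 2 = 0 then 4 * f i else 0 := by
    intro i _
    rw [hc]
    split_ifs with h
    · rw [Even.neg_one_pow (Nat.even_iff.2 h)]; ring
    · rw [Odd.neg_one_pow (Nat.odd_iff.2 (by omega))]; ring
  rw [sum_congr rfl e, sum_add_distrib, ← mul_sum]
  have := alt1 f h0 h1 (K + 1)
  have h3 := single_le_sum (f := fun i => if i % 2 = 0 then 4 * f i else 0) (s := range (K + 1)) (fun i _ => by split_ifs <;> [linarith [h0 i]; exact le_refl _]) (show 0 ∈ range (K + 1) by simp)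
  simp only [Nat.zero_mod, if_true] at h3
  linarith

section
variable {dr : ℕ → ℝ} {n : ℕ}

theorem dr_mono (h0 : ∀ m, 0 ≤ dr m) (d0 : dr 0 = 1) (d1 : dr 1 = 1) (d3 : dr 3 = 1)
    (hm : ∀ m, 2 ≤ m → m ≤ n → dr m ≤ dr (m + 1)) {a b : ℕ} (ha : 3 ≤ a) (hb : b ≤ a) (han : a ≤ n) : dr b ≤ dr a := by
  have key : ∀ b, 2 ≤ b → ∀ c, b + c ≤ n → dr b ≤ dr (b + c) := by
    intro b hb c
    induction c with
    | zero => intro _; exact le_refl _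
    | succ c ih => intro h; exact (ih (by omega)).trans (hm _ (by omega) (by omega))
  have h3 : 1 ≤ dr a := by
    have := key 3 (by omega) (a - 3) (by omega)
    rw [d3, show 3 + (a - 3) = a by omega] at this; exact this
  rcases Nat.lt_or_ge b 2 with h | h
  · interval_cases b
    · rw [d0]; exact h3
    · rw [d1]; exact h3
  · have := key b h (a - b) (by omega)
    rwa [show b + (a - b) = a by omega] at this

theorem DD_nonneg (h0 : ∀ m, 0 ≤ dr m) (k : ℕ) : 0 ≤ DD dr n k := by
  unfold DD; split_ifs; exacts [h0 _, le_refl _]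

theorem DD_mono (h0 : ∀ m, 0 ≤ dr m) (d0 : dr 0 = 1) (d1 : dr 1 = 1) (d3 : dr 3 = 1)
    (hm : ∀ m, 2 ≤ m → m ≤ n → dr m ≤ dr (m + 1)) {k k' : ℕ} (hk : k ≤ k') (h : k + 3 ≤ k' ∨ k + 3 ≤ n) : DD dr n k' ≤ DD dr n k := by
  by_cases hk' : k' ≤ n
  · unfold DD
    rw [if_pos hk', if_pos (by omega)]
    exact dr_mono h0 d0 d1 d3 hm (by omega) (by omega) (by omega)
  · have : DD dr n k' = 0 := by unfold DD; rw [if_neg hk']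
    rw [this]; exact DD_nonneg h0 k

theorem second (h0 : ∀ m, 0 ≤ dr m) (d0 : dr 0 = 1) (d1 : dr 1 = 1) (d3 : dr 3 = 1)
    (hm : ∀ m, 2 ≤ m → m ≤ n → dr m ≤ dr (m + 1)) : - DD dr n 2 ≤ ∑ i ∈ range (n + 2), (-1) ^ (i + 1) * DD dr n (2 * (i + 1) ^ 2) := by
  rw [sum_range_succ']
  have := alt1 (fun i => DD dr n (2 * (i + 1 + 1) ^ 2)) (fun i => DD_nonneg h0 _) (fun i => DD_mono h0 d0 d1 d3 hm (by gcongr; omega) (Or.inl (by ring_nf; omega))) (n + 1)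
  have e : ∑ i ∈ range (n + 1), (-1 : ℝ) ^ (i + 1 + 1) * DD dr n (2 * (i + 1 + 1) ^ 2) = ∑ i ∈ range (n + 1), (-1) ^ i * DD dr n (2 * (i + 1 + 1) ^ 2) := by
    apply sum_congr rfl; intro i _; ring
  rw [e]
  norm_num
  linarith

end

theorem sq_mod (i : ℕ) : (i % 2 = 0 ∧ (i + 1) ^ 2 % 4 = 1) ∨ (i % 2 = 1 ∧ (i + 1) ^ 2 % 4 = 0) := by
  rcases Nat.even_or_odd' i with ⟨j, rfl | rfl⟩
  · left; refine ⟨by omega, ?_⟩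
    rw [show (2 * j + 1) ^ 2 = 1 + 4 * (j * j + j) by ring, Nat.add_mul_mod_self_left]
  · right; refine ⟨by omega, ?_⟩
    rw [show (2 * j + 1 + 1) ^ 2 = 4 * ((j + 1) * (j + 1)) by ring, Nat.mul_mod_right]

theorem case1 {n : ℕ} (hn : 9 ≤ n) (h1 : n % 4 = 1) : crankCount 0 8 n ≤ rankCount 0 8 n := by
  obtain ⟨dr, t, h0, d0, d1, d2, d3, hm, ht, h⟩ := formula (n := n) (by omega) (by omega)
  have mono := fun {k k' : ℕ} (a) (b) => DD_mono (k := k) (k' := k') h0 d0 d1 d3 hm a b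
  have hs := second h0 d0 d1 d3 hm
  have ho : (-1 : ℝ) ^ n = -1 := Odd.neg_one_pow (Nat.odd_iff.2 (by omega))
  have hsg : sgr n = -1 := by unfold sgr; rw [if_neg (by omega)]
  rw [ho, hsg] at h
  have e : ∀ i ∈ range (n + 2), 2 * (1 + 2 * sgr (n - (i + 1) ^ 2)) * DD dr n ((i + 1) ^ 2) = (if i % 2 = 0 then 6 else -2) * DD dr n ((i + 1) ^ 2) := by
    intro i _
    by_cases hi : (i + 1) ^ 2 ≤ n
    · congr 1
      unfold sgr
      rcases sq_mod i with ⟨a, b⟩ | ⟨a, b⟩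
      · rw [if_pos (by omega), if_pos a]; norm_num
      · rw [if_neg (by omega), if_neg (by omega)]; norm_num
    · have : DD dr n ((i + 1) ^ 2) = 0 := by unfold DD; rw [if_neg hi]
      rw [this]; ring
  rw [sum_congr rfl e, sum_range_succ', sum_range_succ'] at h
  obtain ⟨K, rfl⟩ := Nat.exists_eq_add_of_le' (show 1 ≤ n by omega)
  have ha := alt2 (fun i => DD dr (K + 1) ((i + 1 + 1 + 1) ^ 2)) (fun i => DD_nonneg h0 _) (fun i => mono (by gcongr; omega) (Or.inl (by ring_nf; omega))) K (fun i => if (i + 1 + 1) % 2 = 0 then 6 else -2) (fun i => by simp only [show (i + 1 + 1) % 2 = i % 2 by omega])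
  norm_num at ha h
  have m1 : DD dr (K + 1) 2 ≤ DD dr (K + 1) 1 := mono (by omega) (Or.inr (by omega))
  have m2 : DD dr (K + 1) 4 ≤ DD dr (K + 1) 1 := mono (by omega) (Or.inr (by omega))
  have m3 : 1 ≤ DD dr (K + 1) 9 := by
    unfold DD
    rw [if_pos hn, ← d0]
    rcases Nat.eq_or_lt_of_le hn with hh | hh
    · rw [← hh]
    · exact dr_mono h0 d0 d1 d3 hm (by omega) (by omega) (by omega)
  have m4 : dr (K + 1 - 4) = DD dr (K + 1) 4 := by unfold DD; rw [if_pos (by omega)]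
  rw [m4] at ht
  have := (abs_le.1 ht).2
  have : (crankCount 0 8 (K + 1) : ℝ) ≤ rankCount 0 8 (K + 1) := by linarith
  exact_mod_cast this

theorem case3 {n : ℕ} (hn : 7 ≤ n) (h1 : n % 4 = 3) : crankCount 0 8 n ≤ rankCount 0 8 n := by
  obtain ⟨dr, t, h0, d0, d1, d2, d3, hm, ht, h⟩ := formula (n := n) (by omega) (by omega)
  have mono := fun {k k' : ℕ} (a) (b) => DD_mono (k := k) (k' := k') h0 d0 d1 d3 hm a b
  have hs := second h0 d0 d1 d3 hm
  have ho : (-1 : ℝ) ^ n = -1 := Odd.neg_one_pow (Nat.odd_iff.2 (by omega))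
  have hsg : sgr n = 1 := by unfold sgr; rw [if_pos (by omega)]
  rw [ho, hsg] at h
  have e : ∀ i ∈ range (n + 2), 2 * (1 + 2 * sgr (n - (i + 1) ^ 2)) * DD dr n ((i + 1) ^ 2) = (if (i + 1) % 2 = 0 then 6 else -2) * DD dr n ((i + 1) ^ 2) := by
    intro i _
    by_cases hi : (i + 1) ^ 2 ≤ n
    · congr 1
      unfold sgr
      rcases sq_mod i with ⟨a, b⟩ | ⟨a, b⟩
      · rw [if_neg (by omega), if_neg (by omega)]; norm_num
      · rw [if_pos (by omega), if_pos (by omega)]; norm_num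
    · have : DD dr n ((i + 1) ^ 2) = 0 := by unfold DD; rw [if_neg hi]
      rw [this]; ring
  rw [sum_congr rfl e, sum_range_succ'] at h
  have ha := alt2 (fun i => DD dr n ((i + 1 + 1) ^ 2)) (fun i => DD_nonneg h0 _) (fun i => mono (by gcongr; omega) (Or.inl (by ring_nf; omega))) n (fun i => if (i + 1 + 1) % 2 = 0 then 6 else -2) (fun i => by simp only [show (i + 1 + 1) % 2 = i % 2 by omega])
  norm_num at ha h
  have m1 : DD dr n 1 ≤ DD dr n 0 := mono (by omega) (Or.inr (by omega))
  have m2 : DD dr n 2 ≤ DD dr n 0 := mono (by omega) (Or.inr (by omega))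
  have m0 : dr n = DD dr n 0 := by unfold DD; simp
  have m4 : dr (n - 4) = DD dr n 4 := by unfold DD; rw [if_pos (by omega)]
  have m3 : 1 ≤ dr (n - 4) := by
    rw [← d0]; exact dr_mono h0 d0 d1 d3 hm (by omega) (by omega) (by omega)
  rw [m4] at ht m3
  rw [m0] at h
  have := (abs_le.1 ht).2
  have : (crankCount 0 8 n : ℝ) ≤ rankCount 0 8 n := by linarith
  exact_mod_cast this

theorem case2 {n : ℕ} (hn : 10 ≤ n) (h1 : n % 4 = 2) : rankCount 0 8 n ≤ crankCount 0 8 n := by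
  obtain ⟨dr, t, h0, d0, d1, d2, d3, hm, ht, h⟩ := formula (n := n) (by omega) (by omega)
  have mono := fun {k k' : ℕ} (a) (b) => DD_mono (k := k) (k' := k') h0 d0 d1 d3 hm a b
  have hs := second h0 d0 d1 d3 hm
  have ho : (-1 : ℝ) ^ n = 1 := Even.neg_one_pow (Nat.even_iff.2 (by omega))
  have hsg : sgr n = -1 := by unfold sgr; rw [if_neg (by omega)]
  rw [ho, hsg] at h
  have e : ∀ i ∈ range (n + 2), 2 * (1 + 2 * sgr (n - (i + 1) ^ 2)) * DD dr n ((i + 1) ^ 2) = (-2) * DD dr n ((i + 1) ^ 2) := by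
    intro i _
    by_cases hi : (i + 1) ^ 2 ≤ n
    · congr 1
      unfold sgr
      rcases sq_mod i with ⟨a, b⟩ | ⟨a, b⟩
      · rw [if_neg (by omega)]; norm_num
      · rw [if_neg (by omega)]; norm_num
    · have : DD dr n ((i + 1) ^ 2) = 0 := by unfold DD; rw [if_neg hi]
      rw [this]; ring
  rw [sum_congr rfl e, ← mul_sum, sum_range_succ', sum_range_succ'] at h
  have hp : 0 ≤ ∑ i ∈ range n, DD dr n ((i + 1 + 1 + 1) ^ 2) := sum_nonneg fun i _ => DD_nonneg h0 _
  norm_num at hp h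
  have m2 : DD dr n 2 ≤ DD dr n 0 := mono (by omega) (Or.inr (by omega))
  have m0 : dr n = DD dr n 0 := by unfold DD; simp
  have m4 : dr (n - 4) = DD dr n 4 := by unfold DD; rw [if_pos (by omega)]
  have m1 : 1 ≤ DD dr n 1 := by
    unfold DD
    rw [if_pos (by omega), ← d0]; exact dr_mono h0 d0 d1 d3 hm (by omega) (by omega) (by omega)
  rw [m4] at ht
  rw [m0] at h
  have := (abs_le.1 ht).1
  have : (rankCount 0 8 n : ℝ) ≤ crankCount 0 8 n := by linarith
  exact_mod_cast this

end RC

theorem stmt_10 :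
    (∀ n : ℕ, 2 ≤ n → crankCount 0 8 (4 * n + 1) ≤ rankCount 0 8 (4 * n + 1)) ∧
    (∀ n : ℕ, 2 ≤ n → rankCount 0 8 (4 * n + 2) ≤ crankCount 0 8 (4 * n + 2)) ∧
    (∀ n : ℕ, 1 ≤ n → crankCount 0 8 (4 * n + 3) ≤ rankCount 0 8 (4 * n + 3)) :=
  ⟨fun n hn => RC.case1 (by omega) (by omega), fun n hn => RC.case2 (by omega) (by omega), fun n hn => RC.case3 (by omega) (by omega)⟩
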